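/- Let h(u,v) = \sum_{i=0}^{12} \binom{12}{i} \alpha_i u^i v^{12-i} with (\alpha_0, \dots, \alpha_{12}) = (-395, -153, -92, -26, 24, 40, 304/7, 48, 64, 64, 0, -128, -512). Define g = (1/132^2)(h_{uu} h_{vv} - h_{uv}^2) and f = (1/240)(h_u g_v - h_v g_u), where subscripts denote partial derivatives with respect to u and v; then f is a binary form of degree 30 with integer coefficients. There are no integers u, v, y with (u, v) \neq (0, 0) and y^2 = f(u, v). -/

import Mathlib

open MvPolynomial

/-- The coefficient vector `(α₀, …, α₁₂)`. -/
noncomputable def alphaC24 : Fin 13 → ℚ := ![-395, -153, -92, -26, 24, 40, 304/7, 48, 64, 64, 0, -128, -512]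

/-- The binary form `h(u,v) = ∑ i, (12 choose i) αᵢ uⁱ v^(12-i)`,
as a polynomial in the two variables `X 0 = u` and `X 1 = v`. -/
noncomputable def hC24 : MvPolynomial (Fin 2) ℚ :=
  ∑ i : Fin 13, C ((Nat.choose 12 i : ℚ) * alphaC24 i) * X 0 ^ (i : ℕ) * X 1 ^ (12 - (i : ℕ))

/-- `g = (1/132²)·(h_uu h_vv - h_uv²)`. -/
noncomputable def gC24 : MvPolynomial (Fin 2) ℚ :=
  C ((1 : ℚ) / 132 ^ 2) *
    (pderiv 0 (pderiv 0 hC24) * pderiv 1 (pderiv 1 hC24) -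
      pderiv 1 (pderiv 0 hC24) * pderiv 1 (pderiv 0 hC24))

/-- `f = (1/240)·(h_u g_v - h_v g_u)`. -/
noncomputable def fC24 : MvPolynomial (Fin 2) ℚ :=
  C ((1 : ℚ) / 240) *
    (pderiv 0 hC24 * pderiv 1 gC24 - pderiv 1 hC24 * pderiv 0 gC24)

section

/-- The integral form of degree thirty. -/
def FZ {R : Type*} [CommRing R] (u v : R) : R :=
    (-2730128) * u^0 * v^30 + (-44424330) * u^1 * v^29 + (-222407670) * u^2 * v^28 + (-660279540) * u^3 * v^27
    + (-2555226540) * u^4 * v^26 + (-12752601984) * u^5 * v^25 + (-49309216200) * u^6 * v^24 + (-139926484800)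
    * u^7 * v^23 + (-306268257600) * u^8 * v^22 + (-539008569600) * u^9 * v^21 + (-784750579200) * u^10 * v^20
    + (-992175840000) * u^11 * v^19 + (-1208091744000) * u^12 * v^18 + (-1532926080000) * u^13 * v^17 +
    (-1861410240000) * u^14 * v^16 + (-1826663915520) * u^15 * v^15 + (-1191302553600) * u^16 * v^14 +
    (-210229862400) * u^17 * v^13 + (552826675200) * u^18 * v^12 + (784366387200) * u^19 * v^11 +
    (637820190720) * u^20 * v^10 + (413083238400) * u^21 * v^9 + (250800537600) * u^22 * v^8 + (148812595200)
    * u^23 * v^7 + (80393011200) * u^24 * v^6 + (36125540352) * u^25 * v^5 + (12315525120) * u^26 * v^4 +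
    (2888826880) * u^27 * v^3 + (456130560) * u^28 * v^2 + (62914560) * u^29 * v^1 + (6291456) * u^30 * v^0

/-- The integral form of degree twelve. -/
def HZ {R : Type*} [CommRing R] (u v : R) : R :=
    (-395) * u^0 * v^12 + (-1836) * u^1 * v^11 + (-6072) * u^2 * v^10 + (-5720) * u^3 * v^9 + (11880) * u^4 *
    v^8 + (31680) * u^5 * v^7 + (40128) * u^6 * v^6 + (38016) * u^7 * v^5 + (31680) * u^8 * v^4 + (14080) *
    u^9 * v^3 + (-1536) * u^11 * v^1 + (-512) * u^12 * v^0

/-- The integral form of degree twenty. -/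
def GZ {R : Type*} [CommRing R] (u v : R) : R :=
    (12931) * u^0 * v^20 + (-38060) * u^1 * v^19 + (-852340) * u^2 * v^18 + (-3456480) * u^3 * v^17 +
    (-8569380) * u^4 * v^16 + (-18666816) * u^5 * v^15 + (-39982080) * u^6 * v^14 + (-71829120) * u^7 * v^13 +
    (-97693440) * u^8 * v^12 + (-89789440) * u^9 * v^11 + (-45021184) * u^10 * v^10 + (-8852480) * u^11 * v^9
    + (-13278720) * u^12 * v^8 + (-33853440) * u^13 * v^7 + (-39690240) * u^14 * v^6 + (-27549696) * u^15 *
    v^5 + (-12840960) * u^16 * v^4 + (-4669440) * u^17 * v^3 + (-1556480) * u^18 * v^2 + (-327680) * u^19 *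
    v^1 + (-16384) * u^20 * v^0

theorem hC24_eq : hC24 = HZ (X 0) (X 1) := by
  have c : ∀ q : ℚ, ∀ z : ℤ, q = z → (C q : MvPolynomial (Fin 2) ℚ) = (z : MvPolynomial (Fin 2) ℚ) := by
    intro q z h; rw [h]; simp
  unfold hC24 alphaC24 HZ
  simp only [Fin.sum_univ_succ, Fin.sum_univ_zero]
  simp only [Fin.val_zero, Fin.val_succ, Fin.succ_zero_eq_one, Matrix.cons_val_zero, Matrix.cons_val_succ, Finset.univ_eq_empty, Finset.sum_empty]
  have e0 := c ((Nat.choose 12 0 : ℚ) * (-395)) (-395) (by norm_num [Nat.choose])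
  have e1 := c ((Nat.choose 12 1 : ℚ) * (-153)) (-1836) (by norm_num [Nat.choose])
  have e2 := c ((Nat.choose 12 2 : ℚ) * (-92)) (-6072) (by norm_num [Nat.choose])
  have e3 := c ((Nat.choose 12 3 : ℚ) * (-26)) (-5720) (by norm_num [Nat.choose])
  have e4 := c ((Nat.choose 12 4 : ℚ) * (24)) (11880) (by norm_num [Nat.choose])
  have e5 := c ((Nat.choose 12 5 : ℚ) * (40)) (31680) (by norm_num [Nat.choose])
  have e6 := c ((Nat.choose 12 6 : ℚ) * (304/7)) (40128) (by norm_num [Nat.choose])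
  have e7 := c ((Nat.choose 12 7 : ℚ) * (48)) (38016) (by norm_num [Nat.choose])
  have e8 := c ((Nat.choose 12 8 : ℚ) * (64)) (31680) (by norm_num [Nat.choose])
  have e9 := c ((Nat.choose 12 9 : ℚ) * (64)) (14080) (by norm_num [Nat.choose])
  have e10 := c ((Nat.choose 12 10 : ℚ) * (0)) (0) (by norm_num [Nat.choose])
  have e11 := c ((Nat.choose 12 11 : ℚ) * (-128)) (-1536) (by norm_num [Nat.choose])
  have e12 := c ((Nat.choose 12 12 : ℚ) * (-512)) (-512) (by norm_num [Nat.choose])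
  norm_num at *
  simp only [*]
  ring

end

section

/-- Partial derivative of `HZ` in variable 0. -/
def Hu {R : Type*} [CommRing R] (u v : R) : R :=
    (-1836) * u^0 * v^11 + (-12144) * u^1 * v^10 + (-17160) * u^2 * v^9 + (47520) * u^3 * v^8 + (158400) * u^4
    * v^7 + (240768) * u^5 * v^6 + (266112) * u^6 * v^5 + (253440) * u^7 * v^4 + (126720) * u^8 * v^3 +
    (-16896) * u^10 * v^1 + (-6144) * u^11 * v^0

/-- Partial derivative of `HZ` in variable 1. -/
def Hv {R : Type*} [CommRing R] (u v : R) : R :=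
    (-4740) * u^0 * v^11 + (-20196) * u^1 * v^10 + (-60720) * u^2 * v^9 + (-51480) * u^3 * v^8 + (95040) * u^4
    * v^7 + (221760) * u^5 * v^6 + (240768) * u^6 * v^5 + (190080) * u^7 * v^4 + (126720) * u^8 * v^3 +
    (42240) * u^9 * v^2 + (-1536) * u^11 * v^0

/-- Partial derivative of `Hu` in variable 0. -/
def Huu {R : Type*} [CommRing R] (u v : R) : R :=
    (-12144) * u^0 * v^10 + (-34320) * u^1 * v^9 + (142560) * u^2 * v^8 + (633600) * u^3 * v^7 + (1203840) *
    u^4 * v^6 + (1596672) * u^5 * v^5 + (1774080) * u^6 * v^4 + (1013760) * u^7 * v^3 + (-168960) * u^9 * v^1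
    + (-67584) * u^10 * v^0

/-- Partial derivative of `Hu` in variable 1. -/
def Huv {R : Type*} [CommRing R] (u v : R) : R :=
    (-20196) * u^0 * v^10 + (-121440) * u^1 * v^9 + (-154440) * u^2 * v^8 + (380160) * u^3 * v^7 + (1108800) *
    u^4 * v^6 + (1444608) * u^5 * v^5 + (1330560) * u^6 * v^4 + (1013760) * u^7 * v^3 + (380160) * u^8 * v^2 +
    (-16896) * u^10 * v^0

/-- Partial derivative of `Hv` in variable 1. -/
def Hvv {R : Type*} [CommRing R] (u v : R) : R :=
    (-52140) * u^0 * v^10 + (-201960) * u^1 * v^9 + (-546480) * u^2 * v^8 + (-411840) * u^3 * v^7 + (665280) *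
    u^4 * v^6 + (1330560) * u^5 * v^5 + (1203840) * u^6 * v^4 + (760320) * u^7 * v^3 + (380160) * u^8 * v^2 +
    (84480) * u^9 * v^1

/-- Partial derivative of `GZ` in variable 0. -/
def Gu {R : Type*} [CommRing R] (u v : R) : R :=
    (-38060) * u^0 * v^19 + (-1704680) * u^1 * v^18 + (-10369440) * u^2 * v^17 + (-34277520) * u^3 * v^16 +
    (-93334080) * u^4 * v^15 + (-239892480) * u^5 * v^14 + (-502803840) * u^6 * v^13 + (-781547520) * u^7 *
    v^12 + (-808104960) * u^8 * v^11 + (-450211840) * u^9 * v^10 + (-97377280) * u^10 * v^9 + (-159344640) *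
    u^11 * v^8 + (-440094720) * u^12 * v^7 + (-555663360) * u^13 * v^6 + (-413245440) * u^14 * v^5 +
    (-205455360) * u^15 * v^4 + (-79380480) * u^16 * v^3 + (-28016640) * u^17 * v^2 + (-6225920) * u^18 * v^1
    + (-327680) * u^19 * v^0

/-- Partial derivative of `GZ` in variable 1. -/
def Gv {R : Type*} [CommRing R] (u v : R) : R :=
    (258620) * u^0 * v^19 + (-723140) * u^1 * v^18 + (-15342120) * u^2 * v^17 + (-58760160) * u^3 * v^16 +
    (-137110080) * u^4 * v^15 + (-280002240) * u^5 * v^14 + (-559749120) * u^6 * v^13 + (-933778560) * u^7 *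
    v^12 + (-1172321280) * u^8 * v^11 + (-987683840) * u^9 * v^10 + (-450211840) * u^10 * v^9 + (-79672320) *
    u^11 * v^8 + (-106229760) * u^12 * v^7 + (-236974080) * u^13 * v^6 + (-238141440) * u^14 * v^5 +
    (-137748480) * u^15 * v^4 + (-51363840) * u^16 * v^3 + (-14008320) * u^17 * v^2 + (-3112960) * u^18 * v^1
    + (-327680) * u^19 * v^0


theorem pd0 (c : ℤ) (i j : ℕ) : pderiv (R := ℚ) (0 : Fin 2) ((c : MvPolynomial (Fin 2) ℚ) * X 0 ^ i * X 1 ^ j)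
    = ((c * i : ℤ) : MvPolynomial (Fin 2) ℚ) * X 0 ^ (i - 1) * X 1 ^ j := by
  have : (c : MvPolynomial (Fin 2) ℚ) = C (c : ℚ) := by simp
  rw [this, Derivation.leibniz, Derivation.leibniz, Derivation.leibniz_pow, Derivation.leibniz_pow, pderiv_C,
    pderiv_X_self, pderiv_X_of_ne (by decide)]
  simp only [smul_eq_mul, nsmul_eq_mul]
  push_cast
  simp
  ring

theorem pd1 (c : ℤ) (i j : ℕ) : pderiv (R := ℚ) (1 : Fin 2) ((c : MvPolynomial (Fin 2) ℚ) * X 0 ^ i * X 1 ^ j)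
    = ((c * j : ℤ) : MvPolynomial (Fin 2) ℚ) * X 0 ^ i * X 1 ^ (j - 1) := by
  have : (c : MvPolynomial (Fin 2) ℚ) = C (c : ℚ) := by simp
  rw [this, Derivation.leibniz, Derivation.leibniz, Derivation.leibniz_pow, Derivation.leibniz_pow, pderiv_C,
    pderiv_X_self, pderiv_X_of_ne (by decide)]
  simp only [smul_eq_mul, nsmul_eq_mul]
  push_cast
  simp
  ring

theorem pd0p (c i j : ℕ) [c.AtLeastTwo] : pderiv (R := ℚ) (0 : Fin 2) ((ofNat(c) : MvPolynomial (Fin 2) ℚ) * X 0 ^ i * X 1 ^ j)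
    = ((c : MvPolynomial (Fin 2) ℚ) * (i : MvPolynomial (Fin 2) ℚ)) * X 0 ^ (i - 1) * X 1 ^ j := by
  have := pd0 c i j
  push_cast at this
  exact this

theorem pd1p (c i j : ℕ) [c.AtLeastTwo] : pderiv (R := ℚ) (1 : Fin 2) ((ofNat(c) : MvPolynomial (Fin 2) ℚ) * X 0 ^ i * X 1 ^ j)
    = ((c : MvPolynomial (Fin 2) ℚ) * (j : MvPolynomial (Fin 2) ℚ)) * X 0 ^ i * X 1 ^ (j - 1) := by
  have := pd1 c i j
  push_cast at this
  exact this

theorem pd0n (c i j : ℕ) [c.AtLeastTwo] : pderiv (R := ℚ) (0 : Fin 2) ((-ofNat(c) : MvPolynomial (Fin 2) ℚ) * X 0 ^ i * X 1 ^ j)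
    = (-(c : MvPolynomial (Fin 2) ℚ) * (i : MvPolynomial (Fin 2) ℚ)) * X 0 ^ (i - 1) * X 1 ^ j := by
  have := pd0 (-c) i j
  push_cast at this
  exact this

theorem pd1n (c i j : ℕ) [c.AtLeastTwo] : pderiv (R := ℚ) (1 : Fin 2) ((-ofNat(c) : MvPolynomial (Fin 2) ℚ) * X 0 ^ i * X 1 ^ j)
    = (-(c : MvPolynomial (Fin 2) ℚ) * (j : MvPolynomial (Fin 2) ℚ)) * X 0 ^ i * X 1 ^ (j - 1) := by
  have := pd1 (-c) i j
  push_cast at this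
  exact this

theorem dHu : pderiv (R := ℚ) 0 (HZ (X 0 : MvPolynomial (Fin 2) ℚ) (X 1)) = Hu (X 0) (X 1) := by
  unfold HZ Hu
  simp only [map_add, pd0p, pd0n]
  push_cast
  ring

theorem dHv : pderiv (R := ℚ) 1 (HZ (X 0 : MvPolynomial (Fin 2) ℚ) (X 1)) = Hv (X 0) (X 1) := by
  unfold HZ Hv
  simp only [map_add, pd1p, pd1n]
  push_cast
  ring

theorem dHuu : pderiv (R := ℚ) 0 (Hu (X 0 : MvPolynomial (Fin 2) ℚ) (X 1)) = Huu (X 0) (X 1) := by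
  unfold Hu Huu
  simp only [map_add, pd0p, pd0n]
  push_cast
  ring

theorem dHuv : pderiv (R := ℚ) 1 (Hu (X 0 : MvPolynomial (Fin 2) ℚ) (X 1)) = Huv (X 0) (X 1) := by
  unfold Hu Huv
  simp only [map_add, pd1p, pd1n]
  push_cast
  ring

theorem dHvv : pderiv (R := ℚ) 1 (Hv (X 0 : MvPolynomial (Fin 2) ℚ) (X 1)) = Hvv (X 0) (X 1) := by
  unfold Hv Hvv
  simp only [map_add, pd1p, pd1n]
  push_cast
  ring

theorem dGu : pderiv (R := ℚ) 0 (GZ (X 0 : MvPolynomial (Fin 2) ℚ) (X 1)) = Gu (X 0) (X 1) := by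
  unfold GZ Gu
  simp only [map_add, pd0p, pd0n]
  push_cast
  ring

theorem dGv : pderiv (R := ℚ) 1 (GZ (X 0 : MvPolynomial (Fin 2) ℚ) (X 1)) = Gv (X 0) (X 1) := by
  unfold GZ Gv
  simp only [map_add, pd1p, pd1n]
  push_cast
  ring


theorem hess_id {R : Type*} [CommRing R] (u v : R) :
    Huu u v * Hvv u v - Huv u v * Huv u v = 132 ^ 2 * GZ u v := by
  unfold Huu Hvv Huv GZ
  ring

theorem jac_id {R : Type*} [CommRing R] (u v : R) :
    Hu u v * Gv u v - Hv u v * Gu u v = 240 * FZ u v := by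
  unfold Hu Hv Gu Gv FZ
  ring

theorem gC24_eq : gC24 = GZ (X 0) (X 1) := by
  unfold gC24
  rw [hC24_eq, dHu, dHv, dHuu, dHvv, dHuv, hess_id, ← mul_assoc,
    show (132 ^ 2 : MvPolynomial (Fin 2) ℚ) = C (132 ^ 2) by rw [C_pow, map_ofNat], ← C_mul]
  norm_num

theorem fC24_eq : fC24 = FZ (X 0) (X 1) := by
  unfold fC24
  rw [hC24_eq, gC24_eq, dHu, dHv, dGu, dGv, jac_id, ← mul_assoc,
    show (240 : MvPolynomial (Fin 2) ℚ) = C 240 by rw [map_ofNat], ← C_mul]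
  norm_num

theorem FZ_hom (S T : Type*) [CommRing S] [CommRing T] (φ : S →+* T) (u v : S) :
    φ (FZ u v) = FZ (φ u) (φ v) := by
  simp only [FZ, map_add, map_mul, map_pow, map_neg, map_ofNat]

theorem fC24_map : fC24 = map (Int.castRingHom ℚ) (FZ (X 0) (X 1)) := by
  rw [FZ_hom, fC24_eq]; simp

theorem fC24_eval (u v : ℤ) : eval ![(u : ℚ), (v : ℚ)] fC24 = ((FZ u v : ℤ) : ℚ) := by
  rw [fC24_eq, FZ_hom, eval_X, eval_X]
  exact (FZ_hom _ _ (Int.castRingHom ℚ) u v).symm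

theorem hom_term (n i j : ℕ) (c : MvPolynomial (Fin 2) ℚ) (hc : c.IsHomogeneous 0) (h : i + j = n) :
    (c * X 0 ^ i * X 1 ^ j).IsHomogeneous n := by
  have := (hc.mul (isHomogeneous_X_pow (R := ℚ) (0 : Fin 2) i)).mul (isHomogeneous_X_pow (R := ℚ) (1 : Fin 2) j)
  rwa [zero_add, h] at this

theorem hom_p (c : ℕ) [c.AtLeastTwo] : (ofNat(c) : MvPolynomial (Fin 2) ℚ).IsHomogeneous 0 := by
  rw [← map_ofNat C c]; exact isHomogeneous_C _ _

theorem hom_n (c : ℕ) [c.AtLeastTwo] : (-ofNat(c) : MvPolynomial (Fin 2) ℚ).IsHomogeneous 0 := by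
  rw [← map_ofNat C c, ← C_neg]; exact isHomogeneous_C _ _

theorem fC24_hom : fC24.IsHomogeneous 30 := by
  rw [fC24_eq]
  unfold FZ
  repeat' with_reducible apply IsHomogeneous.add
  all_goals first
    | exact hom_term _ _ _ _ (hom_p _) rfl
    | exact hom_term _ _ _ _ (hom_n _) rfl

theorem fC24_int (m : Fin 2 →₀ ℕ) : ∃ z : ℤ, coeff m fC24 = (z : ℚ) := by
  rw [fC24_map, coeff_map]
  exact ⟨_, rfl⟩

end

section

/-- Coordinates of elements of the quintic order with respect to the integral basis `1, b₁, …, b₄`. -/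
@[ext]
structure V where
  c0 : ℤ
  c1 : ℤ
  c2 : ℤ
  c3 : ℤ
  c4 : ℤ
  deriving DecidableEq

namespace V

instance : Zero V := ⟨⟨0, 0, 0, 0, 0⟩⟩
instance : One V := ⟨⟨1, 0, 0, 0, 0⟩⟩
instance : Add V := ⟨fun a b => ⟨a.c0 + b.c0, a.c1 + b.c1, a.c2 + b.c2, a.c3 + b.c3, a.c4 + b.c4⟩⟩
instance : Neg V := ⟨fun a => ⟨-a.c0, -a.c1, -a.c2, -a.c3, -a.c4⟩⟩
instance : Sub V := ⟨fun a b => ⟨a.c0 - b.c0, a.c1 - b.c1, a.c2 - b.c2, a.c3 - b.c3, a.c4 - b.c4⟩⟩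
instance : Mul V := ⟨fun a b => ⟨
    (a.c0 * b.c0) - 6 * (a.c1 * b.c3) - 6 * (a.c1 * b.c4) - 6 * (a.c2 * b.c3) + 6 * (a.c2 * b.c4) - 6 *
    (a.c3 * b.c1) - 6 * (a.c3 * b.c2) - 6 * (a.c4 * b.c1) + 6 * (a.c4 * b.c2),
    (a.c0 * b.c1) + (a.c1 * b.c0) - (a.c1 * b.c1) + (a.c1 * b.c2) - (a.c1 * b.c3) + 2 * (a.c1 * b.c4) +
    (a.c2 * b.c1) + (a.c2 * b.c2) - 2 * (a.c2 * b.c3) - (a.c2 * b.c4) - (a.c3 * b.c1) - 2 * (a.c3 * b.c2) +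
    3 * (a.c3 * b.c3) + 4 * (a.c3 * b.c4) + 2 * (a.c4 * b.c1) - (a.c4 * b.c2) + 4 * (a.c4 * b.c3) + 5 *
    (a.c4 * b.c4),
    (a.c0 * b.c2) + (a.c1 * b.c1) + (a.c1 * b.c2) - 3 * (a.c1 * b.c4) + (a.c2 * b.c0) + (a.c2 * b.c1) -
    (a.c2 * b.c2) + (a.c2 * b.c3) - 2 * (a.c2 * b.c4) + (a.c3 * b.c2) + 2 * (a.c3 * b.c3) - 3 * (a.c3 *
    b.c4) - 3 * (a.c4 * b.c1) - 2 * (a.c4 * b.c2) - 3 * (a.c4 * b.c3) + 2 * (a.c4 * b.c4),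
    (a.c0 * b.c3) - (a.c1 * b.c1) - (a.c1 * b.c2) + (a.c1 * b.c3) - (a.c1 * b.c4) - (a.c2 * b.c1) - 3 *
    (a.c2 * b.c2) + (a.c2 * b.c3) + (a.c2 * b.c4) + (a.c3 * b.c0) + (a.c3 * b.c1) + (a.c3 * b.c2) - (a.c3 *
    b.c3) - 2 * (a.c3 * b.c4) - (a.c4 * b.c1) + (a.c4 * b.c2) - 2 * (a.c4 * b.c3) + 3 * (a.c4 * b.c4),
    (a.c0 * b.c4) - (a.c1 * b.c1) + (a.c1 * b.c2) - (a.c1 * b.c3) - (a.c1 * b.c4) + (a.c2 * b.c1) + (a.c2 *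
    b.c2) + (a.c2 * b.c3) - (a.c2 * b.c4) - (a.c3 * b.c1) + (a.c3 * b.c2) + (a.c3 * b.c4) + (a.c4 * b.c0) -
    (a.c4 * b.c1) - (a.c4 * b.c2) + (a.c4 * b.c3) + 2 * (a.c4 * b.c4)⟩⟩
instance : NatCast V := ⟨fun n => ⟨n, 0, 0, 0, 0⟩⟩
instance : IntCast V := ⟨fun n => ⟨n, 0, 0, 0, 0⟩⟩

@[simp] theorem zero_c0 : (0 : V).c0 = 0 := rfl
@[simp] theorem zero_c1 : (0 : V).c1 = 0 := rfl
@[simp] theorem zero_c2 : (0 : V).c2 = 0 := rfl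
@[simp] theorem zero_c3 : (0 : V).c3 = 0 := rfl
@[simp] theorem zero_c4 : (0 : V).c4 = 0 := rfl
@[simp] theorem one_c0 : (1 : V).c0 = 1 := rfl
@[simp] theorem one_c1 : (1 : V).c1 = 0 := rfl
@[simp] theorem one_c2 : (1 : V).c2 = 0 := rfl
@[simp] theorem one_c3 : (1 : V).c3 = 0 := rfl
@[simp] theorem one_c4 : (1 : V).c4 = 0 := rfl
@[simp] theorem add_c0 (a b : V) : (a + b).c0 = a.c0 + b.c0 := rfl
@[simp] theorem add_c1 (a b : V) : (a + b).c1 = a.c1 + b.c1 := rfl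
@[simp] theorem add_c2 (a b : V) : (a + b).c2 = a.c2 + b.c2 := rfl
@[simp] theorem add_c3 (a b : V) : (a + b).c3 = a.c3 + b.c3 := rfl
@[simp] theorem add_c4 (a b : V) : (a + b).c4 = a.c4 + b.c4 := rfl
@[simp] theorem sub_c0 (a b : V) : (a - b).c0 = a.c0 - b.c0 := rfl
@[simp] theorem sub_c1 (a b : V) : (a - b).c1 = a.c1 - b.c1 := rfl
@[simp] theorem sub_c2 (a b : V) : (a - b).c2 = a.c2 - b.c2 := rfl
@[simp] theorem sub_c3 (a b : V) : (a - b).c3 = a.c3 - b.c3 := rfl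
@[simp] theorem sub_c4 (a b : V) : (a - b).c4 = a.c4 - b.c4 := rfl
@[simp] theorem neg_c0 (a : V) : (-a).c0 = -a.c0 := rfl
@[simp] theorem neg_c1 (a : V) : (-a).c1 = -a.c1 := rfl
@[simp] theorem neg_c2 (a : V) : (-a).c2 = -a.c2 := rfl
@[simp] theorem neg_c3 (a : V) : (-a).c3 = -a.c3 := rfl
@[simp] theorem neg_c4 (a : V) : (-a).c4 = -a.c4 := rfl
theorem mul_c0 (a b : V) : (a * b).c0 =
    (a.c0 * b.c0) - 6 * (a.c1 * b.c3) - 6 * (a.c1 * b.c4) - 6 * (a.c2 * b.c3) + 6 * (a.c2 * b.c4) - 6 *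
    (a.c3 * b.c1) - 6 * (a.c3 * b.c2) - 6 * (a.c4 * b.c1) + 6 * (a.c4 * b.c2) := rfl
theorem mul_c1 (a b : V) : (a * b).c1 =
    (a.c0 * b.c1) + (a.c1 * b.c0) - (a.c1 * b.c1) + (a.c1 * b.c2) - (a.c1 * b.c3) + 2 * (a.c1 * b.c4) +
    (a.c2 * b.c1) + (a.c2 * b.c2) - 2 * (a.c2 * b.c3) - (a.c2 * b.c4) - (a.c3 * b.c1) - 2 * (a.c3 * b.c2) +
    3 * (a.c3 * b.c3) + 4 * (a.c3 * b.c4) + 2 * (a.c4 * b.c1) - (a.c4 * b.c2) + 4 * (a.c4 * b.c3) + 5 *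
    (a.c4 * b.c4) := rfl
theorem mul_c2 (a b : V) : (a * b).c2 =
    (a.c0 * b.c2) + (a.c1 * b.c1) + (a.c1 * b.c2) - 3 * (a.c1 * b.c4) + (a.c2 * b.c0) + (a.c2 * b.c1) -
    (a.c2 * b.c2) + (a.c2 * b.c3) - 2 * (a.c2 * b.c4) + (a.c3 * b.c2) + 2 * (a.c3 * b.c3) - 3 * (a.c3 *
    b.c4) - 3 * (a.c4 * b.c1) - 2 * (a.c4 * b.c2) - 3 * (a.c4 * b.c3) + 2 * (a.c4 * b.c4) := rfl
theorem mul_c3 (a b : V) : (a * b).c3 =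
    (a.c0 * b.c3) - (a.c1 * b.c1) - (a.c1 * b.c2) + (a.c1 * b.c3) - (a.c1 * b.c4) - (a.c2 * b.c1) - 3 *
    (a.c2 * b.c2) + (a.c2 * b.c3) + (a.c2 * b.c4) + (a.c3 * b.c0) + (a.c3 * b.c1) + (a.c3 * b.c2) - (a.c3 *
    b.c3) - 2 * (a.c3 * b.c4) - (a.c4 * b.c1) + (a.c4 * b.c2) - 2 * (a.c4 * b.c3) + 3 * (a.c4 * b.c4) := rfl
theorem mul_c4 (a b : V) : (a * b).c4 =
    (a.c0 * b.c4) - (a.c1 * b.c1) + (a.c1 * b.c2) - (a.c1 * b.c3) - (a.c1 * b.c4) + (a.c2 * b.c1) + (a.c2 *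
    b.c2) + (a.c2 * b.c3) - (a.c2 * b.c4) - (a.c3 * b.c1) + (a.c3 * b.c2) + (a.c3 * b.c4) + (a.c4 * b.c0) -
    (a.c4 * b.c1) - (a.c4 * b.c2) + (a.c4 * b.c3) + 2 * (a.c4 * b.c4) := rfl
@[simp] theorem nat_c0 (n : ℕ) : (n : V).c0 = n := rfl
@[simp] theorem nat_c1 (n : ℕ) : (n : V).c1 = 0 := rfl
@[simp] theorem nat_c2 (n : ℕ) : (n : V).c2 = 0 := rfl
@[simp] theorem nat_c3 (n : ℕ) : (n : V).c3 = 0 := rfl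
@[simp] theorem nat_c4 (n : ℕ) : (n : V).c4 = 0 := rfl
@[simp] theorem int_c0 (n : ℤ) : (n : V).c0 = n := rfl
@[simp] theorem int_c1 (n : ℤ) : (n : V).c1 = 0 := rfl
@[simp] theorem int_c2 (n : ℤ) : (n : V).c2 = 0 := rfl
@[simp] theorem int_c3 (n : ℤ) : (n : V).c3 = 0 := rfl
@[simp] theorem int_c4 (n : ℤ) : (n : V).c4 = 0 := rfl

instance : CommRing V where
  add_assoc a b c := by ext <;> simp [add_assoc]
  zero_add a := by ext <;> simp
  add_zero a := by ext <;> simp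
  add_comm a b := by ext <;> simp [add_comm]
  left_distrib a b c := by ext <;> simp only [mul_c0, mul_c1, mul_c2, mul_c3, mul_c4, add_c0, add_c1, add_c2, add_c3, add_c4] <;> ring
  right_distrib a b c := by ext <;> simp only [mul_c0, mul_c1, mul_c2, mul_c3, mul_c4, add_c0, add_c1, add_c2, add_c3, add_c4] <;> ring
  zero_mul a := by ext <;> simp [mul_c0, mul_c1, mul_c2, mul_c3, mul_c4]
  mul_zero a := by ext <;> simp [mul_c0, mul_c1, mul_c2, mul_c3, mul_c4]
  mul_assoc a b c := by ext <;> simp only [mul_c0, mul_c1, mul_c2, mul_c3, mul_c4] <;> ring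
  one_mul a := by ext <;> simp [mul_c0, mul_c1, mul_c2, mul_c3, mul_c4]
  mul_one a := by ext <;> simp [mul_c0, mul_c1, mul_c2, mul_c3, mul_c4]
  mul_comm a b := by ext <;> simp only [mul_c0, mul_c1, mul_c2, mul_c3, mul_c4] <;> ring
  neg_add_cancel a := by ext <;> simp
  sub_eq_add_neg a b := by ext <;> simp [sub_eq_add_neg]
  nsmul := nsmulRec
  zsmul := zsmulRec
  natCast_succ n := by ext <;> simp
  natCast_zero := by ext <;> simp
  intCast_ofNat n := by ext <;> simp
  intCast_negSucc n := by ext <;> simp [Int.negSucc_eq] <;> ring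

@[simp] theorem ofNat_c0 (n : ℕ) [n.AtLeastTwo] : (ofNat(n) : V).c0 = (ofNat(n) : ℤ) := rfl
@[simp] theorem ofNat_c1 (n : ℕ) [n.AtLeastTwo] : (ofNat(n) : V).c1 = 0 := rfl
@[simp] theorem ofNat_c2 (n : ℕ) [n.AtLeastTwo] : (ofNat(n) : V).c2 = 0 := rfl
@[simp] theorem ofNat_c3 (n : ℕ) [n.AtLeastTwo] : (ofNat(n) : V).c3 = 0 := rfl
@[simp] theorem ofNat_c4 (n : ℕ) [n.AtLeastTwo] : (ofNat(n) : V).c4 = 0 := rfl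

/-- The multiplication table of the order. -/
structure Table {S : Type*} [CommRing S] (v1 v2 v3 v4 : S) : Prop where
  h11 : v1 * v1 = - v1 + v2 - v3 - v4
  h12 : v1 * v2 = v1 + v2 - v3 + v4
  h13 : v1 * v3 = - 6 - v1 + v3 - v4
  h14 : v1 * v4 = - 6 + 2 * v1 - 3 * v2 - v3 - v4
  h22 : v2 * v2 = v1 - v2 - 3 * v3 + v4
  h23 : v2 * v3 = - 6 - 2 * v1 + v2 + v3 + v4
  h24 : v2 * v4 = 6 - v1 - 2 * v2 + v3 - v4
  h33 : v3 * v3 = 3 * v1 + 2 * v2 - v3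
  h34 : v3 * v4 = 4 * v1 - 3 * v2 - 2 * v3 + v4
  h44 : v4 * v4 = 5 * v1 + 2 * v2 + 3 * v3 + 2 * v4

/-- A ring homomorphism out of the order from a solution of the multiplication table. -/
def lift {S : Type*} [CommRing S] (v1 v2 v3 v4 : S) (h : Table v1 v2 v3 v4) : V →+* S where
  toFun a := a.c0 + a.c1 * v1 + a.c2 * v2 + a.c3 * v3 + a.c4 * v4
  map_one' := by simp
  map_zero' := by simp
  map_add' a b := by simp only [add_c0, add_c1, add_c2, add_c3, add_c4]; push_cast; ring
  map_mul' a b := by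
    simp only [mul_c0, mul_c1, mul_c2, mul_c3, mul_c4]
    push_cast
    linear_combination
      -((a.c1 * b.c1 : S) * h.h11 + (a.c1 * b.c2 + a.c2 * b.c1 : S) * h.h12 + (a.c1 * b.c3 + a.c3 * b.c1 :
      S) * h.h13 + (a.c1 * b.c4 + a.c4 * b.c1 : S) * h.h14 + (a.c2 * b.c2 : S) * h.h22 + (a.c2 * b.c3 + a.c3
      * b.c2 : S) * h.h23 + (a.c2 * b.c4 + a.c4 * b.c2 : S) * h.h24 + (a.c3 * b.c3 : S) * h.h33 + (a.c3 *
      b.c4 + a.c4 * b.c3 : S) * h.h34 + (a.c4 * b.c4 : S) * h.h44)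

theorem lift_apply {S : Type*} [CommRing S] (v1 v2 v3 v4 : S) (h : Table v1 v2 v3 v4) (a : V) :
    lift v1 v2 v3 v4 h a = a.c0 + a.c1 * v1 + a.c2 * v2 + a.c3 * v3 + a.c4 * v4 := rfl

end V

end

section

namespace V

/-- Coordinates as a function. -/
def co (a : V) : Fin 5 → ℤ := ![a.c0, a.c1, a.c2, a.c3, a.c4]

/-- The integral basis. -/
def bb : Fin 5 → V := ![⟨1, 0, 0, 0, 0⟩, ⟨0, 1, 0, 0, 0⟩, ⟨0, 0, 1, 0, 0⟩, ⟨0, 0, 0, 1, 0⟩, ⟨0, 0, 0, 0, 1⟩]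

theorem sum_bb (a : V) : a = ∑ i, (a.co i : V) * bb i := by
  simp only [Fin.sum_univ_five]
  ext <;> simp [co, bb, mul_c0, mul_c1, mul_c2, mul_c3, mul_c4]

theorem co_add (a b : V) (i : Fin 5) : (a + b).co i = a.co i + b.co i := by
  fin_cases i <;> rfl

theorem co_intmul (n : ℤ) (b : V) (i : Fin 5) : ((n : V) * b).co i = n * b.co i := by
  fin_cases i <;> simp [co, mul_c0, mul_c1, mul_c2, mul_c3, mul_c4]

theorem co_inj {a b : V} (h : ∀ i, a.co i = b.co i) : a = b := by
  ext
  · exact h 0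
  · exact h 1
  · exact h 2
  · exact h 3
  · exact h 4

/-- Explicit matrix of multiplication by `a`. -/
def mat (a : V) : Matrix (Fin 5) (Fin 5) ℤ := Matrix.of fun i j => (a * bb j).co i

/-- The norm form. -/
def nm (a : V) : ℤ := (mat a).det

end V

open V Module

/-- A number field together with an integral basis of the given order. -/
structure Setup (K : Type) [Field K] [NumberField K] where
  e : V →+* K
  B : Basis (Fin 5) ℚ K
  hB : ∀ i, B i = e (bb i)

namespace Setup

variable {K : Type} [Field K] [NumberField K]

theorem e_eq (S : Setup K) (a : V) : S.e a = ∑ i, ((a.co i : ℤ) : ℚ) • S.B i := by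
  conv_lhs => rw [sum_bb a]
  rw [map_sum]
  refine Finset.sum_congr rfl fun i _ => ?_
  rw [map_mul, S.hB, map_intCast, Algebra.smul_def]
  simp

theorem repr_e (S : Setup K) (a : V) (i : Fin 5) : S.B.repr (S.e a) i = a.co i := by
  rw [e_eq, Basis.repr_sum_self]

theorem e_inj (S : Setup K) : Function.Injective S.e := by
  intro a b h
  apply co_inj
  intro i
  have h1 := S.repr_e a i
  rw [h, S.repr_e b i] at h1
  exact_mod_cast h1.symm

theorem leftMul (S : Setup K) (a : V) : Algebra.leftMulMatrix S.B (S.e a) = (mat a).map (Int.cast : ℤ → ℚ) := by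
  ext i j
  rw [Algebra.leftMulMatrix_eq_repr_mul, S.hB, ← map_mul, repr_e]
  rfl

theorem norm_e (S : Setup K) (a : V) : Algebra.norm ℚ (S.e a) = (nm a : ℚ) := by
  rw [Algebra.norm_eq_matrix_det S.B, leftMul, nm]
  exact (RingHom.map_det (Int.castRingHom ℚ) (mat a)).symm

theorem tr_mat (a : V) : (mat a).trace = 5 * a.c0 := by
  simp only [Matrix.trace, Fin.sum_univ_five, mat, Matrix.diag_apply, Matrix.of_apply]
  simp [co, bb, mul_c0, mul_c1, mul_c2, mul_c3, mul_c4]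
  ring

theorem trace_e (S : Setup K) (a : V) : Algebra.trace ℚ K (S.e a) = (5 * a.c0 : ℤ) := by
  rw [Algebra.trace_eq_matrix_trace S.B, leftMul, ← tr_mat]
  exact (AddMonoidHom.map_trace (Int.castAddHom ℚ) (mat a)).symm

theorem finrank (S : Setup K) : finrank ℚ K = 5 := by
  rw [finrank_eq_card_basis S.B]; rfl

theorem nm_mul (S : Setup K) (a b : V) : nm (a * b) = nm a * nm b := by
  have := S.norm_e (a * b)
  rw [map_mul, map_mul, norm_e, norm_e] at this
  exact_mod_cast this.symm

theorem nm_eq_zero (S : Setup K) {a : V} (h : nm a = 0) : a = 0 := by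
  have := S.norm_e a
  rw [h, Int.cast_zero, Algebra.norm_eq_zero_iff] at this
  exact S.e_inj (this.trans (map_zero _).symm)

theorem isDomain (S : Setup K) : IsDomain V := S.e_inj.isDomain S.e

end Setup

namespace V

theorem det5 (M : Matrix (Fin 5) (Fin 5) ℤ) : M.det =
    (M 0 0 * M 1 1 - M 0 1 * M 1 0) * (M 2 2 * (M 3 3 * M 4 4 - M 3 4 * M 4 3) - M 2 3 * (M 3 2 * M 4 4 - M 3 4 * M 4 2) + M 2 4 * (M 3 2 * M 4 3 - M 3 3 * M 4 2))
    - (M 0 0 * M 1 2 - M 0 2 * M 1 0) * (M 2 1 * (M 3 3 * M 4 4 - M 3 4 * M 4 3) - M 2 3 * (M 3 1 * M 4 4 - M 3 4 * M 4 1) + M 2 4 * (M 3 1 * M 4 3 - M 3 3 * M 4 1))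
    + (M 0 0 * M 1 3 - M 0 3 * M 1 0) * (M 2 1 * (M 3 2 * M 4 4 - M 3 4 * M 4 2) - M 2 2 * (M 3 1 * M 4 4 - M 3 4 * M 4 1) + M 2 4 * (M 3 1 * M 4 2 - M 3 2 * M 4 1))
    - (M 0 0 * M 1 4 - M 0 4 * M 1 0) * (M 2 1 * (M 3 2 * M 4 3 - M 3 3 * M 4 2) - M 2 2 * (M 3 1 * M 4 3 - M 3 3 * M 4 1) + M 2 3 * (M 3 1 * M 4 2 - M 3 2 * M 4 1))
    + (M 0 1 * M 1 2 - M 0 2 * M 1 1) * (M 2 0 * (M 3 3 * M 4 4 - M 3 4 * M 4 3) - M 2 3 * (M 3 0 * M 4 4 - M 3 4 * M 4 0) + M 2 4 * (M 3 0 * M 4 3 - M 3 3 * M 4 0))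
    - (M 0 1 * M 1 3 - M 0 3 * M 1 1) * (M 2 0 * (M 3 2 * M 4 4 - M 3 4 * M 4 2) - M 2 2 * (M 3 0 * M 4 4 - M 3 4 * M 4 0) + M 2 4 * (M 3 0 * M 4 2 - M 3 2 * M 4 0))
    + (M 0 1 * M 1 4 - M 0 4 * M 1 1) * (M 2 0 * (M 3 2 * M 4 3 - M 3 3 * M 4 2) - M 2 2 * (M 3 0 * M 4 3 - M 3 3 * M 4 0) + M 2 3 * (M 3 0 * M 4 2 - M 3 2 * M 4 0))
    + (M 0 2 * M 1 3 - M 0 3 * M 1 2) * (M 2 0 * (M 3 1 * M 4 4 - M 3 4 * M 4 1) - M 2 1 * (M 3 0 * M 4 4 - M 3 4 * M 4 0) + M 2 4 * (M 3 0 * M 4 1 - M 3 1 * M 4 0))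
    - (M 0 2 * M 1 4 - M 0 4 * M 1 2) * (M 2 0 * (M 3 1 * M 4 3 - M 3 3 * M 4 1) - M 2 1 * (M 3 0 * M 4 3 - M 3 3 * M 4 0) + M 2 3 * (M 3 0 * M 4 1 - M 3 1 * M 4 0))
    + (M 0 3 * M 1 4 - M 0 4 * M 1 3) * (M 2 0 * (M 3 1 * M 4 2 - M 3 2 * M 4 1) - M 2 1 * (M 3 0 * M 4 2 - M 3 2 * M 4 0) + M 2 2 * (M 3 0 * M 4 1 - M 3 1 * M 4 0)) := by
  simp [Matrix.det_succ_row_zero, Fin.sum_univ_succ, Fin.succAbove]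
  ring

end V

end

section

namespace V

/-- A five by five determinant expanded along the first two rows. -/
def d5 (m00 m01 m02 m03 m04 m10 m11 m12 m13 m14 m20 m21 m22 m23 m24 m30 m31 m32 m33 m34 m40 m41 m42 m43 m44 : ℤ) : ℤ :=
    (m00 * m11 - m01 * m10) *
      (m22 * (m33 * m44 - m34 * m43) - m23 * (m32 * m44 - m34 * m42) + m24 * (m32 * m43 - m33 * m42))
    - (m00 * m12 - m02 * m10) *
      (m21 * (m33 * m44 - m34 * m43) - m23 * (m31 * m44 - m34 * m41) + m24 * (m31 * m43 - m33 * m41))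
    + (m00 * m13 - m03 * m10) *
      (m21 * (m32 * m44 - m34 * m42) - m22 * (m31 * m44 - m34 * m41) + m24 * (m31 * m42 - m32 * m41))
    - (m00 * m14 - m04 * m10) *
      (m21 * (m32 * m43 - m33 * m42) - m22 * (m31 * m43 - m33 * m41) + m23 * (m31 * m42 - m32 * m41))
    + (m01 * m12 - m02 * m11) *
      (m20 * (m33 * m44 - m34 * m43) - m23 * (m30 * m44 - m34 * m40) + m24 * (m30 * m43 - m33 * m40))
    - (m01 * m13 - m03 * m11) *
      (m20 * (m32 * m44 - m34 * m42) - m22 * (m30 * m44 - m34 * m40) + m24 * (m30 * m42 - m32 * m40))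
    + (m01 * m14 - m04 * m11) *
      (m20 * (m32 * m43 - m33 * m42) - m22 * (m30 * m43 - m33 * m40) + m23 * (m30 * m42 - m32 * m40))
    + (m02 * m13 - m03 * m12) *
      (m20 * (m31 * m44 - m34 * m41) - m21 * (m30 * m44 - m34 * m40) + m24 * (m30 * m41 - m31 * m40))
    - (m02 * m14 - m04 * m12) *
      (m20 * (m31 * m43 - m33 * m41) - m21 * (m30 * m43 - m33 * m40) + m23 * (m30 * m41 - m31 * m40))
    + (m03 * m14 - m04 * m13) *
      (m20 * (m31 * m42 - m32 * m41) - m21 * (m30 * m42 - m32 * m40) + m22 * (m30 * m41 - m31 * m40))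

/-- The norm form in explicit coordinates. -/
def nmx (a0 a1 a2 a3 a4 : ℤ) : ℤ :=
  d5
    (a0) (-6 * a3 - 6 * a4) (-6 * a3 + 6 * a4) (-6 * a1 - 6 * a2) (-6 * a1 + 6 * a2)
    (a1) (a0 - a1 + a2 - a3 + 2 * a4) (a1 + a2 - 2 * a3 - a4) (-a1 - 2 * a2 + 3 * a3 + 4 * a4) (2 * a1 - a2 + 4 * a3 + 5 * a4)
    (a2) (a1 + a2 - 3 * a4) (a0 + a1 - a2 + a3 - 2 * a4) (a2 + 2 * a3 - 3 * a4) (-3 * a1 - 2 * a2 - 3 * a3 + 2 * a4)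
    (a3) (-a1 - a2 + a3 - a4) (-a1 - 3 * a2 + a3 + a4) (a0 + a1 + a2 - a3 - 2 * a4) (-a1 + a2 - 2 * a3 + 3 * a4)
    (a4) (-a1 + a2 - a3 - a4) (a1 + a2 + a3 - a4) (-a1 + a2 + a4) (a0 - a1 - a2 + a3 + 2 * a4)

theorem nm_eq (a : V) : nm a = nmx a.c0 a.c1 a.c2 a.c3 a.c4 := by
  rw [nm, det5]
  simp only [mat, Matrix.of_apply, bb, co]
  simp [mul_c0, mul_c1, mul_c2, mul_c3, mul_c4]
  simp only [nmx, d5]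
  ring

/-- Search used for maximality at `p`. -/
def maxTest (p : ℕ) (ms : List V) : Bool :=
  (List.range p).all fun a => (List.range p).all fun b => (List.range p).all fun c =>
    (List.range p).all fun d => (List.range p).all fun e =>
      (a + b + c + d + e == 0) || ms.any fun m =>
        nmx (a + p * m.c0) (b + p * m.c1) (c + p * m.c2) (d + p * m.c3) (e + p * m.c4) % ((p : ℤ) ^ 5) != 0

theorem max2 : maxTest 2 [⟨0, 0, 0, 0, 0⟩, ⟨0, 0, 0, 0, 1⟩, ⟨1, 0, 0, 0, 0⟩] = true := by decide +kernel
theorem max3 : maxTest 3 [⟨0, 0, 0, 0, 0⟩, ⟨0, 0, 0, 0, 1⟩] = true := by decide +kernel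
theorem max5 : maxTest 5 [⟨0, 0, 0, 0, 0⟩] = true := by decide +kernel

end V

end

section

open V Module

namespace V

theorem maxTest_spec {p : ℕ} {ms : List V} (h : maxTest p ms = true) (a b c d e : ℕ)
    (ha : a < p) (hb : b < p) (hc : c < p) (hd : d < p) (he : e < p) (h0 : a + b + c + d + e ≠ 0) :
    ∃ m : V, ¬ ((p : ℤ) ^ 5 ∣ nm (⟨a, b, c, d, e⟩ + (p : ℤ) * m)) := by
  unfold maxTest at h
  rw [List.all_eq_true] at h
  have h := h a (List.mem_range.2 ha)
  rw [List.all_eq_true] at h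
  have h := h b (List.mem_range.2 hb)
  rw [List.all_eq_true] at h
  have h := h c (List.mem_range.2 hc)
  rw [List.all_eq_true] at h
  have h := h d (List.mem_range.2 hd)
  rw [List.all_eq_true] at h
  have h := h e (List.mem_range.2 he)
  rw [Bool.or_eq_true, List.any_eq_true] at h
  rcases h with h | ⟨m, -, hm⟩
  · exact absurd (by simpa using h) h0
  · refine ⟨m, fun hdvd => ?_⟩
    rw [nm_eq] at hdvd
    have := Int.emod_eq_zero_of_dvd hdvd
    simp [mul_c0, mul_c1, mul_c2, mul_c3, mul_c4] at this hm
    exact hm this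

end V

namespace Setup

variable {K : Type} [Field K] [NumberField K]

theorem int_e (S : Setup K) (a : V) : IsIntegral ℤ (S.e a) := by
  have h1 : ∀ i, IsIntegral ℤ (S.e (bb i)) := by
    have k1 : IsIntegral ℤ (S.e (bb 1)) := by
      refine ⟨Polynomial.X ^ 5 - 20 * Polynomial.X ^ 2 + 30 * Polynomial.X - 60, ?_, ?_⟩
      · monicity!
      · have : (bb 1) ^ 5 - 20 * (bb 1) ^ 2 + 30 * bb 1 - 60 = (0 : V) := by decide
        have := congrArg S.e this
        simpa [map_ofNat] using this
    have k2 : IsIntegral ℤ (S.e (bb 2)) := by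
      refine ⟨Polynomial.X ^ 5 - 40 * Polynomial.X ^ 2 + 30 * Polynomial.X - 36, ?_, ?_⟩
      · monicity!
      · have : (bb 2) ^ 5 - 40 * (bb 2) ^ 2 + 30 * bb 2 - 36 = (0 : V) := by decide
        have := congrArg S.e this
        simpa [map_ofNat] using this
    have k3 : IsIntegral ℤ (S.e (bb 3)) := by
      refine ⟨Polynomial.X ^ 5 + 50 * Polynomial.X ^ 2 - 75 * Polynomial.X + 234, ?_, ?_⟩
      · monicity!
      · have : (bb 3) ^ 5 + 50 * (bb 3) ^ 2 - 75 * bb 3 + 234 = (0 : V) := by decide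
        have := congrArg S.e this
        simpa [map_ofNat] using this
    have k4 : IsIntegral ℤ (S.e (bb 4)) := by
      refine ⟨Polynomial.X ^ 5 + 30 * Polynomial.X ^ 2 + 405 * Polynomial.X + 630, ?_, ?_⟩
      · monicity!
      · have : (bb 4) ^ 5 + 30 * (bb 4) ^ 2 + 405 * bb 4 + 630 = (0 : V) := by decide
        have := congrArg S.e this
        simpa [map_ofNat] using this
    intro i
    fin_cases i
    · have : bb 0 = 1 := rfl
      simp only [Fin.zero_eta, this, map_one]
      exact isIntegral_one
    · exact k1
    · exact k2
    · exact k3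
    · exact k4
  rw [sum_bb a, map_sum]
  refine IsIntegral.sum _ fun i _ => ?_
  rw [map_mul, map_intCast]
  exact (isIntegral_algebraMap (R := ℤ) (x := a.co i)).mul (h1 i)

theorem norm_int (y : K) (hy : IsIntegral ℤ y) : ∃ n : ℤ, Algebra.norm ℚ y = n := by
  have := Algebra.isIntegral_norm ℚ hy
  obtain ⟨n, hn⟩ := IsIntegrallyClosed.isIntegral_iff.1 this
  exact ⟨n, by simpa using hn.symm⟩

theorem trace_int (y : K) (hy : IsIntegral ℤ y) : ∃ n : ℤ, Algebra.trace ℚ K y = n := by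
  have := Algebra.isIntegral_trace (L := ℚ) hy
  obtain ⟨n, hn⟩ := IsIntegrallyClosed.isIntegral_iff.1 this
  exact ⟨n, by simpa using hn.symm⟩

theorem descend (S : Setup K) {p : ℕ} (hp : 0 < p) {ms : List V} (h : maxTest p ms = true) (y : K) (hy : IsIntegral ℤ y)
    (c : V) (hc : S.e c = p * y) : ∃ c', S.e c' = y := by
  have hp' : (0 : ℤ) < p := by exact_mod_cast hp
  have hpK : (p : K) ≠ 0 := by exact_mod_cast hp.ne'
  set r : V := ⟨(c.c0 % p).toNat, (c.c1 % p).toNat, (c.c2 % p).toNat, (c.c3 % p).toNat, (c.c4 % p).toNat⟩ with hr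
  set q : V := ⟨c.c0 / p, c.c1 / p, c.c2 / p, c.c3 / p, c.c4 / p⟩ with hq
  have hcr : c = r + (p : ℤ) * q := by
    have key : ∀ x : ℤ, x = ((x % p).toNat : ℤ) + p * (x / p) := by
      intro x
      rw [Int.toNat_of_nonneg (Int.emod_nonneg _ hp'.ne')]
      exact (Int.emod_add_mul_ediv x p).symm
    ext <;> simp only [hr, hq, add_c0, add_c1, add_c2, add_c3, add_c4, mul_c0, mul_c1, mul_c2, mul_c3, mul_c4] <;>
      simp [-Int.ofNat_toNat] <;> exact key _
  have lt : ∀ x : ℤ, (x % p).toNat < p := by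
    intro x
    have := Int.emod_lt_of_pos x hp'
    have := Int.emod_nonneg x hp'.ne'
    omega
  by_cases h0 : (c.c0 % p).toNat + (c.c1 % p).toNat + (c.c2 % p).toNat + (c.c3 % p).toNat + (c.c4 % p).toNat = 0
  · have hr0 : r = 0 := by
      ext <;> simp only [hr, zero_c0, zero_c1, zero_c2, zero_c3, zero_c4] <;> omega
    refine ⟨q, ?_⟩
    rw [hcr, hr0, zero_add, map_mul, map_intCast] at hc
    exact mul_left_cancel₀ hpK (by exact_mod_cast hc)
  · obtain ⟨m, hm⟩ := maxTest_spec h _ _ _ _ _ (lt c.c0) (lt c.c1) (lt c.c2) (lt c.c3) (lt c.c4) h0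
    exfalso
    apply hm
    have h1 : S.e (r + (p : ℤ) * m) = algebraMap ℚ K p * (y + S.e (m - q)) := by
      have : r + (p : ℤ) * m = c + (p : ℤ) * (m - q) := by rw [hcr]; ring
      rw [this, map_add, hc, map_mul, map_intCast]
      simp
      ring
    obtain ⟨n, hn⟩ := norm_int _ (hy.add (S.int_e (m - q)))
    have h2 := S.norm_e (r + (p : ℤ) * m)
    rw [h1, map_mul, Algebra.norm_algebraMap, hn, S.finrank] at h2
    exact ⟨n, by exact_mod_cast h2.symm⟩

theorem tr_coord (S : Setup K) (y : K) (j : Fin 5) :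
    Algebra.trace ℚ K (y * S.B j) = ∑ i, S.B.repr y i * (5 * (bb i * bb j).c0 : ℤ) := by
  conv_lhs => rw [← S.B.sum_repr y]
  rw [Finset.sum_mul, map_sum]
  refine Finset.sum_congr rfl fun i _ => ?_
  rw [smul_mul_assoc, map_smul, S.hB, S.hB, ← map_mul, trace_e, smul_eq_mul]

theorem maximal (S : Setup K) (y : K) (hy : IsIntegral ℤ y) : ∃ c, S.e c = y := by
  have ht : ∀ j, ∃ n : ℤ, ∑ i, S.B.repr y i * (5 * (bb i * bb j).c0 : ℤ) = n := by
    intro j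
    rw [← tr_coord]
    exact trace_int _ (hy.mul (S.hB j ▸ S.int_e _))
  obtain ⟨n0, h0⟩ := ht 0
  obtain ⟨n1, h1⟩ := ht 1
  obtain ⟨n2, h2⟩ := ht 2
  obtain ⟨n3, h3⟩ := ht 3
  obtain ⟨n4, h4⟩ := ht 4
  simp only [Fin.sum_univ_five] at h0 h1 h2 h3 h4
  simp [bb, mul_c0] at h0 h1 h2 h3 h4
  have hc : S.e ⟨12 * n0, -(n3 + n4), -(n3 - n4), -(n1 + n2), -(n1 - n2)⟩ = 60 * y := by
    apply S.B.repr.injective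
    ext i
    rw [repr_e]
    have : (60 : K) * y = (60 : ℚ) • y := by rw [Algebra.smul_def]; simp
    rw [this, map_smul, Finsupp.smul_apply, smul_eq_mul]
    fin_cases i <;> simp [co] <;> linarith
  have e1 : ∃ c, S.e c = 30 * y := by
    refine S.descend (p := 2) (by norm_num) max2 _ ?_ _ (hc.trans ?_)
    · exact (isIntegral_algebraMap (R := ℤ) (x := 30)).mul hy |> fun h => by simpa using h
    · push_cast; ring
  obtain ⟨c1, hc1⟩ := e1
  have e2 : ∃ c, S.e c = 15 * y := by
    refine S.descend (p := 2) (by norm_num) max2 _ ?_ _ (hc1.trans ?_)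
    · exact (isIntegral_algebraMap (R := ℤ) (x := 15)).mul hy |> fun h => by simpa using h
    · push_cast; ring
  obtain ⟨c2, hc2⟩ := e2
  have e3 : ∃ c, S.e c = 5 * y := by
    refine S.descend (p := 3) (by norm_num) max3 _ ?_ _ (hc2.trans ?_)
    · exact (isIntegral_algebraMap (R := ℤ) (x := 5)).mul hy |> fun h => by simpa using h
    · push_cast; ring
  obtain ⟨c3, hc3⟩ := e3
  exact S.descend (p := 5) (by norm_num) max5 _ hy _ (hc3.trans (by push_cast; ring))

end Setup

end

section

open V Module

namespace Setup

variable {K : Type} [Field K] [NumberField K]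

/-- The order is the ring of integers. -/
noncomputable def E (S : Setup K) : V ≃+* NumberField.RingOfIntegers K :=
  RingEquiv.ofBijective
    (S.e.codRestrict (integralClosure ℤ K).toSubring S.int_e : V →+* NumberField.RingOfIntegers K)
    ⟨fun a b h => S.e_inj (congrArg Subtype.val h), fun y => by
      obtain ⟨c, hc⟩ := S.maximal (y : K) y.2
      exact ⟨c, Subtype.ext hc⟩⟩

theorem E_coe (S : Setup K) (a : V) : ((S.E a : NumberField.RingOfIntegers K) : K) = S.e a := rfl

/-- Integral basis of the ring of integers. -/
noncomputable def zB (S : Setup K) : Basis (Fin 5) ℤ (NumberField.RingOfIntegers K) :=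
  Basis.ofEquivFun
    { toFun := fun x => (S.E.symm x).co
      map_add' := fun x y => by ext i; simp [co_add]
      map_smul' := fun n x => by ext i; simp [co_intmul]
      invFun := fun c => S.E ⟨c 0, c 1, c 2, c 3, c 4⟩
      left_inv := fun x => by
        exact S.E.apply_symm_apply x
      right_inv := fun c => by
        ext i
        fin_cases i <;> simp [co] }

theorem zB_apply (S : Setup K) (i : Fin 5) : S.zB i = S.E (bb i) := by
  rw [zB, Basis.coe_ofEquivFun]
  change S.E ⟨(Pi.single i (1 : ℤ) : Fin 5 → ℤ) 0, (Pi.single i (1 : ℤ) : Fin 5 → ℤ) 1,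
    (Pi.single i (1 : ℤ) : Fin 5 → ℤ) 2, (Pi.single i (1 : ℤ) : Fin 5 → ℤ) 3,
    (Pi.single i (1 : ℤ) : Fin 5 → ℤ) 4⟩ = S.E (bb i)
  refine congrArg S.E ?_
  fin_cases i <;> rfl

theorem discr_eq (S : Setup K) : NumberField.discr K = 16200000 := by
  rw [← NumberField.discr_eq_discr K S.zB, Algebra.discr_def]
  have : Algebra.traceMatrix ℤ S.zB = Matrix.of fun i j => 5 * (bb i * bb j).c0 := by
    ext i j
    rw [Algebra.traceMatrix_apply, Algebra.traceForm_apply, zB_apply, zB_apply, ← map_mul, Matrix.of_apply]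
    have h := S.trace_e (bb i * bb j)
    rw [← E_coe, ← Algebra.coe_trace_int] at h
    exact_mod_cast h
  rw [this]
  have : (Matrix.of fun i j : Fin 5 => 5 * (bb i * bb j).c0) =
    !![5,0,0,0,0;0,0,0,-30,-30;0,0,0,-30,30;0,-30,-30,0,0;0,-30,30,0,0] := by
    ext i j
    fin_cases i <;> fin_cases j <;> decide
  rw [this]
  simp [Matrix.det_succ_row_zero, Fin.sum_univ_succ, Fin.succAbove]

theorem real_unique (a b : ℝ) (ha : a ^ 5 - 20 * a ^ 2 + 30 * a - 60 = 0)
    (hb : b ^ 5 - 20 * b ^ 2 + 30 * b - 60 = 0) : a = b := by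
  have key : ∀ x : ℝ, x ^ 5 - 20 * x ^ 2 + 30 * x - 60 = 0 → 2 < x := by
    intro x hx
    have h0 : 0 < x := by
      by_contra h
      have h' : 0 ≤ -x := by linarith
      have := pow_nonneg h' 5
      nlinarith [sq_nonneg x]
    by_contra h
    have h1 : 0 ≤ 2 - x := by linarith
    have h2 : x ^ 5 ≤ 8 * x ^ 2 := by
      have : x ^ 3 ≤ 8 := by nlinarith [pow_le_pow_left₀ h0.le (by linarith : x ≤ 2) 3]
      nlinarith [sq_nonneg x]
    nlinarith [sq_nonneg (x - 5 / 4)]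
  have h1 := key a ha
  have h2 := key b hb
  have hm : (a - b) * (a ^ 4 + a ^ 3 * b + a ^ 2 * b ^ 2 + a * b ^ 3 + b ^ 4 - 20 * (a + b) + 30) = 0 := by
    linear_combination ha - hb
  rcases mul_eq_zero.1 hm with h | h
  · linarith
  · exfalso
    obtain ⟨p, hp⟩ : ∃ p, p = a - 2 := ⟨_, rfl⟩
    obtain ⟨q, hq⟩ : ∃ q, q = b - 2 := ⟨_, rfl⟩
    have ha' : a = p + 2 := by linarith
    have hb' : b = q + 2 := by linarith
    have hp0 : 0 < p := by linarith
    have hq0 : 0 < q := by linarith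
    rw [ha', hb'] at h
    ring_nf at h
    have : 0 < p ^ 4 := by positivity
    have : 0 < p * q := by positivity
    have : 0 < p * q ^ 2 := by positivity
    have : 0 < p ^ 2 * q := by positivity
    have : 0 < p ^ 3 * q := by positivity
    have : 0 < p ^ 2 * q ^ 2 := by positivity
    have : 0 < p * q ^ 3 := by positivity
    have : 0 < q ^ 4 := by positivity
    have : 0 < q ^ 3 := by positivity
    have : 0 < q ^ 2 := by positivity
    have : 0 < p ^ 3 := by positivity
    have : 0 < p ^ 2 := by positivity
    nlinarith

theorem hom_ext (S : Setup K) (φ ψ : K →+* ℂ) (h : φ (S.e (bb 1)) = ψ (S.e (bb 1))) : φ = ψ := by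
  have key : ∀ a : V, ∀ c0 c1 c2 c3 c4 : ℤ, 82 * a = c0 + c1 * bb 1 + c2 * (bb 1) ^ 2 + c3 * (bb 1) ^ 3 +
      c4 * (bb 1) ^ 4 → φ (S.e a) = ψ (S.e a) := by
    intro a c0 c1 c2 c3 c4 ha
    have h1 := congrArg (φ.comp S.e) ha
    have h2 := congrArg (ψ.comp S.e) ha
    simp only [map_mul, map_add, map_pow, map_ofNat, map_intCast, RingHom.comp_apply] at h1 h2
    rw [h, ← h2] at h1
    exact mul_left_cancel₀ (by norm_num) h1
  have hb : ∀ i, φ (S.B i) = ψ (S.B i) := by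
    intro i
    rw [S.hB]
    fin_cases i
    · exact key _ 82 0 0 0 0 (by decide)
    · exact h
    · exact key _ (-168) 114 32 6 (-4) (by decide)
    · exact key _ (-48) 138 (-26) (-10) (-7) (by decide)
    · exact key _ (-120) (-106) (-24) 16 3 (by decide)
  ext x
  rw [← S.B.sum_repr x, map_sum, map_sum]
  refine Finset.sum_congr rfl fun i _ => ?_
  rw [Algebra.smul_def, map_mul, map_mul, hb]
  simp

open NumberField NumberField.InfinitePlace in
theorem signature (S : Setup K) : nrRealPlaces K = 1 ∧ nrComplexPlaces K = 2 := by
  classical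
  have h1 := card_add_two_mul_card_eq_rank K
  have h2 : 0 < nrRealPlaces K := nrRealPlaces_pos_of_odd_finrank (by rw [S.finrank]; decide)
  rw [S.finrank] at h1
  have h3 : nrRealPlaces K ≤ 1 := by
    rw [← card_real_embeddings, Fintype.card_le_one_iff]
    rintro ⟨φ, hφ⟩ ⟨ψ, hψ⟩
    refine Subtype.ext (S.hom_ext φ ψ ?_)
    have hr : (bb 1) ^ 5 - 20 * (bb 1) ^ 2 + 30 * bb 1 - 60 = (0 : V) := by decide
    have k : ∀ χ : K →+* ℂ, ComplexEmbedding.IsReal χ → ∃ r : ℝ, χ (S.e (bb 1)) = r ∧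
        r ^ 5 - 20 * r ^ 2 + 30 * r - 60 = 0 := by
      intro χ hχ
      refine ⟨hχ.embedding (S.e (bb 1)), (hχ.coe_embedding_apply _).symm, ?_⟩
      have := congrArg (hχ.embedding.comp S.e) hr
      simpa only [map_mul, map_add, map_sub, map_pow, map_ofNat, map_zero, RingHom.comp_apply] using this
    obtain ⟨a, ha, ha'⟩ := k φ hφ
    obtain ⟨b, hb, hb'⟩ := k ψ hψ
    rw [ha, hb, real_unique a b ha' hb']
  omega

end Setup

end

section

open V Module

namespace Setup

variable {K : Type} [Field K] [NumberField K]

open NumberField NumberField.InfinitePlace NumberField.mixedEmbedding MeasureTheory in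
open scoped nonZeroDivisors in
theorem mink (S : Setup K) (J : Ideal (NumberField.RingOfIntegers K)) (z : V) (hz : z ≠ 0)
    (hJ : J ^ 2 = Ideal.span {S.E z}) :
    ∃ γ W : V, γ ≠ 0 ∧ γ * z = W ^ 2 ∧ ∀ φ : K →+* ℂ, ‖φ (S.e γ)‖ < 484 / 25 := by
  classical
  have hz' : S.e z ≠ 0 := by
    rw [Ne, map_eq_zero_iff _ S.e_inj]; exact hz
  have hEz : S.E z ≠ 0 := by
    simpa using hz
  have hJ0 : J ≠ ⊥ := by
    rintro rfl
    rw [← Ideal.zero_eq_bot, zero_pow two_ne_zero, Ideal.zero_eq_bot, eq_comm, Ideal.span_singleton_eq_bot] at hJ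
    exact hEz hJ
  have hJu : (J : FractionalIdeal (𝓞 K)⁰ K) ≠ 0 := by
    rwa [Ne, FractionalIdeal.coeIdeal_eq_zero]
  let I : (FractionalIdeal (𝓞 K)⁰ K)ˣ := Units.mk0 _ hJu
  let f : InfinitePlace K → NNReal := fun w => ⟨22 / 5 * Real.sqrt (w (S.e z)), by positivity⟩
  have hnorm : (Ideal.absNorm J : ℝ) = Real.sqrt |((Algebra.norm ℚ (S.e z) : ℚ) : ℝ)| := by
    rw [eq_comm, Real.sqrt_eq_iff_eq_sq (by positivity) (by positivity)]
    have h1 := congrArg Ideal.absNorm hJ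
    rw [map_pow, Ideal.absNorm_span_singleton] at h1
    rw [← S.E_coe, ← Algebra.coe_norm_int]
    have h2 : ((Ideal.absNorm J ^ 2 : ℕ) : ℝ) = (((Algebra.norm ℤ (S.E z)).natAbs : ℕ) : ℝ) := by rw [h1]
    push_cast at h2 ⊢
    rw [h2, Nat.cast_natAbs]
    simp
  have hprod : ∏ w, ((f w : NNReal) : ℝ) ^ (mult w) = (22 / 5) ^ 5 * Real.sqrt |((Algebra.norm ℚ (S.e z) : ℚ) : ℝ)| := by
    have h1 : ∀ w : InfinitePlace K, ((f w : NNReal) : ℝ) ^ (mult w) =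
        (22 / 5) ^ (mult w) * Real.sqrt (w (S.e z) ^ mult w) := by
      intro w
      have : ((f w : NNReal) : ℝ) = 22 / 5 * Real.sqrt (w (S.e z)) := rfl
      rw [this, mul_pow]
      congr 1
      rw [eq_comm, Real.sqrt_eq_iff_eq_sq (by positivity) (by positivity), ← pow_mul, mul_comm, pow_mul,
        Real.sq_sqrt (by positivity)]
    rw [Finset.prod_congr rfl fun w _ => h1 w, Finset.prod_mul_distrib, Finset.prod_pow_eq_pow_sum,
      sum_mult_eq, S.finrank, ← Real.sqrt_prod, prod_eq_abs_norm]
    · simp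
    · intro w _; positivity
  have hvol : minkowskiBound K I < volume (convexBodyLT K f) := by
    rw [minkowskiBound, volume_fundamentalDomain_fractionalIdealLatticeBasis,
      volume_fundamentalDomain_latticeBasis, convexBodyLT_volume, mixedEmbedding.finrank, S.finrank,
      S.signature.2, S.discr_eq]
    have hI : FractionalIdeal.absNorm I.1 = Ideal.absNorm J := FractionalIdeal.coeIdeal_absNorm J
    rw [hI, convexBodyLTFactor, S.signature.1, S.signature.2]
    have hn : 0 < Real.sqrt |((Algebra.norm ℚ (S.e z) : ℚ) : ℝ)| := by
      refine Real.sqrt_pos.2 (abs_pos.2 ?_)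
      exact_mod_cast (Algebra.norm_ne_zero_iff (R := ℚ)).2 hz'
    rw [← ENNReal.ofReal_coe_nnreal, ← ENNReal.ofReal_coe_nnreal, ← ENNReal.ofReal_coe_nnreal]
    rw [← ENNReal.ofReal_mul (by positivity)]
    refine (ENNReal.toReal_lt_toReal (by finiteness) (by finiteness)).1 ?_
    rw [ENNReal.toReal_mul, ENNReal.toReal_mul, ENNReal.toReal_mul, ENNReal.toReal_ofReal (by positivity),
      ENNReal.toReal_ofReal (by positivity), ENNReal.toReal_ofReal (by positivity)]
    push_cast
    rw [hprod, hnorm]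
    simp only [ENNReal.toReal_pow, ENNReal.toReal_inv, ENNReal.toReal_ofNat, coe_nnnorm, Int.norm_eq_abs,
      Real.coe_sqrt, NNReal.coe_real_pi]
    have hp : (3.1415 : ℝ) < Real.pi := Real.pi_gt_d4
    have hp2 : (3.1415 : ℝ) ^ 2 < Real.pi ^ 2 := pow_lt_pow_left₀ hp (by norm_num) two_ne_zero
    have hs : Real.sqrt |((16200000 : ℤ) : ℝ)| < 4025 := by
      rw [Real.sqrt_lt' (by norm_num)]
      norm_num
    generalize Real.sqrt |((Algebra.norm ℚ (S.e z) : ℚ) : ℝ)| = n at *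
    generalize Real.sqrt |((16200000 : ℤ) : ℝ)| = d at *
    have e1 : n * (2⁻¹ ^ 2 * d) * 2 ^ 5 = (8 * d) * n := by ring
    have e2 : 2 ^ 1 * Real.pi ^ 2 * ((22 / 5) ^ 5 * n) = (2 * (22 / 5) ^ 5 * Real.pi ^ 2) * n := by ring
    rw [e1, e2]
    refine mul_lt_mul_of_pos_right ?_ hn
    norm_num at hp2 ⊢
    linarith
  obtain ⟨a, haI, ha0, hlt⟩ := exists_ne_zero_mem_ideal_lt K I hvol
  obtain ⟨a, haJ, rfl⟩ := (FractionalIdeal.mem_coeIdeal _).1 haI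
  have ha2 : a ^ 2 ∈ Ideal.span {S.E z} := by rw [← hJ]; exact Ideal.pow_mem_pow haJ 2
  obtain ⟨c, hc⟩ := Ideal.mem_span_singleton'.1 ha2
  refine ⟨S.E.symm c, S.E.symm a, ?_, ?_, ?_⟩
  · intro h
    have : c = 0 := by simpa using h
    rw [this, zero_mul] at hc
    apply ha0
    have : a = 0 := by simpa using hc.symm
    rw [this, map_zero]
  · apply S.E.injective
    simp [hc]
  · intro φ
    have h1 := hlt (InfinitePlace.mk φ)
    have h2 : InfinitePlace.mk φ (algebraMap (𝓞 K) K a) ^ 2 = ‖φ (S.e (S.E.symm c))‖ * InfinitePlace.mk φ (S.e z) := by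
      rw [← map_pow, ← map_pow, ← hc, map_mul, map_mul, ← InfinitePlace.apply]
      congr 2
      · rw [← S.E_coe]; simp
    have h3 : ((f (InfinitePlace.mk φ) : NNReal) : ℝ) = 22 / 5 * Real.sqrt (InfinitePlace.mk φ (S.e z)) := rfl
    rw [h3] at h1
    have hpos : 0 < InfinitePlace.mk φ (S.e z) := InfinitePlace.pos_iff.2 hz'
    have h4 := pow_lt_pow_left₀ h1 (by positivity) two_ne_zero
    rw [mul_pow, Real.sq_sqrt hpos.le, h2] at h4
    have := lt_of_mul_lt_mul_right h4 hpos.le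
    norm_num at this ⊢
    exact this

end Setup

end

section

open Polynomial in
/-- The defining quintic over `ℤ`. -/
noncomputable def quintZ : Polynomial ℤ := Polynomial.X ^ 5 - 20 * Polynomial.X ^ 2 + 30 * Polynomial.X - 60

open Polynomial in
theorem quintZ_monic : quintZ.Monic := by
  unfold quintZ
  monicity!

open Polynomial in
theorem quintZ_deg : quintZ.natDegree = 5 := by
  unfold quintZ
  compute_degree!

open Polynomial in
theorem quintZ_irr : Irreducible quintZ := by
  have hP : (Ideal.span {(5 : ℤ)}).IsPrime := by
    rw [Ideal.span_singleton_prime (by norm_num)]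
    exact Int.prime_iff_natAbs_prime.2 (by norm_num)
  refine irreducible_of_eisenstein_criterion hP ?_ ?_ ?_ ?_ quintZ_monic.isPrimitive
  · rw [quintZ_monic.leadingCoeff, Ideal.mem_span_singleton]
    norm_num
  · intro n hn
    rw [degree_eq_natDegree quintZ_monic.ne_zero, quintZ_deg] at hn
    have hn' : n < 5 := by exact_mod_cast hn
    rw [Ideal.mem_span_singleton]
    interval_cases n <;> simp [quintZ, Polynomial.coeff_X, Polynomial.coeff_ofNat_mul] <;> norm_num
  · rw [degree_eq_natDegree quintZ_monic.ne_zero, quintZ_deg]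
    norm_num
  · rw [Ideal.span_singleton_pow, Ideal.mem_span_singleton]
    simp [quintZ]

open Polynomial in
/-- The defining quintic over `ℚ`. -/
noncomputable def quintQ : Polynomial ℚ := quintZ.map (Int.castRingHom ℚ)

open Polynomial in
theorem quintQ_monic : quintQ.Monic := quintZ_monic.map _

open Polynomial in
theorem quintQ_irr : Irreducible quintQ :=
  (quintZ_monic.irreducible_iff_irreducible_map_fraction_map (K := ℚ)).1 quintZ_irr

instance : Fact (Irreducible quintQ) := ⟨quintQ_irr⟩

/-- The quintic field. -/
abbrev KQ : Type := AdjoinRoot quintQ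

instance : Module.Finite ℚ KQ := quintQ_monic.finite_adjoinRoot

instance : NumberField KQ where

theorem KQ_finrank : Module.finrank ℚ KQ = 5 := by
  rw [(AdjoinRoot.powerBasis quintQ_monic.ne_zero).finrank, AdjoinRoot.powerBasis_dim, quintQ,
    quintZ_monic.natDegree_map, quintZ_deg]

/-- The generator of the quintic field. -/
noncomputable def θ : KQ := AdjoinRoot.root quintQ

theorem quintQ_eval {R : Type*} [CommRing R] (o : ℚ →+* R) (t : R) :
    Polynomial.eval₂ o t quintQ = t ^ 5 - 20 * t ^ 2 + 30 * t - 60 := by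
  simp [quintQ, quintZ, Polynomial.eval₂_map, Polynomial.eval₂_sub, Polynomial.eval₂_add, Polynomial.eval₂_mul]

theorem θ_eq : θ ^ 5 - 20 * θ ^ 2 + 30 * θ - 60 = 0 := by
  have := AdjoinRoot.eval₂_root quintQ
  rwa [quintQ_eval] at this

theorem KQ_table : V.Table θ
    ((-84/41) * θ ^ 0 + (57/41) * θ ^ 1 + (16/41) * θ ^ 2 + (3/41) * θ ^ 3 + (-2/41) * θ ^ 4)
    ((-24/41) * θ ^ 0 + (69/41) * θ ^ 1 + (-13/41) * θ ^ 2 + (-5/41) * θ ^ 3 + (-7/82) * θ ^ 4)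
    ((-60/41) * θ ^ 0 + (-53/41) * θ ^ 1 + (-12/41) * θ ^ 2 + (8/41) * θ ^ 3 + (3/82) * θ ^ 4) where
  h11 := by
    linear_combination (0) * θ_eq
  h12 := by
    linear_combination ((-2/41) * θ ^ 0) * θ_eq
  h13 := by
    linear_combination ((-7/82) * θ ^ 0) * θ_eq
  h14 := by
    linear_combination ((3/82) * θ ^ 0) * θ_eq
  h22 := by
    linear_combination ((-52/1681) * θ ^ 0 + (-55/1681) * θ ^ 1 + (-12/1681) * θ ^ 2 + (4/1681) * θ ^ 3) * θ_eq
  h23 := by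
    linear_combination ((-633/3362) * θ ^ 0 + (-45/1681) * θ ^ 1 + (-1/3362) * θ ^ 2 + (7/1681) * θ ^ 3) * θ_eq
  h24 := by
    linear_combination ((447/3362) * θ ^ 0 + (72/1681) * θ ^ 1 + (-23/3362) * θ ^ 2 + (-3/1681) * θ ^ 3) * θ_eq
  h33 := by
    linear_combination ((-108/1681) * θ ^ 0 + (116/1681) * θ ^ 1 + (35/1681) * θ ^ 2 + (49/6724) * θ ^ 3) * θ_eq
  h34 := by
    linear_combination ((140/1681) * θ ^ 0 + (-35/3362) * θ ^ 1 + (-71/3362) * θ ^ 2 + (-21/6724) * θ ^ 3) * θ_eq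
  h44 := by
    linear_combination ((-306/1681) * θ ^ 0 + (28/1681) * θ ^ 1 + (24/1681) * θ ^ 2 + (9/6724) * θ ^ 3) * θ_eq

/-- The embedding of the order in the field. -/
noncomputable def eKQ : V →+* KQ := V.lift _ _ _ _ KQ_table

theorem eKQ_span : ⊤ ≤ Submodule.span ℚ (Set.range fun i => eKQ (V.bb i)) := by
  have hmem : ∀ a : V, eKQ a ∈ Submodule.span ℚ (Set.range fun i => eKQ (V.bb i)) := by
    intro a
    rw [V.sum_bb a, map_sum]
    refine Submodule.sum_mem _ fun i _ => ?_
    have : eKQ ((a.co i : V) * V.bb i) = ((a.co i : ℤ) : ℚ) • eKQ (V.bb i) := by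
      rw [map_mul, map_intCast, Algebra.smul_def]
      simp
    rw [this]
    exact Submodule.smul_mem _ _ (Submodule.subset_span ⟨i, rfl⟩)
  have hθ : eKQ (V.bb 1) = θ := by
    simp [eKQ, V.lift_apply, V.bb]
  rw [← (AdjoinRoot.powerBasis quintQ_monic.ne_zero).basis.span_eq, Submodule.span_le]
  rintro _ ⟨i, rfl⟩
  rw [PowerBasis.basis_eq_pow]
  have : (AdjoinRoot.powerBasis quintQ_monic.ne_zero).gen = eKQ (V.bb 1) := by
    rw [hθ, θ, AdjoinRoot.powerBasis_gen]
  rw [this, ← map_pow]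
  exact hmem _

/-- The number field with its integral basis. -/
noncomputable def SK : Setup KQ where
  e := eKQ
  B := basisOfTopLeSpanOfCardEqFinrank _ eKQ_span (by rw [KQ_finrank]; rfl)
  hB := fun i => by simp

end

section

open V Module

namespace Setup

variable {K : Type} [Field K] [NumberField K]

theorem c0_bound (S : Setup K) (a : V) (M : ℝ) (h : ∀ φ : K →+* ℂ, ‖φ (S.e a)‖ ≤ M) :
    |(a.c0 : ℝ)| ≤ M := by
  have h1 := trace_eq_sum_embeddings (K := ℚ) (L := K) ℂ (x := S.e a)
  rw [S.trace_e] at h1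
  have h2 : ‖algebraMap ℚ ℂ ((5 * a.c0 : ℤ) : ℚ)‖ ≤ ∑ σ : K →ₐ[ℚ] ℂ, M := by
    rw [h1]
    exact (norm_sum_le _ _).trans (Finset.sum_le_sum fun σ _ => h σ.toRingHom)
  rw [Finset.sum_const, Finset.card_univ, AlgHom.card, S.finrank] at h2
  have h3 : algebraMap ℚ ℂ ((5 * a.c0 : ℤ) : ℚ) = ((5 * a.c0 : ℝ) : ℂ) := by simp
  rw [h3, Complex.norm_real, Real.norm_eq_abs, abs_mul] at h2
  norm_num at h2
  linarith

theorem nm_bound (S : Setup K) (a : V) (M : ℝ) (h : ∀ φ : K →+* ℂ, ‖φ (S.e a)‖ ≤ M) :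
    |(nm a : ℝ)| ≤ M ^ 5 := by
  have h1 := Algebra.norm_eq_prod_embeddings ℚ ℂ (S.e a)
  rw [S.norm_e] at h1
  have h2 : ‖algebraMap ℚ ℂ ((nm a : ℤ) : ℚ)‖ ≤ ∏ σ : K →ₐ[ℚ] ℂ, M := by
    rw [h1, norm_prod]
    exact Finset.prod_le_prod (fun _ _ => norm_nonneg _) fun σ _ => h σ.toRingHom
  rw [Finset.prod_const, Finset.card_univ, AlgHom.card, S.finrank] at h2
  have h3 : algebraMap ℚ ℂ ((nm a : ℤ) : ℚ) = ((nm a : ℝ) : ℂ) := by simp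
  rwa [h3, Complex.norm_real, Real.norm_eq_abs] at h2

theorem root_bound (p q r : ℝ) (w : ℂ) (h : w ^ 5 = p * w ^ 2 + q * w + r) :
    ‖w‖ ^ 5 ≤ |p| * ‖w‖ ^ 2 + |q| * ‖w‖ + |r| := by
  rw [← norm_pow, h]
  refine (norm_add_le _ _).trans (add_le_add ((norm_add_le _ _).trans (add_le_add ?_ ?_)) ?_)
  · simp
  · simp
  · simp

theorem real_bound (p q r R x : ℝ) (hp : 0 ≤ p) (hq : 0 ≤ q) (hr : 0 ≤ r) (hR : 0 < R)
    (hRR : p * R ^ 2 + q * R + r < R ^ 5) (hx : x ^ 5 ≤ p * x ^ 2 + q * x + r) : x ≤ R := by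
  by_contra h
  have h1 : R < x := lt_of_not_ge h
  have h0 : 0 < x := hR.trans h1
  have e1 : R ^ 5 * (p * x ^ 2 + q * x + r) ≤ x ^ 5 * (p * R ^ 2 + q * R + r) := by
    have a1 : R ^ 3 ≤ x ^ 3 := pow_le_pow_left₀ hR.le h1.le 3
    have a2 : R ^ 4 ≤ x ^ 4 := pow_le_pow_left₀ hR.le h1.le 4
    have a3 : R ^ 5 ≤ x ^ 5 := pow_le_pow_left₀ hR.le h1.le 5
    have b1 := mul_le_mul_of_nonneg_left a1 (by positivity : 0 ≤ p * (R ^ 2 * x ^ 2))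
    have b2 := mul_le_mul_of_nonneg_left a2 (by positivity : 0 ≤ q * (R * x))
    have b3 := mul_le_mul_of_nonneg_left a3 hr
    nlinarith
  have e2 := mul_le_mul_of_nonneg_left hx (by positivity : 0 ≤ R ^ 5)
  have e3 := mul_lt_mul_of_pos_left hRR (by positivity : 0 < x ^ 5)
  linarith

theorem b1_bound (S : Setup K) (φ : K →+* ℂ) : ‖φ (S.e (bb 1))‖ ≤ 3267 / 1000 := by
  have hr : (bb 1) ^ 5 = 20 * (bb 1) ^ 2 + (- 30) * bb 1 + (60 : V) := by decide
  have h := congrArg (φ.comp S.e) hr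
  simp only [map_mul, map_add, map_neg, map_pow, map_ofNat, RingHom.comp_apply] at h
  have h2 := root_bound 20 (-30) 60 _ (by push_cast; exact h)
  exact real_bound _ _ _ _ _ (abs_nonneg _) (abs_nonneg _) (abs_nonneg _) (by norm_num) (by norm_num) h2

theorem b2_bound (S : Setup K) (φ : K →+* ℂ) : ‖φ (S.e (bb 2))‖ ≤ 3703 / 1000 := by
  have hr : (bb 2) ^ 5 = 40 * (bb 2) ^ 2 + (- 30) * bb 2 + (36 : V) := by decide
  have h := congrArg (φ.comp S.e) hr
  simp only [map_mul, map_add, map_neg, map_pow, map_ofNat, RingHom.comp_apply] at h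
  have h2 := root_bound 40 (-30) 36 _ (by push_cast; exact h)
  exact real_bound _ _ _ _ _ (abs_nonneg _) (abs_nonneg _) (abs_nonneg _) (by norm_num) (by norm_num) h2

theorem b3_bound (S : Setup K) (φ : K →+* ℂ) : ‖φ (S.e (bb 3))‖ ≤ 4311 / 1000 := by
  have hr : (bb 3) ^ 5 = (- 50) * (bb 3) ^ 2 + 75 * bb 3 + (-234 : V) := by decide
  have h := congrArg (φ.comp S.e) hr
  simp only [map_mul, map_add, map_neg, map_pow, map_ofNat, RingHom.comp_apply] at h
  have h2 := root_bound (-50) 75 (-234) _ (by push_cast; exact h)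
  exact real_bound _ _ _ _ _ (abs_nonneg _) (abs_nonneg _) (abs_nonneg _) (by norm_num) (by norm_num) h2

theorem b4_bound (S : Setup K) (φ : K →+* ℂ) : ‖φ (S.e (bb 4))‖ ≤ 5111 / 1000 := by
  have hr : (bb 4) ^ 5 = (- 30) * (bb 4) ^ 2 + (-405) * bb 4 + (-630 : V) := by decide
  have h := congrArg (φ.comp S.e) hr
  simp only [map_mul, map_add, map_neg, map_pow, map_ofNat, RingHom.comp_apply] at h
  have h2 := root_bound (-30) (-405) (-630) _ (by push_cast; exact h)
  exact real_bound _ _ _ _ _ (abs_nonneg _) (abs_nonneg _) (abs_nonneg _) (by norm_num) (by norm_num) h2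

end Setup

/-- The bounds satisfied by the coordinates of a small element. -/
structure V.Small (a : V) : Prop where
  s0 : |a.c0| ≤ 19
  s34 : |a.c3 + a.c4| ≤ 10
  s34' : |a.c3 - a.c4| ≤ 11
  s12 : |a.c1 + a.c2| ≤ 13
  s12' : |a.c1 - a.c2| ≤ 16
  sq : |a.c0 ^ 2 - 12 * (a.c1 * a.c3 + a.c1 * a.c4 + a.c2 * a.c3 - a.c2 * a.c4)| ≤ 374
  sn : |nm a| ≤ 2719736

theorem Setup.small {K : Type} [Field K] [NumberField K] (S : Setup K) (a : V)
    (h : ∀ φ : K →+* ℂ, ‖φ (S.e a)‖ < 484 / 25) : a.Small := by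
  have hb : ∀ (b : V) (M : ℝ), (∀ φ : K →+* ℂ, ‖φ (S.e b)‖ ≤ M) → |((a * b).c0 : ℝ)| ≤ 484 / 25 * M := by
    intro b M hM
    refine S.c0_bound _ _ fun φ => ?_
    rw [map_mul, map_mul, norm_mul]
    exact mul_le_mul (h φ).le (hM φ) (norm_nonneg _) (by norm_num)
  have g1 := hb _ _ S.b1_bound
  have g2 := hb _ _ S.b2_bound
  have g3 := hb _ _ S.b3_bound
  have g4 := hb _ _ S.b4_bound
  have g0 := S.c0_bound _ _ fun φ => (h φ).le
  have gs := hb a _ fun φ => (h φ).le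
  have gn := S.nm_bound _ _ fun φ => (h φ).le
  have conv : ∀ (n m : ℤ) (M : ℝ), |(n : ℝ)| ≤ M → M < m + 1 → |n| ≤ m := by
    intro n m M h1 h2
    have : ((|n| : ℤ) : ℝ) < ((m + 1 : ℤ) : ℝ) := by push_cast; linarith
    have : |n| < m + 1 := by exact_mod_cast this
    omega
  have g0 := conv _ 19 _ g0 (by norm_num)
  have g1 := conv _ 63 _ g1 (by norm_num)
  have g2 := conv _ 71 _ g2 (by norm_num)
  have g3 := conv _ 83 _ g3 (by norm_num)
  have g4 := conv _ 98 _ g4 (by norm_num)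
  have gs := conv _ 374 _ gs (by norm_num)
  have gn := conv _ 2719736 _ gn (by norm_num)
  simp only [mul_c0, bb] at g1 g2 g3 g4 gs
  simp at g1 g2 g3 g4
  simp only [abs_le] at *
  constructor <;> simp only [abs_le] <;> first | omega | skip
  · constructor <;> nlinarith

end

section

namespace V

/-- The integers in `[-19, 19]` congruent to `r` modulo `8` and not to `1` modulo `3`, shifted by `120`. -/
def cls : ℕ → List ℕ
  | 0 => [104, 120, 128]
  | 1 => [105, 113, 129, 137]
  | 2 => [114, 122, 138]
  | 3 => [107, 123, 131]
  | 4 => [108, 116, 132]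
  | 5 => [101, 117, 125]
  | 6 => [102, 110, 126, 134]
  | 7 => [111, 119, 135]
  | _ => []

/-- The integers in `[-14, 14]` congruent to `r` modulo `8`, shifted by `120`. -/
def clt : ℕ → List ℕ
  | 0 => [112, 120, 128]
  | 1 => [113, 121, 129]
  | 2 => [106, 114, 122, 130]
  | 3 => [107, 115, 123, 131]
  | 4 => [108, 116, 124, 132]
  | 5 => [109, 117, 125, 133]
  | 6 => [110, 118, 126, 134]
  | 7 => [111, 119, 127]
  | _ => []

/-- The classes of squares modulo the cube of `κ`. -/
def sqCls : List ((ℕ × ℕ × ℕ) × List ℕ) := [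
    ((0, 0, 0), [0, 1, 3, 4]), ((0, 0, 4), [5, 7]), ((0, 2, 2), [1, 7]), ((0, 2, 6), [0, 3, 4, 5]), ((0, 4,
    0), [1, 3]), ((0, 4, 4), [5, 7]), ((0, 6, 2), [0, 1, 4, 7]), ((0, 6, 6), [3, 5]), ((1, 0, 3), [6]), ((1,
    0, 7), [2]), ((1, 2, 1), [4]), ((1, 2, 3), [5]), ((1, 2, 5), [0]), ((1, 4, 3), [6]), ((1, 4, 7), [2]),
    ((1, 6, 1), [4]), ((1, 6, 3), [1, 3]), ((1, 6, 5), [0]), ((1, 6, 7), [3]), ((2, 0, 6), [2]), ((2, 2, 0),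
    [6]), ((2, 4, 2), [2]), ((2, 6, 4), [2]), ((3, 0, 1), [2]), ((3, 0, 5), [6]), ((3, 2, 1), [1, 3]), ((3,
    2, 3), [4]), ((3, 2, 5), [1]), ((3, 2, 7), [0]), ((3, 4, 1), [2]), ((3, 4, 5), [6]), ((3, 6, 1), [7]),
    ((3, 6, 3), [4]), ((3, 6, 7), [0]), ((4, 0, 0), [1, 3]), ((4, 0, 4), [0, 4, 5, 7]), ((4, 2, 2), [1, 7]),
    ((4, 2, 6), [3, 5]), ((4, 4, 0), [1, 3]), ((4, 4, 4), [5, 7]), ((4, 6, 2), [1, 7]), ((4, 6, 6), [3, 5]),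
    ((5, 0, 3), [6]), ((5, 0, 7), [2]), ((5, 2, 1), [4]), ((5, 2, 3), [1, 3]), ((5, 2, 5), [0]), ((5, 2, 7),
    [3]), ((5, 4, 3), [6]), ((5, 4, 7), [2]), ((5, 6, 1), [4]), ((5, 6, 3), [5]), ((5, 6, 5), [0]), ((6, 0,
    2), [6]), ((6, 2, 4), [6]), ((6, 4, 6), [6]), ((6, 6, 0), [2]), ((7, 0, 1), [2]), ((7, 0, 5), [6]), ((7,
    2, 1), [7]), ((7, 2, 3), [4]), ((7, 2, 7), [0]), ((7, 4, 1), [2]), ((7, 4, 5), [6]), ((7, 6, 1), [1,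
    3]), ((7, 6, 3), [4]), ((7, 6, 5), [1]), ((7, 6, 7), [0])]

/-- The elements that survive the local tests. -/
def survivors : List V := [
    ⟨0, 0, 0, 0, 0⟩, ⟨17, -8, -1, -2, -5⟩, ⟨9, 5, 2, 3, -4⟩, ⟨9, -7, 5, -9, -1⟩, ⟨12, -4, 3, -6, -1⟩, ⟨0, 5,
    5, 1, -1⟩, ⟨0, 9, -6, -3, 0⟩, ⟨-15, -7, 0, -9, 2⟩, ⟨12, 0, 9, 4, 3⟩, ⟨-12, 8, 5, -2, 5⟩, ⟨-19, 6, 5, 0,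
    5⟩, ⟨-12, 0, 3, 0, -3⟩, ⟨9, 4, -8, -2, -2⟩, ⟨0, -2, -2, -2, -2⟩, ⟨9, -8, 4, -2, -2⟩, ⟨5, 0, 3, -2, -1⟩,
    ⟨9, -7, 1, -1, -1⟩, ⟨0, -1, 1, -1, -1⟩, ⟨9, 5, 1, -1, -1⟩, ⟨-12, 8, -3, 0, -1⟩, ⟨0, 3, 2, -1, 0⟩, ⟨9, 0,
    0, 0, 0⟩, ⟨9, 3, 2, 5, 0⟩, ⟨5, 2, -7, -4, 1⟩, ⟨9, 1, -7, -3, 1⟩, ⟨0, 1, -1, -3, 1⟩, ⟨9, 1, 5, -3, 1⟩,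
    ⟨12, 4, -3, 2, 1⟩, ⟨9, 5, -4, -9, 2⟩, ⟨0, 2, 2, -6, 2⟩, ⟨0, -1, 2, -3, 2⟩, ⟨0, 5, 2, 3, 2⟩, ⟨-10, 0, 10,
    4, 2⟩, ⟨-12, 0, 3, -2, 3⟩, ⟨-3, 0, 9, 4, 3⟩, ⟨9, 4, 3, 2, 7⟩]

/-- Bit mask of the squares modulo a small modulus. -/
def sqMod (p mask : ℕ) (n : ℕ) : Bool := mask.testBit (n % p)

/-- Local tests for being a square. -/
def sqTest (n : ℕ) : Bool :=
  sqMod 64 144680414395695635 n && sqMod 63 288872697407275667 n && sqMod 65 20863489977805260307 n && sqMod 11 571 n &&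
    sqMod 17 107287 n && sqMod 19 199411 n &&
    sqMod 23 340831 n && sqMod 29 332473075 n &&
    sqMod 31 303908791 n && sqMod 37 96068509339 n

/-- Subtraction modulo `712390860941760`. -/
def sb (a b : ℕ) : ℕ := Nat.mod (Nat.add a (Nat.mul 712390860941759 b)) 712390860941760

/-- The determinant modulo `712390860941760`. -/
def d5n (m00 m01 m02 m03 m04 m10 m11 m12 m13 m14 m20 m21 m22 m23 m24 m30 m31 m32 m33 m34 m40 m41 m42 m43 m44 : ℕ) : ℕ :=
  sb (Nat.add (Nat.mul (sb (Nat.mul m00 m11) (Nat.mul m01 m10))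
      (sb (Nat.add (Nat.mul m22 (sb (Nat.mul m33 m44) (Nat.mul m34 m43)))
      (Nat.mul m24 (sb (Nat.mul m32 m43) (Nat.mul m33 m42))))
      (Nat.mul m23 (sb (Nat.mul m32 m44) (Nat.mul m34 m42)))))
    (Nat.add (Nat.mul (sb (Nat.mul m00 m13) (Nat.mul m03 m10))
      (sb (Nat.add (Nat.mul m21 (sb (Nat.mul m32 m44) (Nat.mul m34 m42)))
      (Nat.mul m24 (sb (Nat.mul m31 m42) (Nat.mul m32 m41))))
      (Nat.mul m22 (sb (Nat.mul m31 m44) (Nat.mul m34 m41)))))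
    (Nat.add (Nat.mul (sb (Nat.mul m01 m12) (Nat.mul m02 m11))
      (sb (Nat.add (Nat.mul m20 (sb (Nat.mul m33 m44) (Nat.mul m34 m43)))
      (Nat.mul m24 (sb (Nat.mul m30 m43) (Nat.mul m33 m40))))
      (Nat.mul m23 (sb (Nat.mul m30 m44) (Nat.mul m34 m40)))))
    (Nat.add (Nat.mul (sb (Nat.mul m01 m14) (Nat.mul m04 m11))
      (sb (Nat.add (Nat.mul m20 (sb (Nat.mul m32 m43) (Nat.mul m33 m42)))
      (Nat.mul m23 (sb (Nat.mul m30 m42) (Nat.mul m32 m40))))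
      (Nat.mul m22 (sb (Nat.mul m30 m43) (Nat.mul m33 m40)))))
    (Nat.add (Nat.mul (sb (Nat.mul m02 m13) (Nat.mul m03 m12))
      (sb (Nat.add (Nat.mul m20 (sb (Nat.mul m31 m44) (Nat.mul m34 m41)))
      (Nat.mul m24 (sb (Nat.mul m30 m41) (Nat.mul m31 m40))))
      (Nat.mul m21 (sb (Nat.mul m30 m44) (Nat.mul m34 m40)))))
    (Nat.mul (sb (Nat.mul m03 m14) (Nat.mul m04 m13))
      (sb (Nat.add (Nat.mul m20 (sb (Nat.mul m31 m42) (Nat.mul m32 m41)))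
      (Nat.mul m22 (sb (Nat.mul m30 m41) (Nat.mul m31 m40))))
      (Nat.mul m21 (sb (Nat.mul m30 m42) (Nat.mul m32 m40))))))))))
    (Nat.add (Nat.mul (sb (Nat.mul m00 m12) (Nat.mul m02 m10))
      (sb (Nat.add (Nat.mul m21 (sb (Nat.mul m33 m44) (Nat.mul m34 m43)))
      (Nat.mul m24 (sb (Nat.mul m31 m43) (Nat.mul m33 m41))))
      (Nat.mul m23 (sb (Nat.mul m31 m44) (Nat.mul m34 m41)))))
    (Nat.add (Nat.mul (sb (Nat.mul m00 m14) (Nat.mul m04 m10))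
      (sb (Nat.add (Nat.mul m21 (sb (Nat.mul m32 m43) (Nat.mul m33 m42)))
      (Nat.mul m23 (sb (Nat.mul m31 m42) (Nat.mul m32 m41))))
      (Nat.mul m22 (sb (Nat.mul m31 m43) (Nat.mul m33 m41)))))
    (Nat.add (Nat.mul (sb (Nat.mul m01 m13) (Nat.mul m03 m11))
      (sb (Nat.add (Nat.mul m20 (sb (Nat.mul m32 m44) (Nat.mul m34 m42)))
      (Nat.mul m24 (sb (Nat.mul m30 m42) (Nat.mul m32 m40))))
      (Nat.mul m22 (sb (Nat.mul m30 m44) (Nat.mul m34 m40)))))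
    (Nat.mul (sb (Nat.mul m02 m14) (Nat.mul m04 m12))
      (sb (Nat.add (Nat.mul m20 (sb (Nat.mul m31 m43) (Nat.mul m33 m41)))
      (Nat.mul m23 (sb (Nat.mul m30 m41) (Nat.mul m31 m40))))
      (Nat.mul m21 (sb (Nat.mul m30 m43) (Nat.mul m33 m40))))))))

/-- The norm modulo `712390860941760`. -/
def nmn (x0 x1 x2 x3 x4 : ℕ) : ℕ :=
  d5n
    x0
    (Nat.mod (Nat.add (Nat.mul 712390860941754 x3) (Nat.mul 712390860941754 x4)) 712390860941760)
    (Nat.mod (Nat.add (Nat.mul 712390860941754 x3) (Nat.mul 6 x4)) 712390860941760)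
    (Nat.mod (Nat.add (Nat.mul 712390860941754 x1) (Nat.mul 712390860941754 x2)) 712390860941760)
    (Nat.mod (Nat.add (Nat.mul 712390860941754 x1) (Nat.mul 6 x2)) 712390860941760)
    x1
    (Nat.mod (Nat.add x0 (Nat.add (Nat.mul 712390860941759 x1) (Nat.add x2 (Nat.add (Nat.mul 712390860941759 x3) (Nat.mul 2 x4))))) 712390860941760)
    (Nat.mod (Nat.add x1 (Nat.add x2 (Nat.add (Nat.mul 712390860941758 x3) (Nat.mul 712390860941759 x4)))) 712390860941760)
    (Nat.mod (Nat.add (Nat.mul 712390860941759 x1) (Nat.add (Nat.mul 712390860941758 x2) (Nat.add (Nat.mul 3 x3) (Nat.mul 4 x4)))) 712390860941760)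
    (Nat.mod (Nat.add (Nat.mul 2 x1) (Nat.add (Nat.mul 712390860941759 x2) (Nat.add (Nat.mul 4 x3) (Nat.mul 5 x4)))) 712390860941760)
    x2
    (Nat.mod (Nat.add x1 (Nat.add x2 (Nat.mul 712390860941757 x4))) 712390860941760)
    (Nat.mod (Nat.add x0 (Nat.add x1 (Nat.add (Nat.mul 712390860941759 x2) (Nat.add x3 (Nat.mul 712390860941758 x4))))) 712390860941760)
    (Nat.mod (Nat.add x2 (Nat.add (Nat.mul 2 x3) (Nat.mul 712390860941757 x4))) 712390860941760)
    (Nat.mod (Nat.add (Nat.mul 712390860941757 x1) (Nat.add (Nat.mul 712390860941758 x2) (Nat.add (Nat.mul 712390860941757 x3) (Nat.mul 2 x4)))) 712390860941760)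
    x3
    (Nat.mod (Nat.add (Nat.mul 712390860941759 x1) (Nat.add (Nat.mul 712390860941759 x2) (Nat.add x3 (Nat.mul 712390860941759 x4)))) 712390860941760)
    (Nat.mod (Nat.add (Nat.mul 712390860941759 x1) (Nat.add (Nat.mul 712390860941757 x2) (Nat.add x3 x4))) 712390860941760)
    (Nat.mod (Nat.add x0 (Nat.add x1 (Nat.add x2 (Nat.add (Nat.mul 712390860941759 x3) (Nat.mul 712390860941758 x4))))) 712390860941760)
    (Nat.mod (Nat.add (Nat.mul 712390860941759 x1) (Nat.add x2 (Nat.add (Nat.mul 712390860941758 x3) (Nat.mul 3 x4)))) 712390860941760)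
    x4
    (Nat.mod (Nat.add (Nat.mul 712390860941759 x1) (Nat.add x2 (Nat.add (Nat.mul 712390860941759 x3) (Nat.mul 712390860941759 x4)))) 712390860941760)
    (Nat.mod (Nat.add x1 (Nat.add x2 (Nat.add x3 (Nat.mul 712390860941759 x4)))) 712390860941760)
    (Nat.mod (Nat.add (Nat.mul 712390860941759 x1) (Nat.add x2 x4)) 712390860941760)
    (Nat.mod (Nat.add x0 (Nat.add (Nat.mul 712390860941759 x1) (Nat.add (Nat.mul 712390860941759 x2) (Nat.add x3 (Nat.mul 2 x4))))) 712390860941760)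

/-- Positive part of the trace form. -/
def trA (c0 c1 c2 c3 c4 : ℕ) : ℕ :=
  Nat.add (Nat.add (Nat.mul c0 c0) 14400) (Nat.add (Nat.mul 12 (Nat.mul c2 c4)) (Nat.mul 2880 (Nat.add c1 c3)))

/-- Negative part of the trace form. -/
def trB (c0 c1 c2 c3 c4 : ℕ) : ℕ :=
  Nat.add (Nat.add (Nat.mul 240 c0) 345600)
    (Nat.mul 12 (Nat.add (Nat.mul c1 (Nat.add c3 c4)) (Nat.mul c2 c3)))

/-- The final tests, in shifted coordinates. -/
def fin3 (c0 c1 c2 c3 c4 : ℕ) : Bool :=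
  bif Nat.ble (trA c0 c1 c2 c3 c4) (Nat.add (trB c0 c1 c2 c3 c4) 374) &&
      Nat.ble (trB c0 c1 c2 c3 c4) (Nat.add (trA c0 c1 c2 c3 c4) 374) then
    bif sqTest (nmn (Nat.add c0 712390860941640) (Nat.add c1 712390860941640) (Nat.add c2 712390860941640)
        (Nat.add c3 712390860941640) (Nat.add c4 712390860941640)) then
      survivors.contains ⟨Int.subNatNat c0 120, Int.subNatNat c1 120, Int.subNatNat c2 120,
        Int.subNatNat c3 120, Int.subNatNat c4 120⟩
    else true
  else true

/-- A test at a prime above three or five. -/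
def ram (h : ℕ) (d : Bool) : Bool := bif Nat.beq h 0 then d else true

/-- Tests at the primes above three and five. -/
def fin2 (c0 c1 c2 c3 c4 : ℕ) : Bool :=
  bif Nat.beq (Nat.mod (Nat.add c0 (Nat.add (Nat.mul 2 c1) (Nat.add c2 c3))) 3) 2 then true else
  bif Nat.testBit 12 (Nat.mod (Nat.add c0 (Nat.add c2 c3)) 5) then true else
  bif ram (Nat.mod c0 3) (Nat.beq (Nat.mod (Nat.add c1 (Nat.mul 2 c4)) 3) 0) &&
      (ram (Nat.mod (Nat.add c0 (Nat.add (Nat.mul 2 c1) (Nat.add c2 c3))) 3)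
        (Nat.beq (Nat.mod (Nat.add c1 (Nat.mul 2 (Nat.add c3 c4))) 3) 0) &&
      ram (Nat.mod (Nat.add c0 (Nat.add c2 c3)) 5)
        (Nat.beq (Nat.mod (Nat.add c1 (Nat.mul 2 (Nat.add c2 (Nat.add (Nat.mul 2 c3) c4)))) 5) 0)) then
    fin3 c0 c1 c2 c3 c4
  else true

/-- A bound for the sum and the difference, in shifted coordinates. -/
def guard (m n c d : ℕ) : Bool :=
  Nat.ble (Nat.add c d) (Nat.add 240 m) && (Nat.ble 240 (Nat.add (Nat.add c d) m) &&
    (Nat.ble c (Nat.add d n) && Nat.ble d (Nat.add c n)))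

/-- The whole enumeration. -/
def enumAll : Bool :=
  sqCls.all fun t => (List.range' 110 21).all fun c4 =>
    (clt (Nat.mod (Nat.add t.1.2.2 (Nat.mul 2 c4)) 8)).all fun c3 =>
      bif guard 10 11 c3 c4 then
        (clt t.1.1).all fun c1 => (clt (Nat.mod (Nat.add t.1.2.1 (Nat.mul 5 c4)) 8)).all fun c2 =>
          bif guard 13 16 c1 c2 then
            t.2.all fun a0 => (cls (Nat.mod (Nat.add a0 (Nat.mul 3 c4)) 8)).all fun c0 =>
              fin2 c0 c1 c2 c3 c4
          else true
      else true

theorem enumAll_true : enumAll = true := by decide +kernel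

end V

end

section

namespace V

/-- The local tests, in coordinates. -/
structure Tests (a : V) : Prop where
  canon : ∃ t ∈ sqCls, (t.1.1 : ℤ) = a.c1 % 8 ∧ (t.1.2.1 : ℤ) = (a.c2 - 5 * a.c4) % 8 ∧
    (t.1.2.2 : ℤ) = (a.c3 - 2 * a.c4) % 8 ∧ ∃ a0 ∈ t.2, (a0 : ℤ) = (a.c0 - 3 * a.c4) % 8
  h1 : a.c0 % 3 ≠ 1
  h2 : (a.c0 + 2 * a.c1 + a.c2 + a.c3) % 3 ≠ 2
  h5 : (a.c0 + a.c2 + a.c3) % 5 ≠ 2 ∧ (a.c0 + a.c2 + a.c3) % 5 ≠ 3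
  r1 : a.c0 % 3 = 0 → (a.c1 + 2 * a.c4) % 3 = 0
  r2 : (a.c0 + 2 * a.c1 + a.c2 + a.c3) % 3 = 0 → (a.c1 + 2 * a.c3 + 2 * a.c4) % 3 = 0
  r5 : (a.c0 + a.c2 + a.c3) % 5 = 0 → (a.c1 + 2 * a.c2 + 4 * a.c3 + 2 * a.c4) % 5 = 0
  sq : ∃ k : ℤ, nm a = k ^ 2

theorem clt_mem (C r : ℕ) (h1 : 106 ≤ C) (h2 : C ≤ 134) (h : C % 8 = r) : C ∈ clt r := by
  subst h
  interval_cases C <;> decide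

theorem cls_mem (C r : ℕ) (h1 : 101 ≤ C) (h2 : C ≤ 139) (h3 : C % 3 ≠ 1) (h : C % 8 = r) : C ∈ cls r := by
  subst h
  interval_cases C <;> first | decide | exact absurd rfl h3

/-- The modulus of the square tests. -/
abbrev PP : ℕ := 712390860941760

theorem PP_zero : (712390860941760 : ZMod PP) = 0 := by
  exact_mod_cast ZMod.natCast_self PP

theorem castP (n : ℕ) : ((Nat.mod n 712390860941760 : ℕ) : ZMod PP) = n := ZMod.natCast_mod n PP

theorem sb_cast (a b : ℕ) : ((sb a b : ℕ) : ZMod PP) = a - b := by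
  rw [sb, castP]
  simp only [Nat.add_eq, Nat.mul_eq]
  push_cast
  linear_combination (b : ZMod PP) * PP_zero

theorem d5n_cast (m00 m01 m02 m03 m04 m10 m11 m12 m13 m14 m20 m21 m22 m23 m24 m30 m31 m32 m33 m34 m40 m41 m42 m43 m44 : ℕ)
    (n00 n01 n02 n03 n04 n10 n11 n12 n13 n14 n20 n21 n22 n23 n24 n30 n31 n32 n33 n34 n40 n41 n42 n43 n44 : ℤ)
    (h00 : (m00 : ZMod PP) = n00) (h01 : (m01 : ZMod PP) = n01) (h02 : (m02 : ZMod PP) = n02)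
    (h03 : (m03 : ZMod PP) = n03) (h04 : (m04 : ZMod PP) = n04) (h10 : (m10 : ZMod PP) = n10)
    (h11 : (m11 : ZMod PP) = n11) (h12 : (m12 : ZMod PP) = n12) (h13 : (m13 : ZMod PP) = n13)
    (h14 : (m14 : ZMod PP) = n14) (h20 : (m20 : ZMod PP) = n20) (h21 : (m21 : ZMod PP) = n21)
    (h22 : (m22 : ZMod PP) = n22) (h23 : (m23 : ZMod PP) = n23) (h24 : (m24 : ZMod PP) = n24)
    (h30 : (m30 : ZMod PP) = n30) (h31 : (m31 : ZMod PP) = n31) (h32 : (m32 : ZMod PP) = n32)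
    (h33 : (m33 : ZMod PP) = n33) (h34 : (m34 : ZMod PP) = n34) (h40 : (m40 : ZMod PP) = n40)
    (h41 : (m41 : ZMod PP) = n41) (h42 : (m42 : ZMod PP) = n42) (h43 : (m43 : ZMod PP) = n43)
    (h44 : (m44 : ZMod PP) = n44) :
    ((d5n m00 m01 m02 m03 m04 m10 m11 m12 m13 m14 m20 m21 m22 m23 m24 m30 m31 m32 m33 m34 m40 m41 m42 m43 m44 : ℕ) :
      ZMod PP) =
    ((d5 n00 n01 n02 n03 n04 n10 n11 n12 n13 n14 n20 n21 n22 n23 n24 n30 n31 n32 n33 n34 n40 n41 n42 n43 n44 : ℤ) :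
      ZMod PP) := by
  simp only [d5n, d5, sb_cast, Nat.add_eq, Nat.mul_eq, Nat.cast_add, Nat.cast_mul, Int.cast_add, Int.cast_sub,
    Int.cast_mul, h00, h01, h02, h03, h04, h10, h11, h12, h13, h14, h20, h21, h22, h23, h24, h30, h31, h32, h33, h34,
    h40, h41, h42, h43, h44]
  ring

theorem lit1 : (712390860941759 : ZMod PP) = -1 := by linear_combination PP_zero
theorem lit2 : (712390860941758 : ZMod PP) = -2 := by linear_combination PP_zero
theorem lit3 : (712390860941757 : ZMod PP) = -3 := by linear_combination PP_zero
theorem lit6 : (712390860941754 : ZMod PP) = -6 := by linear_combination PP_zero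

theorem nmn_cast (x0 x1 x2 x3 x4 : ℕ) (a0 a1 a2 a3 a4 : ℤ)
    (h0 : (x0 : ZMod PP) = a0) (h1 : (x1 : ZMod PP) = a1) (h2 : (x2 : ZMod PP) = a2)
    (h3 : (x3 : ZMod PP) = a3) (h4 : (x4 : ZMod PP) = a4) :
    ((nmn x0 x1 x2 x3 x4 : ℕ) : ZMod PP) = ((nmx a0 a1 a2 a3 a4 : ℤ) : ZMod PP) := by
  unfold nmn nmx
  apply d5n_cast <;>
  · try simp only [castP, Nat.add_eq, Nat.mul_eq]
    push_cast
    simp only [h0, h1, h2, h3, h4, lit1, lit2, lit3, lit6]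
    try ring

theorem sqMod_of (p mask n : ℕ) (k : ℤ) (hp : p ∣ PP) (hp0 : 0 < p)
    (hm : ∀ j, j < p → mask.testBit (j ^ 2 % p) = true) (h : (n : ZMod PP) = ((k ^ 2 : ℤ) : ZMod PP)) :
    sqMod p mask n = true := by
  have h1 : ((n : ℤ) : ZMod PP) = ((k ^ 2 : ℤ) : ZMod PP) := by rw [← h]; simp
  rw [ZMod.intCast_eq_intCast_iff] at h1
  have h2 : (n : ℤ) ≡ k ^ 2 [ZMOD p] := h1.of_dvd (by exact_mod_cast hp)
  have h3 : (k % p) ^ 2 ≡ k ^ 2 [ZMOD p] := (Int.mod_modEq k p).pow 2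
  have hpz : (0 : ℤ) < p := by exact_mod_cast hp0
  have h5 := Int.emod_nonneg k hpz.ne'
  have h6 := Int.emod_lt_of_pos k hpz
  obtain ⟨j, hj⟩ := Int.eq_ofNat_of_zero_le h5
  rw [hj] at h3 h6
  have h4 : (n : ℤ) ≡ ((j ^ 2 : ℕ) : ℤ) [ZMOD p] := by push_cast; exact h2.trans h3.symm
  have h7 : n % p = j ^ 2 % p := (Int.natCast_modEq_iff.mp h4)
  rw [sqMod, h7]
  exact hm j (by exact_mod_cast h6)

theorem sqTest_of (n : ℕ) (k : ℤ) (h : (n : ZMod PP) = ((k ^ 2 : ℤ) : ZMod PP)) : sqTest n = true := by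
  simp only [sqTest, Bool.and_eq_true]
  refine ⟨⟨⟨⟨⟨⟨⟨⟨⟨?_, ?_⟩, ?_⟩, ?_⟩, ?_⟩, ?_⟩, ?_⟩, ?_⟩, ?_⟩, ?_⟩ <;>
    exact sqMod_of _ _ _ k (by decide) (by decide) (by decide +kernel) h

end V

end

section

namespace V

theorem fin3_spec (C0 C1 C2 C3 C4 : ℕ) (k : ℤ)
    (hk : nmx ((C0 : ℤ) - 120) (C1 - 120) (C2 - 120) (C3 - 120) (C4 - 120) = k ^ 2)
    (s1 : -374 ≤ ((C0 : ℤ) - 120) ^ 2 - 12 * (((C1 : ℤ) - 120) * (C3 - 120) + (C1 - 120) * (C4 - 120)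
      + (C2 - 120) * (C3 - 120) - (C2 - 120) * (C4 - 120)))
    (s2 : ((C0 : ℤ) - 120) ^ 2 - 12 * (((C1 : ℤ) - 120) * (C3 - 120) + (C1 - 120) * (C4 - 120)
      + (C2 - 120) * (C3 - 120) - (C2 - 120) * (C4 - 120)) ≤ 374)
    (E : fin3 C0 C1 C2 C3 C4 = true) :
    (⟨C0 - 120, C1 - 120, C2 - 120, C3 - 120, C4 - 120⟩ : V) ∈ survivors := by
  have q1 : Nat.ble (trA C0 C1 C2 C3 C4) (Nat.add (trB C0 C1 C2 C3 C4) 374) = true := by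
    simp only [trA, trB, Nat.ble_eq, Nat.add_eq, Nat.mul_eq]
    zify
    linarith
  have q2 : Nat.ble (trB C0 C1 C2 C3 C4) (Nat.add (trA C0 C1 C2 C3 C4) 374) = true := by
    simp only [trA, trB, Nat.ble_eq, Nat.add_eq, Nat.mul_eq]
    zify
    linarith
  have hc : ∀ (C : ℕ), ((Nat.add C 712390860941640 : ℕ) : ZMod PP) = (((C : ℤ) - 120 : ℤ) : ZMod PP) := by
    intro C
    simp only [Nat.add_eq]
    push_cast
    linear_combination PP_zero
  have q3 := sqTest_of (nmn (Nat.add C0 712390860941640) (Nat.add C1 712390860941640) (Nat.add C2 712390860941640)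
        (Nat.add C3 712390860941640) (Nat.add C4 712390860941640)) k (by
    rw [← hk]
    exact nmn_cast _ _ _ _ _ _ _ _ _ _ (hc _) (hc _) (hc _) (hc _) (hc _))
  rw [fin3, q1, q2, Bool.and_true, cond_true, q3, cond_true, List.contains_iff_mem] at E
  simp only [Int.subNatNat_eq_coe] at E
  exact_mod_cast E

theorem fin2_spec (C0 C1 C2 C3 C4 : ℕ)
    (h2 : (C0 + 2 * C1 + C2 + C3) % 3 ≠ 2)
    (h5 : (C0 + C2 + C3) % 5 ≠ 2) (h5' : (C0 + C2 + C3) % 5 ≠ 3)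
    (r1 : C0 % 3 = 0 → (C1 + 2 * C4) % 3 = 0)
    (r2 : (C0 + 2 * C1 + C2 + C3) % 3 = 0 → (C1 + 2 * C3 + 2 * C4) % 3 = 0)
    (r5 : (C0 + C2 + C3) % 5 = 0 → (C1 + 2 * C2 + 4 * C3 + 2 * C4) % 5 = 0)
    (E : fin2 C0 C1 C2 C3 C4 = true) : fin3 C0 C1 C2 C3 C4 = true := by
  have x1 : Nat.add C0 (Nat.add (Nat.mul 2 C1) (Nat.add C2 C3)) = C0 + 2 * C1 + C2 + C3 := by
    simp only [Nat.add_eq, Nat.mul_eq]; ring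
  have x2 : Nat.add C0 (Nat.add C2 C3) = C0 + C2 + C3 := by
    simp only [Nat.add_eq]; ring
  have x3 : Nat.add C1 (Nat.mul 2 C4) = C1 + 2 * C4 := rfl
  have x4 : Nat.add C1 (Nat.mul 2 (Nat.add C3 C4)) = C1 + 2 * C3 + 2 * C4 := by
    simp only [Nat.add_eq, Nat.mul_eq]; ring
  have x5 : Nat.add C1 (Nat.mul 2 (Nat.add C2 (Nat.add (Nat.mul 2 C3) C4))) = C1 + 2 * C2 + 4 * C3 + 2 * C4 := by
    simp only [Nat.add_eq, Nat.mul_eq]; ring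
  rw [fin2, x1, x2, x3, x4, x5] at E
  generalize C0 + 2 * C1 + C2 + C3 = p1 at *
  generalize C0 + C2 + C3 = p2 at *
  generalize C1 + 2 * C4 = p3 at *
  generalize C1 + 2 * C3 + 2 * C4 = p4 at *
  generalize C1 + 2 * C2 + 4 * C3 + 2 * C4 = p5 at *
  have k1 : Nat.beq (Nat.mod p1 3) 2 = false := by
    refine Bool.eq_false_iff.mpr fun h => h2 (Nat.eq_of_beq_eq_true h)
  have k2 : Nat.testBit 12 (Nat.mod p2 5) = false := by
    change Nat.testBit 12 (p2 % 5) = false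
    have : p2 % 5 = 0 ∨ p2 % 5 = 1 ∨ p2 % 5 = 4 := by omega
    rcases this with h | h | h <;> rw [h] <;> decide
  have ramh : ∀ (n m : ℕ), (n = 0 → m = 0) → ram n (Nat.beq m 0) = true := by
    intro n m h
    rcases n with _ | n
    · rw [h rfl]; rfl
    · rfl
  rw [k1, k2, cond_false, cond_false, ramh (Nat.mod C0 3) (Nat.mod p3 3) r1, ramh (Nat.mod p1 3) (Nat.mod p4 3) r2,
    ramh (Nat.mod p2 5) (Nat.mod p5 5) r5, Bool.and_true,
    Bool.and_true, cond_true] at E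
  exact E

theorem guard_spec (m n C D : ℕ) (h1 : C + D ≤ 240 + m) (h2 : 240 ≤ C + D + m) (h3 : C ≤ D + n) (h4 : D ≤ C + n) :
    guard m n C D = true := by
  simp only [guard, Bool.and_eq_true, Nat.ble_eq, Nat.add_eq]
  exact ⟨h1, h2, h3, h4⟩

theorem enum_spec' (C0 C1 C2 C3 C4 : ℕ) (t : (ℕ × ℕ × ℕ) × List ℕ) (ht : t ∈ sqCls) (a0 : ℕ) (ha0 : a0 ∈ t.2)
    (b0 : 101 ≤ C0) (b0' : C0 ≤ 139) (m0 : C0 % 3 ≠ 1)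
    (b1 : 106 ≤ C1) (b1' : C1 ≤ 134) (b2 : 106 ≤ C2) (b2' : C2 ≤ 134) (b3 : 106 ≤ C3) (b3' : C3 ≤ 134)
    (b4 : 110 ≤ C4) (b4' : C4 ≤ 130) (g1 : guard 10 11 C3 C4 = true) (g2 : guard 13 16 C1 C2 = true)
    (e0 : C0 % 8 = (a0 + 3 * C4) % 8) (e1 : C1 % 8 = t.1.1) (e2 : C2 % 8 = (t.1.2.1 + 5 * C4) % 8)
    (e3 : C3 % 8 = (t.1.2.2 + 2 * C4) % 8) : fin2 C0 C1 C2 C3 C4 = true := by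
  have E := enumAll_true
  simp only [enumAll, List.all_eq_true] at E
  have E1 := E t ht C4 (by rw [List.mem_range'_1]; exact ⟨b4, by omega⟩) C3 (clt_mem _ _ b3 b3' e3)
  rw [g1, cond_true, List.all_eq_true] at E1
  have E2 := E1 C1 (clt_mem _ _ b1 b1' e1)
  rw [List.all_eq_true] at E2
  have E3 := E2 C2 (clt_mem _ _ b2 b2' e2)
  rw [g2, cond_true, List.all_eq_true] at E3
  have E4 := E3 a0 ha0
  rw [List.all_eq_true] at E4
  exact E4 C0 (cls_mem _ _ b0 b0' m0 e0)

theorem enum_spec (a : V) (hs : a.Small) (ht : a.Tests) : a ∈ survivors := by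
  obtain ⟨c0, c1, c2, c3, c4⟩ := a
  obtain ⟨s0, s34, s34', s12, s12', ssq, -⟩ := hs
  rw [abs_le] at s0 s34 s34' s12 s12' ssq
  obtain ⟨s1, s2⟩ := ssq
  obtain ⟨k, hk⟩ := ht.sq
  simp only at s0 s34 s34' s12 s12' s1 s2
  obtain ⟨C0, hC0⟩ := Int.eq_ofNat_of_zero_le (a := c0 + 120) (by omega)
  obtain ⟨C1, hC1⟩ := Int.eq_ofNat_of_zero_le (a := c1 + 120) (by omega)
  obtain ⟨C2, hC2⟩ := Int.eq_ofNat_of_zero_le (a := c2 + 120) (by omega)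
  obtain ⟨C3, hC3⟩ := Int.eq_ofNat_of_zero_le (a := c3 + 120) (by omega)
  obtain ⟨C4, hC4⟩ := Int.eq_ofNat_of_zero_le (a := c4 + 120) (by omega)
  obtain rfl : c0 = C0 - 120 := by clear * - hC0; omega
  obtain rfl : c1 = C1 - 120 := by clear * - hC1; omega
  obtain rfl : c2 = C2 - 120 := by clear * - hC2; omega
  obtain rfl : c3 = C3 - 120 := by clear * - hC3; omega
  obtain rfl : c4 = C4 - 120 := by clear * - hC4; omega
  rw [nm_eq] at hk
  have h1 := ht.h1
  have h2 := ht.h2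
  have h5 := ht.h5
  have r1 := ht.r1
  have r2 := ht.r2
  have r5 := ht.r5
  obtain ⟨t, htm, e1, e2, e3, a0, ha0, e0⟩ := ht.canon
  simp only at h1 h2 h5 r1 r2 r5 e0 e1 e2 e3
  refine fin3_spec _ _ _ _ _ k hk s1 s2 (fin2_spec _ _ _ _ _ ?_ ?_ ?_ ?_ ?_ ?_
    (enum_spec' C0 C1 C2 C3 C4 t htm a0 ha0 ?_ ?_ ?_ ?_ ?_ ?_ ?_ ?_ ?_ ?_ ?_
      (guard_spec _ _ _ _ ?_ ?_ ?_ ?_) (guard_spec _ _ _ _ ?_ ?_ ?_ ?_) ?_ ?_ ?_ ?_))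
  · clear * - h2; omega
  · clear * - h5; omega
  · clear * - h5; omega
  · clear * - r1; omega
  · clear * - r2; omega
  · clear * - r5; omega
  · clear * - s0; omega
  · clear * - s0; omega
  · clear * - h1; omega
  · clear * - s12 s12'; omega
  · clear * - s12 s12'; omega
  · clear * - s12 s12'; omega
  · clear * - s12 s12'; omega
  · clear * - s34 s34'; omega
  · clear * - s34 s34'; omega
  · clear * - s34 s34'; omega
  · clear * - s34 s34'; omega
  · clear * - s34; omega
  · clear * - s34; omega
  · clear * - s34'; omega
  · clear * - s34'; omega
  · clear * - s12; omega
  · clear * - s12; omega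
  · clear * - s12'; omega
  · clear * - s12'; omega
  · clear * - e0; omega
  · clear * - e1; omega
  · clear * - e2; omega
  · clear * - e3; omega

end V

end

section

namespace V

/-- The cube of `κ`. -/
def k3 : V := ⟨20419, 1304, -507, 7722, -6391⟩

/-- The prime element above two. -/
def rh : V := ⟨161, 18, -114, -30, -19⟩

/-- The other prime element above two. -/
def pi1 : V := ⟨2, -4, 1, 0, -1⟩

/-- A residue map modulo `3`. -/
def hh1 (a : V) : ZMod 3 := ((a.c0 : ℤ) : ZMod 3)

/-- A derivation modulo `3`. -/
def dd1 (a : V) : ZMod 3 := ((a.c1 + 2 * a.c4 : ℤ) : ZMod 3)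

theorem hh1_mul (a b : V) : hh1 (a * b) = hh1 a * hh1 b := by
  rw [hh1, hh1, hh1, ← Int.cast_mul, ZMod.intCast_eq_intCast_iff_dvd_sub]
  refine ⟨-(
    (-2) * (a.c1 * b.c3) + (-2) * (a.c1 * b.c4) + (-2) * (a.c2 * b.c3) + 2 * (a.c2 * b.c4) + (-2) * (a.c3 *
    b.c1) + (-2) * (a.c3 * b.c2) + (-2) * (a.c4 * b.c1) + 2 * (a.c4 * b.c2)), ?_⟩
  simp only [mul_c0, mul_c1, mul_c2, mul_c3, mul_c4]
  push_cast
  ring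

theorem dd1_mul (a b : V) : dd1 (a * b) = hh1 a * dd1 b + dd1 a * hh1 b := by
  rw [dd1, dd1, dd1, hh1, hh1, ← Int.cast_mul, ← Int.cast_mul, ← Int.cast_add,
    ZMod.intCast_eq_intCast_iff_dvd_sub]
  refine ⟨-(
    (-1) * (a.c1 * b.c1) + 1 * (a.c1 * b.c2) + (-1) * (a.c1 * b.c3) + 1 * (a.c2 * b.c1) + 1 * (a.c2 * b.c2)
    + (-1) * (a.c2 * b.c4) + (-1) * (a.c3 * b.c1) + 1 * (a.c3 * b.c3) + 2 * (a.c3 * b.c4) + (-1) * (a.c4 *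
    b.c2) + 2 * (a.c4 * b.c3) + 3 * (a.c4 * b.c4)), ?_⟩
  simp only [mul_c0, mul_c1, mul_c2, mul_c3, mul_c4]
  push_cast
  ring

/-- A residue map modulo `3`. -/
def hh2 (a : V) : ZMod 3 := ((a.c0 + 2 * a.c1 + a.c2 + a.c3 : ℤ) : ZMod 3)

/-- A derivation modulo `3`. -/
def dd2 (a : V) : ZMod 3 := ((a.c1 + 2 * a.c3 + 2 * a.c4 : ℤ) : ZMod 3)

theorem hh2_mul (a b : V) : hh2 (a * b) = hh2 a * hh2 b := by
  rw [hh2, hh2, hh2, ← Int.cast_mul, ZMod.intCast_eq_intCast_iff_dvd_sub]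
  refine ⟨-(
    (-2) * (a.c1 * b.c1) + (-3) * (a.c1 * b.c3) + (-2) * (a.c1 * b.c4) + (-1) * (a.c2 * b.c2) + (-3) * (a.c2
    * b.c3) + 1 * (a.c2 * b.c4) + (-3) * (a.c3 * b.c1) + (-3) * (a.c3 * b.c2) + 2 * (a.c3 * b.c3) + 1 *
    (a.c3 * b.c4) + (-2) * (a.c4 * b.c1) + 1 * (a.c4 * b.c2) + 1 * (a.c4 * b.c3) + 5 * (a.c4 * b.c4)), ?_⟩
  simp only [mul_c0, mul_c1, mul_c2, mul_c3, mul_c4]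
  push_cast
  ring

theorem dd2_mul (a b : V) : dd2 (a * b) = hh2 a * dd2 b + dd2 a * hh2 b := by
  rw [dd2, dd2, dd2, hh2, hh2, ← Int.cast_mul, ← Int.cast_mul, ← Int.cast_add,
    ZMod.intCast_eq_intCast_iff_dvd_sub]
  refine ⟨-(
    (-3) * (a.c1 * b.c1) + (-2) * (a.c1 * b.c3) + (-2) * (a.c1 * b.c4) + (-1) * (a.c2 * b.c2) + (-1) * (a.c2
    * b.c4) + (-2) * (a.c3 * b.c1) + (-1) * (a.c3 * b.c3) + (-2) * (a.c4 * b.c1) + (-1) * (a.c4 * b.c2) + 5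
    * (a.c4 * b.c4)), ?_⟩
  simp only [mul_c0, mul_c1, mul_c2, mul_c3, mul_c4]
  push_cast
  ring

/-- A residue map modulo `5`. -/
def hh5 (a : V) : ZMod 5 := ((a.c0 + a.c2 + a.c3 : ℤ) : ZMod 5)

/-- A derivation modulo `5`. -/
def dd5 (a : V) : ZMod 5 := ((a.c1 + 2 * a.c2 + 4 * a.c3 + 2 * a.c4 : ℤ) : ZMod 5)

theorem hh5_mul (a b : V) : hh5 (a * b) = hh5 a * hh5 b := by
  rw [hh5, hh5, hh5, ← Int.cast_mul, ZMod.intCast_eq_intCast_iff_dvd_sub]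
  refine ⟨-(
    (-1) * (a.c1 * b.c3) + (-2) * (a.c1 * b.c4) + (-1) * (a.c2 * b.c2) + (-1) * (a.c2 * b.c3) + 1 * (a.c2 *
    b.c4) + (-1) * (a.c3 * b.c1) + (-1) * (a.c3 * b.c2) + (-1) * (a.c3 * b.c4) + (-2) * (a.c4 * b.c1) + 1 *
    (a.c4 * b.c2) + (-1) * (a.c4 * b.c3) + 1 * (a.c4 * b.c4)), ?_⟩
  simp only [mul_c0, mul_c1, mul_c2, mul_c3, mul_c4]
  push_cast
  ring

theorem dd5_mul (a b : V) : dd5 (a * b) = hh5 a * dd5 b + dd5 a * hh5 b := by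
  rw [dd5, dd5, dd5, hh5, hh5, ← Int.cast_mul, ← Int.cast_mul, ← Int.cast_add,
    ZMod.intCast_eq_intCast_iff_dvd_sub]
  refine ⟨-(
    (-1) * (a.c1 * b.c1) + (-2) * (a.c1 * b.c4) + (-3) * (a.c2 * b.c2) + (-1) * (a.c2 * b.c4) + (-1) * (a.c3
    * b.c3) + (-2) * (a.c3 * b.c4) + (-2) * (a.c4 * b.c1) + (-1) * (a.c4 * b.c2) + (-2) * (a.c4 * b.c3) + 5
    * (a.c4 * b.c4)), ?_⟩
  simp only [mul_c0, mul_c1, mul_c2, mul_c3, mul_c4]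
  push_cast
  ring

theorem der_aux {F : Type*} [Field F] (g z w dg dz dw : F) (h : g * z = w * w)
    (hd : g * dz + dg * z = w * dw + dw * w) (hz : z ≠ 0) (hg : g = 0) : dg = 0 := by
  subst hg
  have hw : w = 0 := by simpa using h.symm
  subst hw
  simpa [hz] using hd

theorem k3_e1 : k3 * ⟨-1845, 437, -412, -283, -453⟩ = ⟨3, 0, 5, 2, 1⟩ := by decide
theorem k3_e2 : k3 * ⟨-1420, 628, -369, -144, -191⟩ = ⟨8, 0, 0, 0, 0⟩ := by decide
theorem k3_r12 : k3 * ⟨-2083418051908622282216352857, -139373485629535310851109383, 141893489452011845649663141, -713401515180833828034817590, 626366638142774877411484094⟩ = rh ^ 12 := by decide +kernel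

/-- Congruence modulo eight of the reduced coordinates. -/
theorem k3_mul (b : V) : ((k3 * b).c0 - 3 * (k3 * b).c4) % 8 = 0 ∧ (k3 * b).c1 % 8 = 0 ∧
    ((k3 * b).c2 - 5 * (k3 * b).c4) % 8 = 0 ∧ ((k3 * b).c3 - 2 * (k3 * b).c4) % 8 = 0 := by
  simp only [mul_c0, mul_c1, mul_c2, mul_c3, mul_c4, k3]
  refine ⟨?_, ?_, ?_, ?_⟩ <;> omega

/-- Boolean form of the test modulo the cube of `κ`. -/
def canonB (a : V) : Bool :=
  sqCls.any fun t => decide ((t.1.1 : ℤ) = a.c1 % 8) && (decide ((t.1.2.1 : ℤ) = (a.c2 - 5 * a.c4) % 8) &&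
    (decide ((t.1.2.2 : ℤ) = (a.c3 - 2 * a.c4) % 8) &&
      t.2.any fun a0 => decide ((a0 : ℤ) = (a.c0 - 3 * a.c4) % 8)))

theorem canonB_iff (a : V) : canonB a = true ↔
    ∃ t ∈ sqCls, (t.1.1 : ℤ) = a.c1 % 8 ∧ (t.1.2.1 : ℤ) = (a.c2 - 5 * a.c4) % 8 ∧
    (t.1.2.2 : ℤ) = (a.c3 - 2 * a.c4) % 8 ∧ ∃ a0 ∈ t.2, (a0 : ℤ) = (a.c0 - 3 * a.c4) % 8 := by
  simp only [canonB, List.any_eq_true, Bool.and_eq_true, decide_eq_true_eq]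

theorem canonB_add (a b : V) : canonB (a + k3 * b) = canonB a := by
  obtain ⟨h0, h1, h2, h3⟩ := k3_mul b
  have e0 : ((a + k3 * b).c0 - 3 * (a + k3 * b).c4) % 8 = (a.c0 - 3 * a.c4) % 8 := by
    simp only [add_c0, add_c4]; omega
  have e1 : (a + k3 * b).c1 % 8 = a.c1 % 8 := by
    simp only [add_c1]; omega
  have e2 : ((a + k3 * b).c2 - 5 * (a + k3 * b).c4) % 8 = (a.c2 - 5 * a.c4) % 8 := by
    simp only [add_c2, add_c4]; omega
  have e3 : ((a + k3 * b).c3 - 2 * (a + k3 * b).c4) % 8 = (a.c3 - 2 * a.c4) % 8 := by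
    simp only [add_c3, add_c4]; omega
  rw [canonB, canonB, e0, e1, e2, e3]

theorem canonB_all : ∀ i < 4, ∀ j < 4, ∀ k < 4, ∀ l < 4,
    canonB ((⟨(i : ℕ), (j : ℕ), (k : ℕ), (l : ℕ), 0⟩ : V) * ⟨i, j, k, l, 0⟩) = true := by
  decide +kernel

theorem canonB_sq (q : V) : canonB (q * q) = true := by
  obtain ⟨x, i, j, k, l, hi, hj, hk, hl, hq⟩ : ∃ (x : V) (i j k l : ℕ), i < 4 ∧ j < 4 ∧ k < 4 ∧ l < 4 ∧
      q = ⟨i, j, k, l, 0⟩ + 4 * x + (q.c4 : V) * ⟨3, 0, 5, 2, 1⟩ := by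
    refine ⟨⟨(q.c0 - 3 * q.c4) / 4, q.c1 / 4, (q.c2 - 5 * q.c4) / 4, (q.c3 - 2 * q.c4) / 4, 0⟩,
      ((q.c0 - 3 * q.c4) % 4).toNat, (q.c1 % 4).toNat, ((q.c2 - 5 * q.c4) % 4).toNat,
      ((q.c3 - 2 * q.c4) % 4).toNat, by omega, by omega, by omega, by omega, ?_⟩
    ext <;> simp only [add_c0, add_c1, add_c2, add_c3, add_c4, mul_c0, mul_c1, mul_c2, mul_c3, mul_c4, int_c0, int_c1,
      int_c2, int_c3, int_c4, ofNat_c0, ofNat_c1, ofNat_c2, ofNat_c3, ofNat_c4] <;> omega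
  have h := canonB_all i hi j hj k hk l hl
  generalize (⟨i, j, k, l, 0⟩ : V) = y at h hq
  have e8 : k3 * ⟨-1420, 628, -369, -144, -191⟩ = 8 := k3_e2
  have e : q * q = y * y + k3 * (⟨-1420, 628, -369, -144, -191⟩ * (y * x + 2 * x ^ 2) +
      ⟨-1845, 437, -412, -283, -453⟩ * ((q.c4 : V) * (2 * (y + 4 * x) + (q.c4 : V) * (k3 * ⟨-1845, 437, -412, -283, -453⟩)))) := by
    rw [← k3_e1] at hq
    have e2 : q * q = y * y + 8 * (y * x + 2 * x ^ 2) + (k3 * ⟨-1845, 437, -412, -283, -453⟩) * ((q.c4 : V) * (2 * (y + 4 * x) +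
        (q.c4 : V) * (k3 * ⟨-1845, 437, -412, -283, -453⟩))) := by
      linear_combination (q + y + 4 * x + (q.c4 : V) * (k3 * ⟨-1845, 437, -412, -283, -453⟩)) * hq
    rw [e2, ← e8]; ring
  rw [e, canonB_add, h]

theorem rh_dvd (a : V) (h : (a.c0 + a.c3 + a.c4) % 2 = 0) : rh ∣ a := by
  refine ⟨(((a.c0 + a.c3 + a.c4) / 2 : ℤ) : V) * ⟨70, 23, 17, -36, -2⟩ + (a.c1 : V) * ⟨114, 48, 23, -37, 16⟩ + (a.c2 : V) * ⟨102, 57, 22, -56, 3⟩ +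
    (a.c3 : V) * ⟨-155, -98, -33, 93, -3⟩ + (a.c4 : V) * ⟨-53, -74, -8, 48, -4⟩, ?_⟩
  ext <;> simp only [rh, add_c0, add_c1, add_c2, add_c3, add_c4, mul_c0, mul_c1, mul_c2, mul_c3, mul_c4, int_c0, int_c1,
      int_c2, int_c3, int_c4] <;> omega

theorem pi1_dvd (a : V) (h : a.c0 % 2 = 0) : pi1 ∣ a := by
  refine ⟨((a.c0 / 2 : ℤ) : V) * ⟨-5, 0, -5, -6, 3⟩ + (a.c1 : V) * ⟨9, 1, -7, -2, -1⟩ + (a.c2 : V) * ⟨27, 2, -6, 6, -7⟩ +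
    (a.c3 : V) * ⟨15, 2, -13, -5, -1⟩ + (a.c4 : V) * ⟨-15, -2, 17, 8, 0⟩, ?_⟩
  ext <;> simp only [pi1, add_c0, add_c1, add_c2, add_c3, add_c4, mul_c0, mul_c1, mul_c2, mul_c3, mul_c4, int_c0, int_c1,
      int_c2, int_c3, int_c4] <;> omega

/-- The properties of the element whose ideal is a square. -/
structure Good (z : V) : Prop where
  ne : z ≠ 0
  h1 : hh1 z = 2
  h2 : hh2 z = 1
  h5 : hh5 z = 1 ∨ hh5 z = 4
  loc : ∃ a d : V, (a.c0 + a.c3 + a.c4) % 2 = 1 ∧ z = a ^ 2 + k3 * d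
  nrm : ∃ n : ℤ, nm z = n ^ 2

theorem canon_of {γ z W : V} (hz : Good z) (h : γ * z = W ^ 2) : canonB γ = true := by
  obtain ⟨a, d, ha, hd⟩ := hz.loc
  obtain ⟨r, hr⟩ := rh_dvd (1 - a) (by simp only [sub_c0, sub_c3, sub_c4, one_c0, one_c3, one_c4]; omega)
  have g := mul_neg_geom_sum (1 - a) 12
  set a' := ∑ i ∈ Finset.range 12, (1 - a) ^ i with ha'
  rw [sub_sub_cancel, hr, mul_pow, ← k3_r12] at g
  set e : V := ⟨-2083418051908622282216352857, -139373485629535310851109383, 141893489452011845649663141, -713401515180833828034817590, 626366638142774877411484094⟩ with he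
  have h2 : γ = (W * a') * (W * a') + k3 * (γ * (2 * (e * r ^ 12) - k3 * (e * r ^ 12) ^ 2) - γ * d * a' ^ 2) := by
    have h3 : γ * (a ^ 2 + k3 * d) = W ^ 2 := by rw [← hd, h]
    linear_combination a' ^ 2 * h3 - γ * (a * a' + 1 - k3 * e * r ^ 12) * g
  rw [h2, canonB_add, canonB_sq]

theorem tests_of {γ z W : V} (hz : Good z) (h : γ * z = W ^ 2) : Tests γ := by
  have h' : γ * z = W * W := by rw [h, sq]
  have p1 : hh1 γ * hh1 z = hh1 W * hh1 W := by rw [← hh1_mul, h', hh1_mul]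
  have p2 : hh2 γ * hh2 z = hh2 W * hh2 W := by rw [← hh2_mul, h', hh2_mul]
  have p5 : hh5 γ * hh5 z = hh5 W * hh5 W := by rw [← hh5_mul, h', hh5_mul]
  have q1 : hh1 γ * dd1 z + dd1 γ * hh1 z = hh1 W * dd1 W + dd1 W * hh1 W := by rw [← dd1_mul, h', dd1_mul]
  have q2 : hh2 γ * dd2 z + dd2 γ * hh2 z = hh2 W * dd2 W + dd2 W * hh2 W := by rw [← dd2_mul, h', dd2_mul]
  have q5 : hh5 γ * dd5 z + dd5 γ * hh5 z = hh5 W * dd5 W + dd5 W * hh5 W := by rw [← dd5_mul, h', dd5_mul]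
  have n1 : hh1 z ≠ 0 := by rw [hz.h1]; decide
  have n2 : hh2 z ≠ 0 := by rw [hz.h2]; decide
  have n5 : hh5 z ≠ 0 := by rcases hz.h5 with h | h <;> rw [h] <;> decide
  have key : ∀ (p : ℕ) (n r : ℤ), n % p = r % p ↔ ((n : ℤ) : ZMod p) = (r : ℤ) := fun p n r =>
    (ZMod.intCast_eq_intCast_iff' n r p).symm
  refine ⟨(canonB_iff γ).1 (canon_of hz h), ?_, ?_, ⟨?_, ?_⟩, ?_, ?_, ?_, ?_⟩
  · intro hc
    have e : hh1 γ = 1 := by simpa [hh1] using (key 3 _ 1).1 hc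
    rw [e, hz.h1] at p1
    generalize hh1 W = w at p1
    revert w; decide
  · intro hc
    have e : hh2 γ = 2 := by simpa [hh2] using (key 3 _ 2).1 hc
    rw [e, hz.h2] at p2
    generalize hh2 W = w at p2
    revert w; decide
  · intro hc
    have e : hh5 γ = 2 := by simpa [hh5] using (key 5 _ 2).1 hc
    have := hz.h5
    rw [e] at p5
    generalize hh5 W = w at p5
    generalize hh5 z = x at p5 this
    revert w x; decide
  · intro hc
    have e : hh5 γ = 3 := by simpa [hh5] using (key 5 _ 3).1 hc
    have := hz.h5
    rw [e] at p5
    generalize hh5 W = w at p5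
    generalize hh5 z = x at p5 this
    revert w x; decide
  · intro hc
    refine (key 3 _ 0).2 ?_
    haveI : Fact (Nat.Prime 3) := ⟨by norm_num⟩
    have := der_aux _ _ _ _ _ _ p1 q1 n1 (by simpa [hh1] using (key 3 _ 0).1 hc)
    simpa [dd1] using this
  · intro hc
    refine (key 3 _ 0).2 ?_
    haveI : Fact (Nat.Prime 3) := ⟨by norm_num⟩
    have := der_aux _ _ _ _ _ _ p2 q2 n2 (by simpa [hh2] using (key 3 _ 0).1 hc)
    simpa [dd2] using this
  · intro hc
    refine (key 5 _ 0).2 ?_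
    haveI : Fact (Nat.Prime 5) := ⟨by norm_num⟩
    have := der_aux _ _ _ _ _ _ p5 q5 n5 (by simpa [hh5] using (key 5 _ 0).1 hc)
    simpa [dd5] using this
  · obtain ⟨n, hn⟩ := hz.nrm
    have hn0 : n ≠ 0 := by
      rintro rfl
      exact hz.ne (SK.nm_eq_zero (by rw [hn]; norm_num))
    have hm : nm γ * n ^ 2 = nm W ^ 2 := by rw [← hn, ← SK.nm_mul, h, sq, SK.nm_mul, sq]
    have hd : n ∣ nm W := (Int.pow_dvd_pow_iff two_ne_zero).1 ⟨nm γ, by rw [← hm]; ring⟩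
    obtain ⟨k, hk⟩ := hd
    refine ⟨k, mul_right_cancel₀ (pow_ne_zero 2 hn0) ?_⟩
    rw [hm, hk]; ring

theorem sq_cancel {s c W : V} (hs : s ≠ 0) (h : s * s * c = W ^ 2) : ∃ W', c = W' ^ 2 := by
  have hs' : SK.e s ≠ 0 := fun h0 => hs (SK.e_inj (by rw [h0, map_zero]))
  have h1 : (SK.e W / SK.e s) ^ 2 = SK.e c := by
    have := congrArg SK.e h
    simp only [map_mul, map_pow] at this
    field_simp
    rw [← this]; ring
  have h2 : IsIntegral ℤ (SK.e W / SK.e s) := by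
    refine IsIntegral.of_pow (n := 2) (by norm_num) ?_
    rw [h1]
    exact SK.int_e c
  obtain ⟨w, hw⟩ := SK.maximal _ h2
  exact ⟨w, SK.e_inj (by rw [map_pow, hw, h1])⟩

/-- The survivors of large norm. -/
def bigs : List V := [
    ⟨17, -8, -1, -2, -5⟩, ⟨9, 5, 2, 3, -4⟩, ⟨9, -7, 5, -9, -1⟩, ⟨12, -4, 3, -6, -1⟩, ⟨0, 5, 5, 1, -1⟩, ⟨0,
    9, -6, -3, 0⟩, ⟨-15, -7, 0, -9, 2⟩, ⟨12, 0, 9, 4, 3⟩, ⟨-12, 8, 5, -2, 5⟩, ⟨-19, 6, 5, 0, 5⟩]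

/-- The remaining survivors `γ = s² γ'`, with `s` and `γ'`. -/
def kills : List (V × V) := [
    (⟨0, 1, 0, 1, 0⟩, ⟨1, 0, 0, 0, 0⟩), (⟨3, 1, -1, 0, 0⟩, ⟨1, 0, 0, 0, 0⟩), (⟨0, 1, -1, 0, 0⟩, ⟨1, 0, 0, 0,
    0⟩), (⟨3, -1, 1, 0, 0⟩, ⟨1, 0, 0, 0, 0⟩), (⟨-26255053, -735723, -12772386, -21020568, 12048003⟩,
    ⟨128435179438517, 64749499201992, 27490255014111, -62447370842774, 7018105771631⟩), (⟨3, -1, 0, 0, 0⟩,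
    ⟨1, 0, 0, 0, 0⟩), (⟨0, 1, 0, 0, 0⟩, ⟨1, 0, 0, 0, 0⟩), (⟨3, 1, 0, 0, 0⟩, ⟨1, 0, 0, 0, 0⟩), (⟨0, 1, 0, 0,
    1⟩, ⟨1, 0, 0, 0, 0⟩), (⟨0, 0, 0, 1, 0⟩, ⟨1, 0, 0, 0, 0⟩), (⟨3, 0, 0, 0, 0⟩, ⟨1, 0, 0, 0, 0⟩), (⟨3, 0, 0,
    1, 0⟩, ⟨1, 0, 0, 0, 0⟩), (⟨161, 18, -114, -30, -19⟩, ⟨17717, 8012, 3921, -8612, 639⟩), (⟨3, 0, -1, 0,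
    0⟩, ⟨1, 0, 0, 0, 0⟩), (⟨0, 0, 1, 0, 0⟩, ⟨1, 0, 0, 0, 0⟩), (⟨3, 0, 1, 0, 0⟩, ⟨1, 0, 0, 0, 0⟩), (⟨0, 0, 1,
    0, 1⟩, ⟨1, 0, 0, 0, 0⟩), (⟨3, 1, -1, -1, 0⟩, ⟨1, 0, 0, 0, 0⟩), (⟨0, 1, -1, 0, 0⟩, ⟨16, 8, 3, -8, 1⟩),
    (⟨0, 1, -1, -1, 0⟩, ⟨1, 0, 0, 0, 0⟩), (⟨0, 0, 0, 0, 1⟩, ⟨1, 0, 0, 0, 0⟩), (⟨-26255053, -735723,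
    -12772386, -21020568, 12048003⟩, ⟨8875895677622, 4473715873572, 1899961632694, -4315790096180,
    484523077682⟩), (⟨0, 0, 1, 1, 0⟩, ⟨1, 0, 0, 0, 0⟩), (⟨3, 0, -1, 0, 0⟩, ⟨13, 6, 3, -6, 1⟩), (⟨161, 18,
    -114, -30, -19⟩, ⟨41529, 20932, 9791, -26274, -2081⟩)]

theorem survivors_eq : survivors = 0 :: (bigs ++ kills.map fun p => p.1 * p.1 * p.2) := by decide +kernel

theorem bigs_nm : ∀ a ∈ bigs, 2719736 < |nmx a.c0 a.c1 a.c2 a.c3 a.c4| := by decide +kernel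

theorem kills_bad : ∀ p ∈ kills, p.1 ≠ 0 ∧ (p.2.c0 % 3 = 1 ∨ (p.2.c0 + 2 * p.2.c1 + p.2.c2 + p.2.c3) % 3 = 2 ∨
    (p.2.c0 + p.2.c2 + p.2.c3) % 5 = 2 ∨ (p.2.c0 + p.2.c2 + p.2.c3) % 5 = 3 ∨ canonB p.2 = false) := by
  decide +kernel

theorem no_small {γ z W : V} (hz : Good z) (h : γ * z = W ^ 2) (h0 : γ ≠ 0) (hs : γ.Small) : False := by
  have hm := enum_spec γ hs (tests_of hz h)
  rw [survivors_eq, List.mem_cons, List.mem_append, List.mem_map] at hm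
  rcases hm with hm | hm | ⟨⟨s, c⟩, hp, hm⟩
  · exact h0 hm
  · have := bigs_nm γ hm
    rw [← nm_eq] at this
    exact absurd hs.sn (not_le.2 this)
  · obtain ⟨hs0, hb⟩ := kills_bad _ hp
    simp only at hs0 hb hm
    obtain ⟨W', hW⟩ := sq_cancel (c := c * z) (W := W) hs0 (by rw [← h, ← hm]; ring)
    have ht := tests_of hz hW
    rcases hb with hb | hb | hb | hb | hb
    · exact ht.h1 hb
    · exact ht.h2 hb
    · exact ht.h5.1 hb
    · exact ht.h5.2 hb
    · rw [(canonB_iff c).2 ht.canon] at hb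
      exact absurd hb (by decide)

/-- There is no good element generating the square of an ideal. -/
theorem no_good (z : V) (hz : Good z) (J : Ideal (NumberField.RingOfIntegers KQ))
    (hJ : J ^ 2 = Ideal.span {SK.E z}) : False := by
  obtain ⟨γ, W, h0, h, hb⟩ := SK.mink J z hz.ne hJ
  exact no_small hz h h0 (SK.small γ hb)

end V

end

section

namespace V

/-- Coordinate of the sextic covariant. -/
def x0 {R : Type*} [CommRing R] (u v : R) : R :=
    (-16) * u^0 * v^6 + (-432) * u^1 * v^5 + (-480) * u^2 * v^4 + (-320) * u^3 * v^3 + (384) * u^5 * v^1 +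
    (128) * u^6 * v^0

theorem x0_hom {R S : Type*} [CommRing R] [CommRing S] (φ : R →+* S) (u v : R) :
    φ (x0 u v) = x0 (φ u) (φ v) := by
  simp only [x0, map_add, map_mul, map_pow, map_neg, map_ofNat, map_zero]

/-- Coordinate of the sextic covariant. -/
def x1 {R : Type*} [CommRing R] (u v : R) : R :=
    (-14) * u^0 * v^6 + (-256) * u^1 * v^5 + (-320) * u^2 * v^4 + (-160) * u^3 * v^3 + (80) * u^4 * v^2 +
    (256) * u^5 * v^1 + (64) * u^6 * v^0

theorem x1_hom {R S : Type*} [CommRing R] [CommRing S] (φ : R →+* S) (u v : R) :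
    φ (x1 u v) = x1 (φ u) (φ v) := by
  simp only [x1, map_add, map_mul, map_pow, map_neg, map_ofNat, map_zero]

/-- Coordinate of the sextic covariant. -/
def x2 {R : Type*} [CommRing R] (u v : R) : R :=
    (-46) * u^0 * v^6 + (-200) * u^1 * v^5 + (-200) * u^2 * v^4 + (-160) * u^3 * v^3 + (-80) * u^4 * v^2 +
    (64) * u^5 * v^1

theorem x2_hom {R S : Type*} [CommRing R] [CommRing S] (φ : R →+* S) (u v : R) :
    φ (x2 u v) = x2 (φ u) (φ v) := by
  simp only [x2, map_add, map_mul, map_pow, map_neg, map_ofNat, map_zero]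

/-- Coordinate of the sextic covariant. -/
def x3 {R : Type*} [CommRing R] (u v : R) : R :=
    (10) * u^0 * v^6 + (216) * u^1 * v^5 + (280) * u^2 * v^4 + (-240) * u^4 * v^2 + (-320) * u^5 * v^1 +
    (-64) * u^6 * v^0

theorem x3_hom {R S : Type*} [CommRing R] [CommRing S] (φ : R →+* S) (u v : R) :
    φ (x3 u v) = x3 (φ u) (φ v) := by
  simp only [x3, map_add, map_mul, map_pow, map_neg, map_ofNat, map_zero]

/-- Coordinate of the sextic covariant. -/
def x4 {R : Type*} [CommRing R] (u v : R) : R :=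
    (-6) * u^0 * v^6 + (-40) * u^1 * v^5 + (-80) * u^2 * v^4 + (80) * u^4 * v^2 + (64) * u^5 * v^1

theorem x4_hom {R S : Type*} [CommRing R] [CommRing S] (φ : R →+* S) (u v : R) :
    φ (x4 u v) = x4 (φ u) (φ v) := by
  simp only [x4, map_add, map_mul, map_pow, map_neg, map_ofNat, map_zero]

/-- The sextic covariant. -/
def XV (u v : ℤ) : V := ⟨x0 u v, x1 u v, x2 u v, x3 u v, x4 u v⟩

/-- The root of the resolvent. -/
def TV (u v : ℤ) : V := ⟨
    0,
    (13) * u^0 * v^6 + (-54) * u^1 * v^5 + (-150) * u^2 * v^4 + (-160) * u^3 * v^3 + (48) * u^5 * v^1 + (16)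
    * u^6 * v^0,
    (-28) * u^0 * v^6 + (-66) * u^1 * v^5 + (-30) * u^2 * v^4 + (-80) * u^3 * v^3 + (-120) * u^4 * v^2 +
    (-48) * u^5 * v^1 + (-16) * u^6 * v^0,
    (-1) * u^0 * v^6 + (24) * u^1 * v^5 + (30) * u^2 * v^4 + (-80) * u^3 * v^3 + (-120) * u^4 * v^2 + (-96)
    * u^5 * v^1 + (-16) * u^6 * v^0,
    (-10) * u^0 * v^6 + (-36) * u^1 * v^5 + (-90) * u^2 * v^4 + (-80) * u^3 * v^3 + (-16) * u^6 * v^0⟩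

/-- The square of the root. -/
def T2 (u v : ℤ) : V := ⟨
    (4740) * u^0 * v^12 + (22032) * u^1 * v^11 + (72864) * u^2 * v^10 + (68640) * u^3 * v^9 + (-142560) *
    u^4 * v^8 + (-380160) * u^5 * v^7 + (-481536) * u^6 * v^6 + (-456192) * u^7 * v^5 + (-380160) * u^8 *
    v^4 + (-168960) * u^9 * v^3 + (18432) * u^11 * v^1 + (6144) * u^12 * v^0,
    (-696) * u^0 * v^12 + (6876) * u^1 * v^11 + (39996) * u^2 * v^10 + (89520) * u^3 * v^9 + (128520) * u^4
    * v^8 + (157248) * u^5 * v^7 + (124992) * u^6 * v^6 + (76032) * u^7 * v^5 + (69120) * u^8 * v^4 +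
    (49920) * u^9 * v^3 + (25344) * u^10 * v^2 + (9216) * u^11 * v^1 + (1536) * u^12 * v^0,
    (-1485) * u^0 * v^12 + (-9540) * u^1 * v^11 + (-17820) * u^2 * v^10 + (-38880) * u^3 * v^9 + (-95040) *
    u^4 * v^8 + (-181440) * u^5 * v^7 + (-181440) * u^6 * v^6 + (-69120) * u^7 * v^5 + (25920) * u^8 * v^4 +
    (34560) * u^9 * v^3 + (11520) * u^10 * v^2,
    (-684) * u^0 * v^12 + (-5256) * u^1 * v^11 + (-19260) * u^2 * v^10 + (-49680) * u^3 * v^9 + (-105840) *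
    u^4 * v^8 + (-131328) * u^5 * v^7 + (-84672) * u^6 * v^6 + (-34560) * u^7 * v^5 + (-17280) * u^8 * v^4 +
    (-23040) * u^9 * v^3 + (-25344) * u^10 * v^2 + (-9216) * u^11 * v^1,
    (-111) * u^0 * v^12 + (2016) * u^1 * v^11 + (7596) * u^2 * v^10 + (7440) * u^3 * v^9 + (-7560) * u^4 *
    v^8 + (-24192) * u^5 * v^7 + (4032) * u^6 * v^6 + (76032) * u^7 * v^5 + (95040) * u^8 * v^4 + (61440) *
    u^9 * v^3 + (25344) * u^10 * v^2 + (9216) * u^11 * v^1 + (1536) * u^12 * v^0⟩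

/-- Coordinate of the cofactor. -/
def q0 (u v : ℤ) : ℤ :=
    (12638025) * u^0 * v^24 + (117485640) * u^1 * v^23 + (661589856) * u^2 * v^22 + (2172029904) * u^3 *
    v^21 + (3927513744) * u^4 * v^20 + (65862720) * u^5 * v^19 + (-21026174400) * u^6 * v^18 +
    (-56538953856) * u^7 * v^17 + (-70730915904) * u^8 * v^16 + (-23932744704) * u^9 * v^15 + (87944693760)
    * u^10 * v^14 + (235999733760) * u^11 * v^13 + (373947549696) * u^12 * v^12 + (438479806464) * u^13 *
    v^11 + (397193601024) * u^14 * v^10 + (284152872960) * u^15 * v^9 + (159138017280) * u^16 * v^8 +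
    (59648016384) * u^17 * v^7 + (3269984256) * u^18 * v^6 + (-11036196864) * u^19 * v^5 + (-6131220480) *
    u^20 * v^4 + (-1167851520) * u^21 * v^3 + (191102976) * u^22 * v^2 + (127401984) * u^23 * v^1 +
    (21233664) * u^24 * v^0

/-- Coordinate of the cofactor. -/
def q1 (u v : ℤ) : ℤ :=
    (2474280) * u^0 * v^24 + (-24925104) * u^1 * v^23 + (-343378224) * u^2 * v^22 + (-1810958688) * u^3 *
    v^21 + (-5999361984) * u^4 * v^20 + (-14428385280) * u^5 * v^19 + (-26574880896) * u^6 * v^18 +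
    (-39038184576) * u^7 * v^17 + (-44116348032) * u^8 * v^16 + (-37241496576) * u^9 * v^15 + (-30757432320)
    * u^10 * v^14 + (-27933272064) * u^11 * v^13 + (-4857974784) * u^12 * v^12 + (46603026432) * u^13 * v^11
    + (105590808576) * u^14 * v^10 + (142216888320) * u^15 * v^9 + (138365190144) * u^16 * v^8 +
    (104066187264) * u^17 * v^7 + (64256606208) * u^18 * v^6 + (33181138944) * u^19 * v^5 + (13518766080) *
    u^20 * v^4 + (3765436416) * u^21 * v^3 + (651165696) * u^22 * v^2 + (99090432) * u^23 * v^1 + (14155776)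
    * u^24 * v^0

/-- Coordinate of the cofactor. -/
def q2 (u v : ℤ) : ℤ :=
    (5279175) * u^0 * v^24 + (61578360) * u^1 * v^23 + (289733760) * u^2 * v^22 + (1015288560) * u^3 * v^21
    + (3164033232) * u^4 * v^20 + (9592706880) * u^5 * v^19 + (24485103360) * u^6 * v^18 + (46139777280) *
    u^7 * v^17 + (53787602880) * u^8 * v^16 + (16543761408) * u^9 * v^15 + (-55629020160) * u^10 * v^14 +
    (-92177326080) * u^11 * v^13 + (-40410040320) * u^12 * v^12 + (59525038080) * u^13 * v^11 +
    (118836191232) * u^14 * v^10 + (103206666240) * u^15 * v^9 + (55182643200) * u^16 * v^8 + (20424130560)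
    * u^17 * v^7 + (6555893760) * u^18 * v^6 + (2864775168) * u^19 * v^5 + (2149908480) * u^20 * v^4 +
    (1309409280) * u^21 * v^3 + (353894400) * u^22 * v^2 + (-7077888) * u^24 * v^0

/-- Coordinate of the cofactor. -/
def q3 (u v : ℤ) : ℤ :=
    (-5121954) * u^0 * v^24 + (-26612928) * u^1 * v^23 + (-45658512) * u^2 * v^22 + (-346039776) * u^3 *
    v^21 + (-3107829600) * u^4 * v^20 + (-13181887296) * u^5 * v^19 + (-35988665472) * u^6 * v^18 +
    (-72990367488) * u^7 * v^17 + (-122508474624) * u^8 * v^16 + (-182499609600) * u^9 * v^15 +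
    (-243709323264) * u^10 * v^14 + (-283013941248) * u^11 * v^13 + (-274351214592) * u^12 * v^12 +
    (-203627298816) * u^13 * v^11 + (-98227814400) * u^14 * v^10 + (-18763923456) * u^15 * v^9 +
    (8877662208) * u^16 * v^8 + (6778847232) * u^17 * v^7 + (907739136) * u^18 * v^6 + (-353894400) * u^19 *
    v^5 + (491913216) * u^20 * v^4 + (700710912) * u^21 * v^3 + (325582848) * u^22 * v^2 + (56623104) * u^23
    * v^1

/-- Coordinate of the cofactor. -/
def q4 (u v : ℤ) : ℤ :=
    (4822659) * u^0 * v^24 + (63675288) * u^1 * v^23 + (199284192) * u^2 * v^22 + (29382480) * u^3 * v^21 +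
    (-850430448) * u^4 * v^20 + (-864065664) * u^5 * v^19 + (3479421312) * u^6 * v^18 + (14375968128) * u^7
    * v^17 + (30722535360) * u^8 * v^16 + (45842899968) * u^9 * v^15 + (42857109504) * u^10 * v^14 +
    (11451691008) * u^11 * v^13 + (-27022215168) * u^12 * v^12 + (-37413273600) * u^13 * v^11 +
    (-10475716608) * u^14 * v^10 + (24906203136) * u^15 * v^9 + (34523615232) * u^16 * v^8 + (19192578048) *
    u^17 * v^7 + (2866544640) * u^18 * v^6 + (-3133734912) * u^19 * v^5 + (-2571042816) * u^20 * v^4 +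
    (-1089994752) * u^21 * v^3 + (-325582848) * u^22 * v^2 + (-70778880) * u^23 * v^1 + (-7077888) * u^24 *
    v^0

/-- The cofactor. -/
def QV (u v : ℤ) : V := ⟨q0 u v, q1 u v, q2 u v, q3 u v, q4 u v⟩

/-- The element `λ`. -/
def lam : V := ⟨0, -1, 1, 1, 1⟩

/-- The element `τ`. -/
def tau : V := ⟨2, 1, 0, -1, 0⟩

theorem lam_XV (u v : ℤ) : lam * XV u v = -4 * tau * TV u v := by
  have h : (-4 * tau : V) = ⟨-8, -4, 0, 4, 0⟩ := by decide
  rw [h]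
  ext <;> simp only [lam, XV, TV, x0, x1, x2, x3, x4, mul_c0, mul_c1, mul_c2, mul_c3, mul_c4] <;> ring

theorem TV_sq (u v : ℤ) : TV u v * TV u v = T2 u v := by
  ext <;> simp only [TV, T2, mul_c0, mul_c1, mul_c2, mul_c3, mul_c4] <;> ring

set_option maxHeartbeats 2000000 in
theorem QV_eq (u v : ℤ) : QV u v = T2 u v * T2 u v + 30 * (HZ u v : ℤ) * T2 u v + 405 * ((HZ u v : ℤ) : V) ^ 2 := by
  have h : ∀ k : ℤ, QV u v = T2 u v * T2 u v + ((30 * k : ℤ) : V) * T2 u v + ((405 * k ^ 2 : ℤ) : V) →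
      QV u v = T2 u v * T2 u v + 30 * (k : ℤ) * T2 u v + 405 * ((k : ℤ) : V) ^ 2 := by
    intro k hk
    rw [hk]
    push_cast
    ring
  apply h
  ext <;> simp only [QV, q0, q1, q2, q3, q4, T2, HZ, mul_c0, mul_c1, mul_c2, mul_c3, mul_c4, add_c0, add_c1, add_c2, add_c3, add_c4,
    int_c0, int_c1, int_c2, int_c3, int_c4] <;> ring

set_option maxHeartbeats 2000000 in
theorem TV_QV (u v : ℤ) : TV u v * QV u v = ((648 * FZ u v : ℤ) : V) := by
  ext <;> simp only [QV, q0, q1, q2, q3, q4, TV, FZ, mul_c0, mul_c1, mul_c2, mul_c3, mul_c4,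
    int_c0, int_c1, int_c2, int_c3, int_c4] <;> ring

set_option maxHeartbeats 2000000 in
theorem nm_XV (u v : ℤ) : nm (XV u v) = 1024 * FZ u v := by
  rw [nm_eq]
  simp only [XV, x0, x1, x2, x3, x4, nmx, d5, FZ]
  ring

set_option maxHeartbeats 2000000 in
theorem bezout (u v : ℤ) : ∃ A B : ℤ, A * FZ u v + B * HZ u v = 4035630093750000 * v ^ 41 := by
  refine ⟨
    (612748195) * u^0 * v^11 + (-494101164) * u^1 * v^10 + (2677374210) * u^2 * v^9 + (237198360) * u^3 *
    v^8 + (-4717175760) * u^4 * v^7 + (-9848396448) * u^5 * v^6 + (-8210450688) * u^6 * v^5 + (-8933981760)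
    * u^7 * v^4 + (-6467978880) * u^8 * v^3 + (-565241600) * u^9 * v^2 + (503872512) * u^10 * v^1 +
    (251936256) * u^11 * v^0,
    (-14451926830048) * u^0 * v^29 + (1675364711526) * u^1 * v^28 + (-93577795896822) * u^2 * v^27 +
    (-430329885614096) * u^3 * v^26 + (-1659683381014224) * u^4 * v^25 + (-6020875428020376) * u^5 * v^24 +
    (-18853307334488128) * u^6 * v^23 + (-46388903984247744) * u^7 * v^22 + (-91613296539881712) * u^8 *
    v^21 + (-150959491014327488) * u^9 * v^20 + (-210171695756408064) * u^10 * v^19 + (-252843099066198912)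
    * u^11 * v^18 + (-300696937435282816) * u^12 * v^17 + (-383648398830263808) * u^13 * v^16 +
    (-448933522657262592) * u^14 * v^15 + (-392461565526665216) * u^15 * v^14 + (-185770003356177408) * u^16
    * v^13 + (55803354726813696) * u^17 * v^12 + (184707636284530688) * u^18 * v^11 + (179080667875418112) *
    u^19 * v^10 + (121306190338154496) * u^20 * v^9 + (73527070312726528) * u^21 * v^8 + (44746390374580224)
    * u^22 * v^7 + (25787582153490432) * u^23 * v^6 + (12699011257991168) * u^24 * v^5 + (4795353950846976)
    * u^25 * v^4 + (1219087449980928) * u^26 * v^3 + (195828733968384) * u^27 * v^2 + (27862134423552) *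
    u^28 * v^1 + (3095792713728) * u^29 * v^0, ?_⟩
  simp only [FZ, HZ]
  ring

end V

end

section

namespace V

set_option maxHeartbeats 1000000 in
theorem FZ_three (v w : ℤ) : ∃ Q : ℤ, FZ (2 * v + 3 * w) v = 3 ^ 9 * (1 * v ^ 30 + 3 * Q) := by
  refine ⟨
    (137393516017881) * w^0 * v^30 + (4821125009634810) * w^1 * v^29 + (81550746339062130) * w^2 * v^28 +
    (886432908425887620) * w^3 * v^27 + (6961604095996097940) * w^4 * v^26 + (42098741711253408096) * w^5 *
    v^25 + (203964238380890316600) * w^6 * v^24 + (813175440581046196800) * w^7 * v^23 +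
    (2718894407493651307200) * w^8 * v^22 + (7730229205638142214400) * w^9 * v^21 +
    (18882286194105710069760) * w^10 * v^20 + (39932024588899864876800) * w^11 * v^19 +
    (73531969573439866118400) * w^12 * v^18 + (118392306363866700057600) * w^13 * v^17 +
    (167151238473078358387200) * w^14 * v^16 + (207302275754351349719040) * w^15 * v^15 +
    (226021621464463061606400) * w^16 * v^14 + (216615171150077462323200) * w^17 * v^13 +
    (182289162303703515340800) * w^18 * v^12 + (134424153437917000089600) * w^19 * v^11 +
    (86588212540130305228800) * w^20 * v^10 + (48498114652047507456000) * w^21 * v^9 +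
    (23470080880071757824000) * w^22 * v^8 + (9727509977992691712000) * w^23 * v^7 +
    (3410709183119720448000) * w^24 * v^6 + (994171228306777571328) * w^25 * v^5 + (234853337397445263360) *
    w^26 * v^4 + (43255739677833953280) * w^27 * v^3 + (5831572711900446720) * w^28 * v^2 +
    (511862181608816640) * w^29 * v^1 + (21936950640377856) * w^30 * v^0, ?_⟩
  simp only [FZ]
  ring

set_option maxHeartbeats 1000000 in
theorem FZ_five (v w : ℤ) : ∃ Q : ℤ, FZ (4 * v + 5 * w) v = 5 ^ 5 * (3 * v ^ 30 + 5 * Q) := by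
  refine ⟨
    (15789207158947607908673) * w^0 * v^30 + (517245646963446240093870) * w^1 * v^29 +
    (8190596292937720921803450) * w^2 * v^28 + (83493724882674274479901500) * w^3 * v^27 +
    (615644657353294334488192500) * w^4 * v^26 + (3497859557204908697638200000) * w^5 * v^25 +
    (15928976863228754818804275000) * w^6 * v^24 + (59712293369000831244759000000) * w^7 * v^23 +
    (187791284539959680317995000000) * w^8 * v^22 + (502450748717036817461100000000) * w^9 * v^21 +
    (1155781207307604108641400000000) * w^10 * v^20 + (2303932487312733684754500000000) * w^11 * v^19 +
    (4003778233565855949622500000000) * w^12 * v^18 + (6092325194970873063150000000000) * w^13 * v^17 +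
    (8142089715159276686625000000000) * w^14 * v^16 + (9575084609191206738000000000000) * w^15 * v^15 +
    (9916095022335524610000000000000) * w^16 * v^14 + (9040671418414371750000000000000) * w^17 * v^13 +
    (7246230269390954250000000000000) * w^18 * v^12 + (5092641581751742500000000000000) * w^19 * v^11 +
    (3125857288805617500000000000000) * w^20 * v^10 + (1666331079765300000000000000000) * w^21 * v^9 +
    (765624939409125000000000000000) * w^22 * v^8 + (300120756255000000000000000000) * w^23 * v^7 +
    (98997397875000000000000000000) * w^24 * v^6 + (26966081520000000000000000000) * w^25 * v^5 +
    (5906560500000000000000000000) * w^26 * v^4 + (1000137500000000000000000000) * w^27 * v^3 +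
    (122887500000000000000000000) * w^28 * v^2 + (9750000000000000000000000) * w^29 * v^1 +
    (375000000000000000000000) * w^30 * v^0, ?_⟩
  simp only [FZ]
  ring

theorem FZ_even (u w : ℤ) : ∃ Q : ℤ, FZ u (2 * w) = 2 ^ 21 * (3 * u ^ 30 + 2 * Q) := by
  refine ⟨
    (-698912768) * u^0 * w^30 + (-5686314240) * u^1 * w^29 + (-14234090880) * u^2 * w^28 + (-21128945280) *
    u^3 * w^27 + (-40883624640) * u^4 * w^26 + (-102020815872) * u^5 * w^25 + (-197236864800) * u^6 * w^24 +
    (-279852969600) * u^7 * w^23 + (-306268257600) * u^8 * w^22 + (-269504284800) * u^9 * w^21 +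
    (-196187644800) * u^10 * w^20 + (-124021980000) * u^11 * w^19 + (-75505734000) * u^12 * w^18 +
    (-47903940000) * u^13 * w^17 + (-29084535000) * u^14 * w^16 + (-14270811840) * u^15 * w^15 +
    (-4653525600) * u^16 * w^14 + (-410605200) * u^17 * w^13 + (539869800) * u^18 * w^12 + (382991400) *
    u^19 * w^11 + (155717820) * u^20 * w^10 + (50425200) * u^21 * w^9 + (15307650) * u^22 * w^8 + (4541400)
    * u^23 * w^7 + (1226700) * u^24 * w^6 + (275616) * u^25 * w^5 + (46980) * u^26 * w^4 + (5510) * u^27 *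
    w^3 + (435) * u^28 * w^2 + (30) * u^29 * w^1, ?_⟩
  simp only [FZ]
  ring

theorem odd_pow_ne {p : ℤ} (hp : Prime p) (n : ℤ) (hn : ¬ p ∣ n) (k : ℕ) : ∀ y : ℤ, y ^ 2 ≠ p ^ (2 * k + 1) * n := by
  induction k with
  | zero =>
    intro y h
    have h1 : p ∣ y := hp.dvd_of_dvd_pow (n := 2) ⟨n, by rw [h]; ring⟩
    obtain ⟨z, rfl⟩ := h1
    apply hn
    refine ⟨z ^ 2, ?_⟩
    apply mul_left_cancel₀ hp.ne_zero
    linear_combination -h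
  | succ k ih =>
    intro y h
    have h1 : p ∣ y := hp.dvd_of_dvd_pow (n := 2) ⟨p ^ (2 * k + 2) * n, by rw [h]; ring⟩
    obtain ⟨z, rfl⟩ := h1
    apply ih z
    apply mul_left_cancel₀ (pow_ne_zero 2 hp.ne_zero)
    linear_combination h

theorem FZ_smul (c a b : ℤ) : FZ (a * c) (b * c) = c ^ 30 * FZ a b := by
  simp only [FZ]
  ring

theorem FZ_congr {M : ℤ} {a b c d : ℤ} (h1 : M ∣ a - c) (h2 : M ∣ b - d) : M ∣ FZ a b - FZ c d := by
  have e : ∀ (z t : ℤ), M ∣ z - t ↔ Ideal.Quotient.mk (Ideal.span {M}) z = Ideal.Quotient.mk (Ideal.span {M}) t := by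
    intro z t
    rw [Ideal.Quotient.eq, Ideal.mem_span_singleton]
  rw [e] at h1 h2 ⊢
  rw [FZ_hom, FZ_hom, h1, h2]

theorem x0_congr {M : ℤ} {a b c d : ℤ} (h1 : M ∣ a - c) (h2 : M ∣ b - d) : M ∣ x0 a b - x0 c d := by
  have e : ∀ (z t : ℤ), M ∣ z - t ↔ Ideal.Quotient.mk (Ideal.span {M}) z = Ideal.Quotient.mk (Ideal.span {M}) t := by
    intro z t
    rw [Ideal.Quotient.eq, Ideal.mem_span_singleton]
  rw [e] at h1 h2 ⊢
  rw [x0_hom, x0_hom, h1, h2]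

theorem x0_smul (c a b : ℤ) : x0 (a * c) (b * c) = c ^ 6 * x0 a b := by
  simp only [x0]
  ring

theorem x1_congr {M : ℤ} {a b c d : ℤ} (h1 : M ∣ a - c) (h2 : M ∣ b - d) : M ∣ x1 a b - x1 c d := by
  have e : ∀ (z t : ℤ), M ∣ z - t ↔ Ideal.Quotient.mk (Ideal.span {M}) z = Ideal.Quotient.mk (Ideal.span {M}) t := by
    intro z t
    rw [Ideal.Quotient.eq, Ideal.mem_span_singleton]
  rw [e] at h1 h2 ⊢
  rw [x1_hom, x1_hom, h1, h2]

theorem x1_smul (c a b : ℤ) : x1 (a * c) (b * c) = c ^ 6 * x1 a b := by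
  simp only [x1]
  ring

theorem x2_congr {M : ℤ} {a b c d : ℤ} (h1 : M ∣ a - c) (h2 : M ∣ b - d) : M ∣ x2 a b - x2 c d := by
  have e : ∀ (z t : ℤ), M ∣ z - t ↔ Ideal.Quotient.mk (Ideal.span {M}) z = Ideal.Quotient.mk (Ideal.span {M}) t := by
    intro z t
    rw [Ideal.Quotient.eq, Ideal.mem_span_singleton]
  rw [e] at h1 h2 ⊢
  rw [x2_hom, x2_hom, h1, h2]

theorem x2_smul (c a b : ℤ) : x2 (a * c) (b * c) = c ^ 6 * x2 a b := by
  simp only [x2]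
  ring

theorem x3_congr {M : ℤ} {a b c d : ℤ} (h1 : M ∣ a - c) (h2 : M ∣ b - d) : M ∣ x3 a b - x3 c d := by
  have e : ∀ (z t : ℤ), M ∣ z - t ↔ Ideal.Quotient.mk (Ideal.span {M}) z = Ideal.Quotient.mk (Ideal.span {M}) t := by
    intro z t
    rw [Ideal.Quotient.eq, Ideal.mem_span_singleton]
  rw [e] at h1 h2 ⊢
  rw [x3_hom, x3_hom, h1, h2]

theorem x3_smul (c a b : ℤ) : x3 (a * c) (b * c) = c ^ 6 * x3 a b := by
  simp only [x3]
  ring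

theorem x4_congr {M : ℤ} {a b c d : ℤ} (h1 : M ∣ a - c) (h2 : M ∣ b - d) : M ∣ x4 a b - x4 c d := by
  have e : ∀ (z t : ℤ), M ∣ z - t ↔ Ideal.Quotient.mk (Ideal.span {M}) z = Ideal.Quotient.mk (Ideal.span {M}) t := by
    intro z t
    rw [Ideal.Quotient.eq, Ideal.mem_span_singleton]
  rw [e] at h1 h2 ⊢
  rw [x4_hom, x4_hom, h1, h2]

theorem x4_smul (c a b : ℤ) : x4 (a * c) (b * c) = c ^ 6 * x4 a b := by
  simp only [x4]
  ring

/-- An integer congruent to `u / v` modulo `M`. -/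
theorem exists_ratio (M : ℕ) (hM : 0 < M) (u v : ℤ) (h : IsCoprime v (M : ℤ)) :
    ∃ r : ℕ, r < M ∧ (M : ℤ) ∣ u - r * v := by
  obtain ⟨a, b, hab⟩ := h
  have hM' : (0 : ℤ) < M := by exact_mod_cast hM
  refine ⟨((u * a) % M).toNat, ?_, ?_⟩
  · have := Int.emod_lt_of_pos (u * a) hM'
    have := Int.emod_nonneg (u * a) hM'.ne'
    omega
  · have h1 := Int.emod_nonneg (u * a) hM'.ne'
    rw [Int.toNat_of_nonneg h1]
    have h2 := Int.emod_add_mul_ediv (u * a) M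
    refine ⟨u * b + (u * a / M) * v, ?_⟩
    linear_combination (-v) * h2 - u * hab

/-- If `FZ u v` is a square then so is `FZ r 1` modulo `M`. -/
theorem sq_ratio (M : ℕ) (u v y : ℤ) (h : IsCoprime v (M : ℤ)) (hy : y ^ 2 = FZ u v) (r : ℕ)
    (hr : (M : ℤ) ∣ u - r * v) : ∃ s : ℤ, (M : ℤ) ∣ s ^ 2 - FZ (r : ℤ) 1 := by
  obtain ⟨a, b, hab⟩ := h
  have h1 := FZ_congr (M := M) (b := v) (d := 1 * v) hr (by simp)
  rw [FZ_smul, ← hy] at h1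
  refine ⟨y * a ^ 15, ?_⟩
  have h2 : (M : ℤ) ∣ (a * v) ^ 30 - 1 ^ 30 :=
    dvd_trans ⟨-b, by linear_combination hab⟩ (sub_dvd_pow_sub_pow (a * v) 1 30)
  have h3 : (y * a ^ 15) ^ 2 - FZ (r : ℤ) 1 = a ^ 30 * (y ^ 2 - v ^ 30 * FZ (r : ℤ) 1)
      + ((a * v) ^ 30 - 1 ^ 30) * FZ (r : ℤ) 1 := by ring
  rw [h3]
  exact dvd_add (Dvd.dvd.mul_left h1 _) (Dvd.dvd.mul_right h2 _)

theorem sq_mask (M m : ℕ) (hM : 0 < M) (hm : ∀ s < M, m.testBit (s * s % M) = true) (s t : ℤ)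
    (h : (M : ℤ) ∣ s ^ 2 - t) : m.testBit (t % M).toNat = true := by
  have hM' : (0 : ℤ) < M := by exact_mod_cast hM
  have h1 := Int.emod_nonneg s hM'.ne'
  have h2 := Int.emod_lt_of_pos s hM'
  have h3 := hm (s % M).toNat (by omega)
  have h4 : t % M = (((s % M).toNat * (s % M).toNat % M : ℕ) : ℤ) := by
    push_cast
    rw [Int.toNat_of_nonneg h1, ← Int.mul_emod, ← pow_two]
    exact Int.modEq_iff_dvd.2 h
  rw [h4, Int.toNat_natCast]
  exact h3

theorem dec9 : ∀ a : ℕ, a < 9 → ∀ b : ℕ, b < 9 → (147 : ℕ).testBit (FZ (a : ℤ) (b : ℤ) % (9 : ℕ)).toNat = true →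
    (a % 3 = 0 ∧ b % 3 = 0) ∨ a % 3 = 0 ∨ (a + b) % 3 = 0 := by
  decide +kernel

theorem dec25 : ∀ r : ℕ, r < 25 → (19483219 : ℕ).testBit (FZ (r : ℤ) 1 % (25 : ℕ)).toNat = true →
    r % 5 = 1 ∨ r % 5 = 4 := by
  decide +kernel

/-- Cofactor of `ρ ^ 6 κ ^ 3` in `32`. -/
def Lp : V := ⟨-782243453892196, -396507835620161, -167392924686603, 382114888798011, -42247065026321⟩

/-- The sixth power of `ρ`. -/
def rh6 : V := ⟨-4458262700606003, -587217233627334, 4426129725556437, 1879538615666400, 164067999078537⟩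

theorem rh6_eq : rh ^ 6 = rh6 := by decide +kernel

theorem Lp_eq : rh6 * k3 * Lp = 32 := by decide +kernel

/-- Candidate local square roots. -/
def s4 : List V := [⟨0, 0, 1, 0, 3⟩, ⟨0, 1, 2, 0, 1⟩, ⟨0, 1, 0, 0, 3⟩, ⟨0, 2, 1, 0, 1⟩]

/-- Divisibility by `32`, as a boolean. -/
def d32 (a : V) : Bool := a.c0 % 32 == 0 && a.c1 % 32 == 0 && a.c2 % 32 == 0 && a.c3 % 32 == 0 && a.c4 % 32 == 0

theorem dec128 : ∀ r : ℕ, r < 128 → (2668882576834431627811302641479385619 : ℕ).testBit (FZ (r : ℤ) 1 % (128 : ℕ)).toNat = true →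
    (s4.any fun s => d32 (Lp * (XV r 1 - rh6 * (s * s)))) = true := by
  decide +kernel

theorem s4_odd : ∀ s ∈ s4, (s.c0 + s.c3 + s.c4) % 2 = 1 := by decide

end V

end

section

namespace V

theorem v_odd (u v y : ℤ) (hc : IsCoprime u v) (hy : y ^ 2 = FZ u v) : ¬ (2 : ℤ) ∣ v := by
  rintro ⟨w, rfl⟩
  obtain ⟨Q, hQ⟩ := FZ_even u w
  refine odd_pow_ne Int.prime_two (3 * u ^ 30 + 2 * Q) ?_ 10 y (by rw [hy, hQ])
  intro h
  have h1 : (2 : ℤ) ∣ 3 * u ^ 30 := (dvd_add_left (Dvd.intro Q rfl)).1 h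
  rcases Int.prime_two.dvd_or_dvd h1 with h2 | h2
  · norm_num at h2
  · have h3 := Int.prime_two.dvd_of_dvd_pow h2
    exact Int.prime_two.not_unit (hc.isUnit_of_dvd' h3 (Dvd.intro w rfl))

theorem three_dvd (u v y : ℤ) (hc : IsCoprime u v) (hy : y ^ 2 = FZ u v) : (3 : ℤ) ∣ u ∧ ¬ (3 : ℤ) ∣ v := by
  have key : (3 : ℤ) ∣ u := by
    by_contra hu
    have h1 := FZ_congr (M := ((9 : ℕ) : ℤ)) (a := u) (b := v) (c := ((u % 9).toNat : ℤ))
      (d := ((v % 9).toNat : ℤ)) (by clear * -; omega) (by clear * -; omega)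
    rw [← hy] at h1
    have h2 := sq_mask 9 147 (by norm_num) (by decide) y _ h1
    have h3 := dec9 _ (by clear * -; omega) _ (by clear * -; omega) h2
    have h4 : (3 : ℤ) ∣ u + v := by
      clear h1 h2 hy hc
      omega
    obtain ⟨w, hw⟩ := h4
    obtain ⟨Q, hQ⟩ := FZ_three v (w - v)
    have h5 : 2 * v + 3 * (w - v) = u := by linear_combination -hw
    rw [h5] at hQ
    refine odd_pow_ne Int.prime_three _ ?_ 4 y (by rw [hy, hQ])
    intro h
    have h6 := (dvd_add_left (Dvd.intro Q rfl)).1 h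
    rcases Int.prime_three.dvd_or_dvd h6 with h7 | h7
    · norm_num at h7
    · have h8 := Int.prime_three.dvd_of_dvd_pow h7
      apply hu
      have h9 := dvd_sub (Dvd.intro w hw.symm) h8
      simpa using h9
  refine ⟨key, fun h => Int.prime_three.not_unit (hc.isUnit_of_dvd' key h)⟩

theorem not_four (u v y : ℤ) (hc : IsCoprime u v) (hy : y ^ 2 = FZ u v) (hv : ¬ (5 : ℤ) ∣ v) : (5 : ℤ) ∣ u - v := by
  have p5 : Prime (5 : ℤ) := Nat.prime_iff_prime_int.1 (by norm_num : Nat.Prime 5)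
  have hcop : IsCoprime v ((25 : ℕ) : ℤ) := by
    have : IsCoprime v (5 : ℤ) := ((p5.coprime_iff_not_dvd).2 hv).symm
    have h2 := this.pow_right (n := 2)
    norm_num at h2
    exact h2
  obtain ⟨r, hr, hd⟩ := exists_ratio 25 (by norm_num) u v hcop
  obtain ⟨s, hs⟩ := sq_ratio 25 u v y hcop hy r hd
  have h2 := sq_mask 25 19483219 (by norm_num) (by decide) s _ hs
  have h5 : (5 : ℤ) ∣ u - r * v := dvd_trans (by norm_num) hd
  rcases dec25 r hr h2 with h | h
  · have h6 : (5 : ℤ) ∣ ((r : ℤ) - 1) * v := Dvd.dvd.mul_right (by clear * - h; omega) _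
    have h7 := dvd_add h5 h6
    have h8 : u - r * v + ((r : ℤ) - 1) * v = u - v := by ring
    rwa [h8] at h7
  · exfalso
    have h6 : (5 : ℤ) ∣ ((r : ℤ) - 4) * v := Dvd.dvd.mul_right (by clear * - h; omega) _
    have h7 := dvd_add h5 h6
    obtain ⟨w, hw⟩ := h7
    obtain ⟨Q, hQ⟩ := FZ_five v w
    have h8 : 4 * v + 5 * w = u := by linear_combination -hw
    rw [h8] at hQ
    refine odd_pow_ne p5 _ ?_ 2 y (by rw [hy, hQ])
    intro h
    have h6 := (dvd_add_left (Dvd.intro Q rfl)).1 h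
    rcases p5.dvd_or_dvd h6 with h7 | h7
    · norm_num at h7
    · exact hv (p5.dvd_of_dvd_pow h7)

theorem zm3 : ∀ v : ZMod 3, v ≠ 0 → x0 0 v = 2 ∧ x0 0 v + 2 * x1 0 v + x2 0 v + x3 0 v = 1 ∧ FZ 0 v ≠ 0 := by
  decide +kernel

theorem zm5a : ∀ v : ZMod 5, v ≠ 0 → x0 v v + x2 v v + x3 v v = 1 ∨ x0 v v + x2 v v + x3 v v = 4 := by
  decide +kernel

theorem zm5b : ∀ u : ZMod 5, u ≠ 0 → x0 u 0 + x2 u 0 + x3 u 0 = 1 ∨ x0 u 0 + x2 u 0 + x3 u 0 = 4 := by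
  decide +kernel

theorem cast_x (p : ℕ) (u v : ℤ) : ((x0 u v : ℤ) : ZMod p) = x0 (u : ZMod p) v ∧
    ((x1 u v : ℤ) : ZMod p) = x1 (u : ZMod p) v ∧ ((x2 u v : ℤ) : ZMod p) = x2 (u : ZMod p) v ∧
    ((x3 u v : ℤ) : ZMod p) = x3 (u : ZMod p) v ∧ ((FZ u v : ℤ) : ZMod p) = FZ (u : ZMod p) v :=
  ⟨x0_hom (Int.castRingHom (ZMod p)) u v, x1_hom (Int.castRingHom (ZMod p)) u v,
    x2_hom (Int.castRingHom (ZMod p)) u v, x3_hom (Int.castRingHom (ZMod p)) u v,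
    FZ_hom _ _ (Int.castRingHom (ZMod p)) u v⟩

theorem hh_XV (u v y : ℤ) (hc : IsCoprime u v) (hy : y ^ 2 = FZ u v) :
    hh1 (XV u v) = 2 ∧ hh2 (XV u v) = 1 ∧ y ≠ 0 := by
  obtain ⟨hu, hv⟩ := three_dvd u v y hc hy
  obtain ⟨e0, e1, e2, e3, eF⟩ := cast_x 3 u v
  have hu' : ((u : ℤ) : ZMod 3) = 0 := (ZMod.intCast_zmod_eq_zero_iff_dvd u 3).2 hu
  have hv' : ((v : ℤ) : ZMod 3) ≠ 0 := fun h => hv ((ZMod.intCast_zmod_eq_zero_iff_dvd v 3).1 h)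
  obtain ⟨a1, a2, a3⟩ := zm3 _ hv'
  refine ⟨?_, ?_, ?_⟩
  · simp only [hh1, XV]
    rw [e0, hu', a1]
  · simp only [hh2, XV]
    push_cast
    rw [e0, e1, e2, e3, hu', a2]
  · rintro rfl
    apply a3
    rw [hu', ← hy] at eF
    rw [← eF]
    simp

theorem hh5_XV (u v y : ℤ) (hc : IsCoprime u v) (hy : y ^ 2 = FZ u v) :
    hh5 (XV u v) = 1 ∨ hh5 (XV u v) = 4 := by
  obtain ⟨e0, e1, e2, e3, eF⟩ := cast_x 5 u v
  simp only [hh5, XV]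
  push_cast
  rw [e0, e2, e3]
  by_cases hv : (5 : ℤ) ∣ v
  · have hv' : ((v : ℤ) : ZMod 5) = 0 := (ZMod.intCast_zmod_eq_zero_iff_dvd v 5).2 hv
    have p5 : Prime (5 : ℤ) := Nat.prime_iff_prime_int.1 (by norm_num : Nat.Prime 5)
    have hu' : ((u : ℤ) : ZMod 5) ≠ 0 := fun h =>
      p5.not_unit (hc.isUnit_of_dvd' ((ZMod.intCast_zmod_eq_zero_iff_dvd u 5).1 h) hv)
    rw [hv']
    exact zm5b _ hu'
  · have hd := not_four u v y hc hy hv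
    have hv' : ((v : ℤ) : ZMod 5) ≠ 0 := fun h => hv ((ZMod.intCast_zmod_eq_zero_iff_dvd v 5).1 h)
    have hu' : ((u : ℤ) : ZMod 5) = v := by
      have := (ZMod.intCast_zmod_eq_zero_iff_dvd (u - v) 5).2 hd
      push_cast at this
      exact sub_eq_zero.1 this
    rw [hu']
    exact zm5a _ hv'

theorem dvd_of_co {M : ℤ} {a : V} (h0 : M ∣ a.c0) (h1 : M ∣ a.c1) (h2 : M ∣ a.c2) (h3 : M ∣ a.c3) (h4 : M ∣ a.c4) :
    ∃ d : V, a = (M : V) * d := by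
  obtain ⟨d0, h0⟩ := h0
  obtain ⟨d1, h1⟩ := h1
  obtain ⟨d2, h2⟩ := h2
  obtain ⟨d3, h3⟩ := h3
  obtain ⟨d4, h4⟩ := h4
  refine ⟨⟨d0, d1, d2, d3, d4⟩, ?_⟩
  ext <;> simp [mul_c0, mul_c1, mul_c2, mul_c3, mul_c4, h0, h1, h2, h3, h4]

theorem intmul_co (n : ℤ) (a : V) : ((n : V) * a).c0 = n * a.c0 ∧ ((n : V) * a).c1 = n * a.c1 ∧
    ((n : V) * a).c2 = n * a.c2 ∧ ((n : V) * a).c3 = n * a.c3 ∧ ((n : V) * a).c4 = n * a.c4 := by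
  refine ⟨?_, ?_, ?_, ?_, ?_⟩ <;> simp [mul_c0, mul_c1, mul_c2, mul_c3, mul_c4]

theorem loc_XV (u v y : ℤ) (hc : IsCoprime u v) (hy : y ^ 2 = FZ u v) :
    ∃ a d : V, (a.c0 + a.c3 + a.c4) % 2 = 1 ∧ XV u v = rh ^ 6 * (a ^ 2 + k3 * d) := by
  have hv := v_odd u v y hc hy
  have hcop : IsCoprime v ((128 : ℕ) : ℤ) := by
    have : IsCoprime v (2 : ℤ) := ((Int.prime_two.coprime_iff_not_dvd).2 hv).symm
    have h2 := this.pow_right (n := 7)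
    norm_num at h2
    exact h2
  obtain ⟨r, hr, hd⟩ := exists_ratio 128 (by norm_num) u v hcop
  obtain ⟨s, hs⟩ := sq_ratio 128 u v y hcop hy r hd
  have h2 := sq_mask 128 2668882576834431627811302641479385619 (by norm_num) (by decide) s _ hs
  have h3 := dec128 r hr h2
  rw [List.any_eq_true] at h3
  obtain ⟨s, hs4, h3⟩ := h3
  have hso := s4_odd s hs4
  simp only [d32, Bool.and_eq_true, beq_iff_eq] at h3
  obtain ⟨⟨⟨⟨m0, m1⟩, m2⟩, m3⟩, m4⟩ := h3
  obtain ⟨d, hd1⟩ := dvd_of_co (Int.dvd_of_emod_eq_zero m0) (Int.dvd_of_emod_eq_zero m1)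
    (Int.dvd_of_emod_eq_zero m2) (Int.dvd_of_emod_eq_zero m3) (Int.dvd_of_emod_eq_zero m4)
  have hv1 : ((128 : ℕ) : ℤ) ∣ v - 1 * v := by simp
  obtain ⟨i0, i1, i2, i3, i4⟩ := intmul_co (v ^ 6) (XV r 1)
  obtain ⟨e, he⟩ := dvd_of_co (M := 128) (a := XV u v - ((v ^ 6 : ℤ) : V) * XV r 1)
    (by have := x0_congr hd hv1; rw [x0_smul] at this; rw [sub_c0, i0]; exact this)
    (by have := x1_congr hd hv1; rw [x1_smul] at this; rw [sub_c1, i1]; exact this)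
    (by have := x2_congr hd hv1; rw [x2_smul] at this; rw [sub_c2, i2]; exact this)
    (by have := x3_congr hd hv1; rw [x3_smul] at this; rw [sub_c3, i3]; exact this)
    (by have := x4_congr hd hv1; rw [x4_smul] at this; rw [sub_c4, i4]; exact this)
  refine ⟨((v ^ 3 : ℤ) : V) * s, ((v ^ 6 : ℤ) : V) * d + 4 * Lp * e, ?_, ?_⟩
  · obtain ⟨i0, i1, i2, i3, i4⟩ := intmul_co (v ^ 3) s
    rw [i0, i3, i4, ← mul_add, ← mul_add, Int.mul_emod, hso]
    have : v ^ 3 % 2 = 1 := by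
      have h1 : ¬ (2 : ℤ) ∣ v ^ 3 := fun h => hv (Int.prime_two.dvd_of_dvd_pow h)
      clear * - h1
      omega
    rw [this]
    rfl
  · have h32 : (32 : V) ≠ 0 := by decide
    have := SK.isDomain
    apply mul_left_cancel₀ h32
    rw [rh6_eq]
    push_cast at hd1 he ⊢
    have e1 := Lp_eq
    linear_combination (rh6 * k3 * (v : V) ^ 6) * hd1 + (XV u v - rh6 * (v : V) ^ 6 * s ^ 2) * (-e1)
      + (rh6 * k3 * Lp) * he

theorem nm_rh6 : nm rh6 = 64 := by
  rw [nm_eq]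
  decide +kernel

theorem local_main (u v y : ℤ) (hc : IsCoprime u v) (hy : y ^ 2 = FZ u v) :
    ∃ z : V, XV u v = rh ^ 6 * z ∧ Good z ∧ nm z = (4 * y) ^ 2 ∧ y ≠ 0 := by
  obtain ⟨a, d, ho, h⟩ := loc_XV u v y hc hy
  obtain ⟨a1, a2, hy0⟩ := hh_XV u v y hc hy
  have a5 := hh5_XV u v y hc hy
  have hn : nm (a ^ 2 + k3 * d) = (4 * y) ^ 2 := by
    have h1 := nm_XV u v
    rw [h, rh6_eq, SK.nm_mul, nm_rh6, ← hy] at h1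
    clear * - h1
    linarith
  refine ⟨a ^ 2 + k3 * d, h, ⟨?_, ?_, ?_, ?_, ⟨a, d, ho, rfl⟩, ⟨_, hn⟩⟩, hn, hy0⟩
  · intro h0
    rw [h0] at hn
    have : nm (0 : V) = 0 := by rw [nm_eq]; decide
    rw [this] at hn
    have h2 := pow_eq_zero_iff (two_ne_zero) |>.1 hn.symm
    exact hy0 (by clear * - h2; omega)
  · rw [h, rh6_eq, hh1_mul] at a1
    have : hh1 rh6 = 1 := by decide
    rw [this, one_mul] at a1
    exact a1
  · rw [h, rh6_eq, hh2_mul] at a2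
    have : hh2 rh6 = 1 := by decide
    rw [this, one_mul] at a2
    exact a2
  · rw [h, rh6_eq, hh5_mul] at a5
    have : hh5 rh6 = 4 := by decide
    rw [this] at a5
    revert a5
    generalize hh5 (a ^ 2 + k3 * d) = t
    revert t
    decide

end V

end

section

namespace V

theorem mem_of_nil {P : Ideal V} (hP : P.IsPrime) {p a w : V} {k : ℕ} (hp : p ∈ P) (h : a ^ k = p * w) : a ∈ P :=
  hP.mem_of_pow_mem k (by rw [h]; exact P.mul_mem_right _ hp)

/-- The residue map at the second prime above two. -/
def pp2 : V →+* ZMod 2 := lift 0 0 1 1 (by constructor <;> decide)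

theorem pp2_apply (a : V) : pp2 a = ((a.c0 + a.c3 + a.c4 : ℤ) : ZMod 2) := by
  rw [pp2, lift_apply]
  push_cast
  ring

theorem mem_two {P : Ideal V} (hP : P.IsPrime) (h2 : (2 : V) ∈ P) (a : V) (h : a.c0 % 2 = 0)
    (h' : (a.c0 + a.c3 + a.c4) % 2 = 0) : a ∈ P := by
  have n1 : (⟨0, 1, 0, 0, 0⟩ : V) ∈ P := mem_of_nil hP (k := 4) (w := ⟨-12, 11, -4, -4, -1⟩) h2 (by decide)
  have n2 : (⟨0, 0, 1, 0, 0⟩ : V) ∈ P := mem_of_nil hP (k := 4) (w := ⟨-12, 3, 20, 0, 3⟩) h2 (by decide)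
  have n3 : (⟨0, 0, 0, 1, 1⟩ : V) ∈ P := mem_of_nil hP (k := 2) (w := ⟨0, 8, -1, -1, 2⟩) h2 (by decide)
  obtain ⟨k, hk⟩ : ∃ k, a.c0 = 2 * k := ⟨a.c0 / 2, by clear * - h; omega⟩
  obtain ⟨l, hl⟩ : ∃ l, a.c4 = a.c3 + 2 * l := ⟨(a.c4 - a.c3) / 2, by clear * - h h'; omega⟩
  have e : a = (a.c1 : V) * ⟨0, 1, 0, 0, 0⟩ + (a.c2 : V) * ⟨0, 0, 1, 0, 0⟩ + (a.c3 : V) * ⟨0, 0, 0, 1, 1⟩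
      + ⟨k, 0, 0, 0, l⟩ * 2 := by
    ext <;> simp [mul_c0, mul_c1, mul_c2, mul_c3, mul_c4, hk, hl] <;> ring
  rw [e]
  exact P.add_mem (P.add_mem (P.add_mem (P.mul_mem_left _ n1) (P.mul_mem_left _ n2)) (P.mul_mem_left _ n3))
    (P.mul_mem_left _ h2)

theorem mem_three {P : Ideal V} (hP : P.IsPrime) (h3 : (3 : V) ∈ P) (a : V) (h : hh1 a = 0)
    (h' : hh2 a = 0) : a ∈ P := by
  have n1 : (⟨0, 0, 0, 0, 1⟩ : V) ∈ P := mem_of_nil hP (k := 3) (w := ⟨-6, 10, -8, -1, 0⟩) h3 (by decide)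
  have n2 : (⟨0, 1, 1, 0, 0⟩ : V) ∈ P := mem_of_nil hP (k := 3) (w := ⟨24, 8, -4, -8, 0⟩) h3 (by decide)
  have n3 : (⟨0, 1, 0, 1, 0⟩ : V) ∈ P := mem_of_nil hP (k := 2) (w := ⟨-4, 0, 1, 0, -1⟩) h3 (by decide)
  have g : (3 : ℤ) ∣ a.c0 := (ZMod.intCast_zmod_eq_zero_iff_dvd _ 3).1 h
  have g' : (3 : ℤ) ∣ a.c0 + 2 * a.c1 + a.c2 + a.c3 := (ZMod.intCast_zmod_eq_zero_iff_dvd _ 3).1 h'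
  obtain ⟨k, hk⟩ := g
  obtain ⟨l, hl⟩ : ∃ l, a.c1 = a.c2 + a.c3 + 3 * l := ⟨(a.c1 - a.c2 - a.c3) / 3, by clear * - hk g'; omega⟩
  have e : a = (a.c4 : V) * ⟨0, 0, 0, 0, 1⟩ + (a.c2 : V) * ⟨0, 1, 1, 0, 0⟩ + (a.c3 : V) * ⟨0, 1, 0, 1, 0⟩
      + ⟨k, l, 0, 0, 0⟩ * 3 := by
    ext <;> simp [mul_c0, mul_c1, mul_c2, mul_c3, mul_c4, hk, hl] <;> ring
  rw [e]
  exact P.add_mem (P.add_mem (P.add_mem (P.mul_mem_left _ n1) (P.mul_mem_left _ n2)) (P.mul_mem_left _ n3))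
    (P.mul_mem_left _ h3)

theorem mem_five {P : Ideal V} (hP : P.IsPrime) (h5 : (5 : V) ∈ P) (a : V) (h : hh5 a = 0) : a ∈ P := by
  have n1 : (⟨0, 1, 0, 0, 0⟩ : V) ∈ P := mem_of_nil hP (k := 5) (w := ⟨12, -10, 4, -4, -4⟩) h5 (by decide)
  have n2 : (⟨0, 0, 0, 0, 1⟩ : V) ∈ P := mem_of_nil hP (k := 5) (w := ⟨-126, -30, -12, -18, -93⟩) h5 (by decide)
  have n3 : (⟨-1, 0, 1, 0, 0⟩ : V) ∈ P := mem_of_nil hP (k := 5) (w := ⟨79, 10, -57, -18, -8⟩) h5 (by decide)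
  have n4 : (⟨-1, 0, 0, 1, 0⟩ : V) ∈ P := mem_of_nil hP (k := 5) (w := ⟨-167, -80, -39, 84, -11⟩) h5 (by decide)
  have g : (5 : ℤ) ∣ a.c0 + a.c2 + a.c3 := (ZMod.intCast_zmod_eq_zero_iff_dvd _ 5).1 h
  obtain ⟨k, hk⟩ := g
  have hk' : a.c0 = 5 * k - a.c2 - a.c3 := by linear_combination hk
  have e : a = (a.c1 : V) * ⟨0, 1, 0, 0, 0⟩ + (a.c4 : V) * ⟨0, 0, 0, 0, 1⟩ + (a.c2 : V) * ⟨-1, 0, 1, 0, 0⟩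
      + (a.c3 : V) * ⟨-1, 0, 0, 1, 0⟩ + ⟨k, 0, 0, 0, 0⟩ * 5 := by
    ext <;> simp [mul_c0, mul_c1, mul_c2, mul_c3, mul_c4, hk'] <;> ring
  rw [e]
  exact P.add_mem (P.add_mem (P.add_mem (P.add_mem (P.mul_mem_left _ n1) (P.mul_mem_left _ n2))
    (P.mul_mem_left _ n3)) (P.mul_mem_left _ n4)) (P.mul_mem_left _ h5)

theorem one_not {P : Ideal V} (hP : P.IsPrime) {z w : V} (hz : z ∈ P) (h : z * w - 1 ∈ P) : False := by
  apply hP.ne_top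
  rw [Ideal.eq_top_iff_one]
  have := P.sub_mem (P.mul_mem_right w hz) h
  simpa using this

/-- The element avoids all primes above 2, 3, 5. -/
structure Cop (z : V) : Prop where
  p1 : z.c0 % 2 = 1
  p2 : (z.c0 + z.c3 + z.c4) % 2 = 1
  h1 : hh1 z ≠ 0
  h2 : hh2 z ≠ 0
  h5 : hh5 z ≠ 0

theorem Cop.two {z : V} (h : Cop z) {P : Ideal V} (hP : P.IsPrime) (hz : z ∈ P) : (2 : V) ∉ P := by
  intro h2
  have a := h.p1
  have b := h.p2
  refine one_not hP hz (w := 1) (mem_two hP h2 _ ?_ ?_)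
  · rw [mul_one, sub_c0, one_c0]
    clear * - a
    omega
  · rw [mul_one, sub_c0, one_c0, sub_c3, sub_c4, one_c3, one_c4]
    clear * - b
    omega

theorem hh1_sub_one (a : V) : hh1 (a - 1) = hh1 a - 1 := by
  simp [hh1]

theorem hh2_sub_one (a : V) : hh2 (a - 1) = hh2 a - 1 := by
  simp [hh2]
  ring

theorem hh5_sub_one (a : V) : hh5 (a - 1) = hh5 a - 1 := by
  simp [hh5]
  ring

theorem sq3 : ∀ t : ZMod 3, t ≠ 0 → t * t - 1 = 0 := by decide
theorem sq5 : ∀ t : ZMod 5, t ≠ 0 → t * (t * (t * t)) - 1 = 0 := by decide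

theorem Cop.three {z : V} (h : Cop z) {P : Ideal V} (hP : P.IsPrime) (hz : z ∈ P) : (3 : V) ∉ P := by
  intro h3
  refine one_not hP hz (w := z) (mem_three hP h3 _ ?_ ?_)
  · rw [hh1_sub_one, hh1_mul]
    exact sq3 _ h.h1
  · rw [hh2_sub_one, hh2_mul]
    exact sq3 _ h.h2

theorem Cop.five {z : V} (h : Cop z) {P : Ideal V} (hP : P.IsPrime) (hz : z ∈ P) : (5 : V) ∉ P := by
  intro h3
  refine one_not hP hz (w := z * (z * z)) (mem_five hP h3 _ ?_)
  rw [hh5_sub_one, hh5_mul, hh5_mul, hh5_mul]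
  exact sq5 _ h.h5

theorem isCop {a b : V} (h : ∀ P : Ideal V, P.IsPrime → a ∈ P → b ∈ P → False) : IsCoprime a b := by
  rw [← Ideal.isCoprime_span_singleton_iff, Ideal.isCoprime_iff_sup_eq]
  by_contra hne
  obtain ⟨M, hM, hle⟩ := Ideal.exists_le_maximal _ hne
  exact h M hM.isPrime (hle (Ideal.mem_sup_left (Ideal.mem_span_singleton_self a)))
    (hle (Ideal.mem_sup_right (Ideal.mem_span_singleton_self b)))

theorem not_mem_of_dvd {P : Ideal V} {a b n : V} (h : a * b = n) (hn : n ∉ P) : a ∉ P := fun ha =>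
  hn (h ▸ P.mul_mem_right b ha)

theorem Cop.n {z : V} (hz : Cop z) {P : Ideal V} (hP : P.IsPrime) (hzP : z ∈ P) (a b c : ℕ) :
    ((2 ^ a * 3 ^ b * 5 ^ c : ℕ) : V) ∉ P := by
  push_cast
  intro h
  rcases hP.mem_or_mem h with h | h
  · rcases hP.mem_or_mem h with h | h
    · exact hz.two hP hzP (hP.mem_of_pow_mem _ h)
    · exact hz.three hP hzP (hP.mem_of_pow_mem _ h)
  · exact hz.five hP hzP (hP.mem_of_pow_mem _ h)

theorem Cop.tau {z : V} (hz : Cop z) {P : Ideal V} (hP : P.IsPrime) (hzP : z ∈ P) : tau ∉ P :=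
  not_mem_of_dvd (b := ⟨-3, 2, -1, 0, -1⟩) (n := ((2 ^ 1 * 3 ^ 1 * 5 ^ 0 : ℕ) : V)) (by decide) (hz.n hP hzP 1 1 0)

theorem Cop.lam {z : V} (hz : Cop z) {P : Ideal V} (hP : P.IsPrime) (hzP : z ∈ P) : lam ∉ P :=
  not_mem_of_dvd (b := ⟨-3, -2, 1, 0, 1⟩) (n := ((2 ^ 2 * 3 ^ 2 * 5 ^ 0 : ℕ) : V)) (by decide) (hz.n hP hzP 2 2 0)

theorem Cop.pi1 {z : V} (hz : Cop z) {P : Ideal V} (hP : P.IsPrime) (hzP : z ∈ P) : pi1 ∉ P :=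
  not_mem_of_dvd (b := ⟨-5, 0, -5, -6, 3⟩) (n := ((2 ^ 1 * 3 ^ 0 * 5 ^ 0 : ℕ) : V)) (by decide) (hz.n hP hzP 1 0 0)

theorem Cop.rh {z : V} (hz : Cop z) {P : Ideal V} (hP : P.IsPrime) (hzP : z ∈ P) : rh ∉ P :=
  not_mem_of_dvd (b := ⟨70, 23, 17, -36, -2⟩) (n := ((2 ^ 1 * 3 ^ 0 * 5 ^ 0 : ℕ) : V)) (by decide) (hz.n hP hzP 1 0 0)

/-- No prime of good residue contains both `FZ` and `HZ`. -/
theorem FH {z : V} (hz : Cop z) {P : Ideal V} (hP : P.IsPrime) (hzP : z ∈ P) (u v : ℤ) (hc : IsCoprime u v)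
    (hF : ((FZ u v : ℤ) : V) ∈ P) (hH : ((HZ u v : ℤ) : V) ∈ P) : False := by
  obtain ⟨A, B, h⟩ := bezout u v
  have h1 : ((2 ^ 4 * 3 ^ 17 * 5 ^ 9 : ℕ) : V) * (v : V) ^ 41 ∈ P := by
    have h2 := congrArg (Int.cast : ℤ → V) h
    push_cast at h2
    have h3 : ((2 ^ 4 * 3 ^ 17 * 5 ^ 9 : ℕ) : V) = 4035630093750000 := by decide
    rw [h3, ← h2]
    exact P.add_mem (P.mul_mem_left _ hF) (P.mul_mem_left _ hH)
  have hv : (v : V) ∈ P := by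
    rcases hP.mem_or_mem h1 with h2 | h2
    · exact absurd h2 (hz.n hP hzP _ _ _)
    · exact hP.mem_of_pow_mem _ h2
  have h2 : v ∣ FZ u v - FZ u 0 := FZ_congr (by simp) (by simp)
  obtain ⟨Q, hQ⟩ := h2
  have h0 : FZ u 0 = 6291456 * u ^ 30 := by
    simp only [FZ]
    ring
  rw [h0] at hQ
  have h3 : ((2 ^ 21 * 3 ^ 1 * 5 ^ 0 : ℕ) : V) * (u : V) ^ 30 ∈ P := by
    have h4 := congrArg (Int.cast : ℤ → V) hQ
    push_cast at h4
    have h3 : ((2 ^ 21 * 3 ^ 1 * 5 ^ 0 : ℕ) : V) = 6291456 := by decide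
    have h5 : (6291456 : V) * (u : V) ^ 30 = ((FZ u v : ℤ) : V) - v * Q := by linear_combination -h4
    rw [h3, h5]
    exact P.sub_mem hF (P.mul_mem_right _ hv)
  have hu : (u : V) ∈ P := by
    rcases hP.mem_or_mem h3 with h2 | h2
    · exact absurd h2 (hz.n hP hzP _ _ _)
    · exact hP.mem_of_pow_mem _ h2
  obtain ⟨a, b, hab⟩ := hc
  apply hP.ne_top
  rw [Ideal.eq_top_iff_one]
  have h4 := congrArg (Int.cast : ℤ → V) hab
  push_cast at h4
  rw [← h4]
  exact P.add_mem (P.mul_mem_left _ hu) (P.mul_mem_left _ hv)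

/-- The cofactor is coprime to `z`. -/
theorem cop_w {z : V} (hz : Cop z) (u v y : ℤ) (hc : IsCoprime u v) (hy : y ^ 2 = FZ u v) (k : ℕ)
    (h : XV u v = rh ^ 6 * (pi1 ^ k * z)) : IsCoprime z (rh ^ 6 * pi1 ^ k * lam * QV u v) := by
  apply isCop
  intro P hP hzP hw
  have hq : QV u v ∈ P := by
    rcases hP.mem_or_mem hw with h1 | h1
    · exfalso
      rcases hP.mem_or_mem h1 with h1 | h1
      · rcases hP.mem_or_mem h1 with h1 | h1
        · exact hz.rh hP hzP (hP.mem_of_pow_mem _ h1)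
        · exact hz.pi1 hP hzP (hP.mem_of_pow_mem _ h1)
      · exact hz.lam hP hzP h1
    · exact h1
  have hx : XV u v ∈ P := by
    rw [h]
    exact P.mul_mem_left _ (P.mul_mem_left _ hzP)
  have ht : TV u v ∈ P := by
    have h1 := P.mul_mem_left lam hx
    rw [lam_XV] at h1
    rcases hP.mem_or_mem h1 with h2 | h2
    · exfalso
      rcases hP.mem_or_mem h2 with h3 | h3
      · have h4 := hz.n hP hzP 2 0 0
        apply h4
        have h5 : ((2 ^ 2 * 3 ^ 0 * 5 ^ 0 : ℕ) : V) = - (-4) := by decide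
        rw [h5]
        exact P.neg_mem h3
      · exact hz.tau hP hzP h3
    · exact h2
  have ht2 : T2 u v ∈ P := by
    rw [← TV_sq]
    exact P.mul_mem_left _ ht
  have hF : ((FZ u v : ℤ) : V) ∈ P := by
    have h1 := P.mul_mem_left (TV u v) hq
    rw [TV_QV] at h1
    have h2 : ((648 * FZ u v : ℤ) : V) = ((2 ^ 3 * 3 ^ 4 * 5 ^ 0 : ℕ) : V) * ((FZ u v : ℤ) : V) := by
      push_cast
      ring
    rw [h2] at h1
    rcases hP.mem_or_mem h1 with h3 | h3
    · exact absurd h3 (hz.n hP hzP _ _ _)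
    · exact h3
  have hH : ((HZ u v : ℤ) : V) ∈ P := by
    have h1 : ((2 ^ 0 * 3 ^ 4 * 5 ^ 1 : ℕ) : V) * ((HZ u v : ℤ) : V) ^ 2 ∈ P := by
      have h2 : ((2 ^ 0 * 3 ^ 4 * 5 ^ 1 : ℕ) : V) * ((HZ u v : ℤ) : V) ^ 2 =
          QV u v - (T2 u v + 30 * ((HZ u v : ℤ) : V)) * T2 u v := by
        rw [QV_eq]
        push_cast
        ring
      rw [h2]
      exact P.sub_mem hq (P.mul_mem_left _ ht2)
    rcases hP.mem_or_mem h1 with h3 | h3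
    · exact absurd h3 (hz.n hP hzP _ _ _)
    · exact hP.mem_of_pow_mem _ h3
  exact FH hz hP hzP u v hc hF hH

theorem cop_T {z : V} (hz : Cop z) : IsCoprime z (-2592 * tau) := by
  apply isCop
  intro P hP hzP hw
  rcases hP.mem_or_mem hw with h1 | h1
  · apply hz.n hP hzP 5 4 0
    have h5 : ((2 ^ 5 * 3 ^ 4 * 5 ^ 0 : ℕ) : V) = - (-2592) := by decide
    rw [h5]
    exact P.neg_mem h1
  · exact hz.tau hP hzP h1

/-- A coprime complementary divisor of a square. -/
theorem exists_compl {z : V} (hz : Cop z) (u v y : ℤ) (hc : IsCoprime u v) (hy : y ^ 2 = FZ u v) (k : ℕ)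
    (h : XV u v = rh ^ 6 * (pi1 ^ k * z)) : ∃ b : V, IsCoprime z b ∧ z * b = (y : V) ^ 2 := by
  have hw := cop_w hz u v y hc hy k h
  have hprod : z * (rh ^ 6 * pi1 ^ k * lam * QV u v) = -2592 * tau * (y : V) ^ 2 := by
    have h1 := TV_QV u v
    rw [← hy] at h1
    push_cast at h1
    have h2 := lam_XV u v
    rw [h] at h2
    linear_combination QV u v * h2 - 4 * tau * h1
  have hT : (-2592 * tau : V) ∣ rh ^ 6 * pi1 ^ k * lam * QV u v :=
    (cop_T hz).symm.dvd_of_dvd_mul_left ⟨_, hprod⟩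
  obtain ⟨b, hb⟩ := hT
  rw [hb] at hw hprod
  refine ⟨b, hw.of_mul_right_right, ?_⟩
  have h0 : (-2592 * tau : V) ≠ 0 := by decide
  have := SK.isDomain
  apply mul_left_cancel₀ h0
  linear_combination hprod

end V

end

section

namespace V

theorem nm_pi1 : nm pi1 = -2 := by
  rw [nm_eq]
  decide +kernel

theorem nm_zero : nm (0 : V) = 0 := by
  rw [nm_eq]
  decide

theorem max_pow (n : ℕ) : ∀ a : V, a ≠ 0 → (nm a).natAbs ≤ n → ∃ k z, a = pi1 ^ k * z ∧ ¬ pi1 ∣ z := by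
  induction n with
  | zero =>
    intro a h0 h
    exact absurd (SK.nm_eq_zero (by omega)) h0
  | succ n ih =>
    intro a h0 h
    by_cases hd : pi1 ∣ a
    · obtain ⟨b, rfl⟩ := hd
      have hb : b ≠ 0 := right_ne_zero_of_mul h0
      have hnb : nm b ≠ 0 := fun h => hb (SK.nm_eq_zero h)
      rw [SK.nm_mul, nm_pi1, Int.natAbs_mul] at h
      obtain ⟨k, z, h1, h2⟩ := ih b hb (by
        have : (-2 : ℤ).natAbs = 2 := rfl
        rw [this] at h
        clear * - h hnb
        omega)
      exact ⟨k + 1, z, by rw [h1]; ring, h2⟩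
    · exact ⟨0, a, by simp, hd⟩

theorem nm_pow (a : V) (k : ℕ) : nm (a ^ k) = nm a ^ k := by
  induction k with
  | zero =>
    rw [pow_zero, pow_zero, nm_eq]
    decide
  | succ k ih => rw [pow_succ, SK.nm_mul, ih, pow_succ]

theorem absNorm_E (z : V) : Ideal.absNorm (Ideal.span {SK.E z}) = (nm z).natAbs := by
  rw [Ideal.absNorm_span_singleton]
  congr 1
  have h := SK.norm_e z
  rw [← Setup.E_coe, ← Algebra.coe_norm_int] at h
  exact_mod_cast h

theorem even_of (k m y : ℕ) (hy : y ≠ 0) (h : 2 ^ k * m ^ 2 = y ^ 2) : Even k := by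
  have hm : m ≠ 0 := by
    rintro rfl
    have h' : y ^ 2 = 0 := by rw [← h]; ring
    exact hy (by simpa using h')
  have h1 := congrArg (padicValNat 2) h
  rw [padicValNat.mul (by positivity) (by positivity), padicValNat.prime_pow, padicValNat.pow,
    padicValNat.pow] at h1
  rw [Nat.even_iff]
  omega

theorem pp2_good {z : V} (hz : Good z) : pp2 z ≠ 0 := by
  obtain ⟨a, d, ha, h⟩ := hz.loc
  have h1 : pp2 a = 1 := by
    rw [pp2_apply]
    have : a.c0 + a.c3 + a.c4 = 2 * ((a.c0 + a.c3 + a.c4) / 2) + 1 := by clear * - ha; omega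
    rw [this]
    push_cast
    have h2 : (2 : ZMod 2) = 0 := rfl
    rw [h2]
    ring
  have h2 : pp2 k3 = 0 := by
    rw [pp2_apply]
    decide
  rw [h, map_add, map_pow, map_mul, h1, h2, zero_mul]
  decide

theorem no_point (u v y : ℤ) (hc : IsCoprime u v) (hy : y ^ 2 = FZ u v) : False := by
  obtain ⟨z0, hx, hg, hn, hy0⟩ := local_main u v y hc hy
  obtain ⟨k, z, hk, hd⟩ := max_pow _ z0 hg.ne le_rfl
  have hcop : Cop z := by
    have g2 := pp2_good hg
    have g1 := hg.h1
    have g3 := hg.h2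
    have g5 := hg.h5
    rw [hk] at g2 g1 g3 g5
    rw [map_mul] at g2
    rw [hh1_mul] at g1
    rw [hh2_mul] at g3
    rw [hh5_mul] at g5
    refine ⟨?_, ?_, ?_, ?_, ?_⟩
    · have := mt (pi1_dvd z) hd
      clear * - this
      omega
    · have h1 := right_ne_zero_of_mul g2
      rw [pp2_apply, Ne, ZMod.intCast_zmod_eq_zero_iff_dvd] at h1
      clear * - h1
      push_cast at h1
      omega
    · intro h
      rw [h, mul_zero] at g1
      exact absurd g1 (by decide)
    · intro h
      rw [h, mul_zero] at g3
      exact absurd g3 (by decide)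
    · intro h
      rw [h, mul_zero] at g5
      exact absurd g5 (by decide)
  obtain ⟨b, hb, hzb⟩ := exists_compl hcop u v y hc hy k (by rw [hx, hk])
  have h1 : Ideal.span {SK.E z} * Ideal.span {SK.E b} = Ideal.span {SK.E (y : V)} ^ 2 := by
    rw [Ideal.span_singleton_mul_span_singleton, Ideal.span_singleton_pow, ← map_mul, ← map_pow, hzb]
  have h2 : IsCoprime (Ideal.span {SK.E z}) (Ideal.span {SK.E b}) := by
    rw [Ideal.isCoprime_span_singleton_iff]
    exact hb.map SK.E.toRingHom
  obtain ⟨J, hJ⟩ := exists_eq_pow_of_mul_eq_pow_of_coprime h2 h1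
  have h3 := congrArg Ideal.absNorm hJ
  rw [absNorm_E, map_pow] at h3
  have hkE : Even k := by
    apply even_of k (Ideal.absNorm J) (4 * y).natAbs
    · clear * - hy0
      omega
    · rw [hk, SK.nm_mul, nm_pow, nm_pi1] at hn
      have h4 := congrArg Int.natAbs hn
      rw [Int.natAbs_mul, Int.natAbs_pow, Int.natAbs_pow, h3] at h4
      exact h4
  obtain ⟨l, hl⟩ := hkE
  refine no_good z0 hg (Ideal.span {SK.E pi1} ^ l * J) ?_
  rw [mul_pow, ← hJ, ← pow_mul, mul_two, ← hl, Ideal.span_singleton_pow,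
    Ideal.span_singleton_mul_span_singleton, ← map_pow, ← map_mul, ← hk]

theorem no_point' (u v y : ℤ) (h0 : (u, v) ≠ (0, 0)) (hy : y ^ 2 = FZ u v) : False := by
  have hg : 0 < Int.gcd u v := by
    rw [Nat.pos_iff_ne_zero]
    intro h
    rw [Int.gcd_eq_zero_iff] at h
    exact h0 (Prod.ext h.1 h.2)
  obtain ⟨u', v', hc, hu, hv⟩ := Int.exists_gcd_one hg
  generalize Int.gcd u v = g at *
  have hgz : (g : ℤ) ≠ 0 := by
    clear * - hg
    omega
  rw [hu, hv, FZ_smul] at hy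
  have hd : ((g : ℤ) ^ 15) ^ 2 ∣ y ^ 2 := ⟨FZ u' v', by rw [hy]; ring⟩
  rw [Int.pow_dvd_pow_iff two_ne_zero] at hd
  obtain ⟨w, rfl⟩ := hd
  refine no_point u' v' w (Int.isCoprime_iff_gcd_eq_one.2 hc) ?_
  apply mul_left_cancel₀ (pow_ne_zero 30 hgz)
  rw [← hy]
  ring

end V

end

/-- The form `f` is homogeneous of degree 30 with integer coefficients, and the
genus-14 hyperelliptic curve `C_24 : y² = f(u,v)` has no rational points. -/
theorem rational_points_C24 :
    fC24.IsHomogeneous 30 ∧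
    (∀ m : Fin 2 →₀ ℕ, ∃ z : ℤ, coeff m fC24 = (z : ℚ)) ∧
    ¬ ∃ u v y : ℤ, (u, v) ≠ (0, 0) ∧
        (y : ℚ) ^ 2 = eval ![(u : ℚ), (v : ℚ)] fC24 := by
  refine ⟨fC24_hom, fC24_int, ?_⟩
  rintro ⟨u, v, y, h0, h⟩
  rw [fC24_eval] at h
  exact V.no_point' u v y h0 (by exact_mod_cast h)
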